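/- arXiv:1306.5572 — 10 statements merged into one kernel-verified Lean document; each statement's English description precedes it below -/
import Mathlib

section
/- Let (X, X̂, X̃) be a compactification pack and let E ⊆ X̂ × X̂. Then E belongs to the topological coarse structure on X̂ attached to the compactification X̃ if and only if for every x ∈ X and every neighborhood V of x in X̃ there is a neighborhood W of x in X̃ with (E ∪ E⁻¹)(W ∩ X̂) ⊆ V. -/
open Set Topology

/-- `E(A) = {y : ∃ x ∈ A, (y, x) ∈ E}`. -/
def eApply {Z : Type*} (E : Set (Z × Z)) (A : Set Z) : Set Z := {y | ∃ x ∈ A, (y, x) ∈ E}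

/-- `E⁻¹ = {(y,x) : (x,y) ∈ E}`. -/
def invRel {Z : Type*} (E : Set (Z × Z)) : Set (Z × Z) := {p | (p.2, p.1) ∈ E}

/-- `α(A) = ⋃ {U ∈ α : U ∩ A ≠ ∅}`. -/
def famApply {Z : Type*} (α : Set (Set Z)) (A : Set Z) : Set Z :=
  ⋃₀ {U ∈ α | (U ∩ A).Nonempty}

/-- `K` is relatively compact in the subspace `hX`: its closure in `hX` is compact. -/
def RelCptIn {T : Type*} [TopologicalSpace T] (hX K : Set T) : Prop :=
  IsCompact (closure K ∩ hX)

/-- `E` is proper: `E(K)` and `E⁻¹(K)` are relatively compact in `hX` for every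
relatively compact `K ⊆ hX`. -/
def IsProperFor {T : Type*} [TopologicalSpace T] (hX : Set T) (E : Set (T × T)) : Prop :=
  ∀ K : Set T, K ⊆ hX → RelCptIn hX K →
    RelCptIn hX (eApply E K) ∧ RelCptIn hX (eApply (invRel E) K)

/-- `E` belongs to the topological coarse structure on `X̂ = Xᶜ` attached to the
compactification `T`. -/
def MemTopCoarse {T : Type*} [TopologicalSpace T] (X : Set T) (E : Set (T × T)) : Prop :=
  E ⊆ Xᶜ ×ˢ Xᶜ ∧ IsProperFor Xᶜ E ∧
  ∀ x ∈ X, ∀ V ∈ 𝓝 x, ∃ W ∈ 𝓝 x, eApply E (W ∩ Xᶜ) ⊆ V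

section CoarseHelpers

variable {T : Type*}

theorem eApply_mono {E : Set (T × T)} {A B : Set T} (h : A ⊆ B) : eApply E A ⊆ eApply E B :=
  fun _ ⟨z, hz, hyz⟩ => ⟨z, h hz, hyz⟩

theorem eApply_union_right (E : Set (T × T)) (A B : Set T) :
    eApply E (A ∪ B) = eApply E A ∪ eApply E B := by
  ext y
  simp only [eApply, mem_union, mem_ofPred_eq, or_and_right, exists_or]

theorem eApply_union_left (E F : Set (T × T)) (A : Set T) :
    eApply (E ∪ F) A = eApply E A ∪ eApply F A := by
  ext y
  simp only [eApply, mem_union, mem_ofPred_eq, and_or_left, exists_or]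

theorem eApply_subset_of_subset_prod {E : Set (T × T)} {B : Set T} (hE : E ⊆ B ×ˢ B)
    (A : Set T) : eApply E A ⊆ B :=
  fun _ ⟨_, _, h⟩ => (hE h).1

theorem invRel_subset_prod {E : Set (T × T)} {B : Set T} (hE : E ⊆ B ×ˢ B) :
    invRel E ⊆ B ×ˢ B :=
  fun _ h => ⟨(hE h).2, (hE h).1⟩

variable [TopologicalSpace T]

theorem RelCptIn.closure_subset [T2Space T] {Y K : Set T} (hK : RelCptIn Y K) (hKY : K ⊆ Y) :
    closure K ⊆ Y :=
  (closure_minimal (subset_inter subset_closure hKY) (IsCompact.isClosed hK)).trans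
    inter_subset_right

theorem relCptIn_of_closure_subset [CompactSpace T] {Y K : Set T} (h : closure K ⊆ Y) :
    RelCptIn Y K := by
  rw [RelCptIn, inter_eq_left.mpr h]
  exact isClosed_closure.isCompact

/-- Continuity at infinity of `E⁻¹` makes the image under `E` of a relatively compact set
relatively compact. -/
theorem relCptIn_eApply [CompactSpace T] [T2Space T] {X K : Set T} {E : Set (T × T)}
    (hE : E ⊆ Xᶜ ×ˢ Xᶜ)
    (h : ∀ x ∈ X, ∀ V ∈ 𝓝 x, ∃ W ∈ 𝓝 x, eApply (invRel E) (W ∩ Xᶜ) ⊆ V)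
    (hKX : K ⊆ Xᶜ) (hK : RelCptIn Xᶜ K) : RelCptIn Xᶜ (eApply E K) := by
  refine relCptIn_of_closure_subset fun x hxcl hx => ?_
  obtain ⟨W, hW, hWV⟩ := h x hx (closure K)ᶜ
    (isClosed_closure.isOpen_compl.mem_nhds fun hxK => hK.closure_subset hKX hxK hx)
  obtain ⟨y, hyW, k, hk, hyk⟩ := mem_closure_iff_nhds.mp hxcl W hW
  exact hWV ⟨y, ⟨hyW, (hE hyk).1⟩, hyk⟩ (subset_closure hk)

/-- A member of the topological coarse structure has an inverse that is continuous at
infinity. -/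
theorem MemTopCoarse.exists_eApply_invRel_subset [CompactSpace T] [T2Space T] {X : Set T}
    (hX : IsClosed X) {E : Set (T × T)} (hE : MemTopCoarse X E) {x : T} (hx : x ∈ X)
    {V : Set T} (hV : V ∈ 𝓝 x) : ∃ W ∈ 𝓝 x, eApply (invRel E) (W ∩ Xᶜ) ⊆ V := by
  obtain ⟨hsub, hprop, hcont⟩ := hE
  obtain ⟨U, hUV, hU, hxU⟩ := mem_nhds_iff.mp hV
  have key : x ∉ closure (eApply E (Uᶜ ∩ Xᶜ)) := by
    refine hU.isClosed_compl.isCompact.induction_on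
      (p := fun S => x ∉ closure (eApply E (S ∩ Xᶜ))) ?_ ?_ ?_ ?_
    · simp [eApply]
    · exact fun s t hst ht hs =>
        ht (closure_mono (eApply_mono (inter_subset_inter_left _ hst)) hs)
    · intro s t hs ht
      rw [union_inter_distrib_right, eApply_union_right, closure_union]
      exact not_or.mpr ⟨hs, ht⟩
    · intro p hp
      by_cases hpX : p ∈ X
      · have hpx : p ≠ x := fun h => hp (h ▸ hxU)
        obtain ⟨C, hC, hCcl, hCx⟩ :=
          exists_mem_nhds_isClosed_subset (isOpen_ne.mem_nhds hpx)
        obtain ⟨W, hW, hWC⟩ := hcont p hpX C hC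
        exact ⟨W, mem_nhdsWithin_of_mem_nhds hW,
          fun h => hCx (closure_minimal hWC hCcl h) rfl⟩
      · obtain ⟨C, hC, hCcl, hCX⟩ :=
          exists_mem_nhds_isClosed_subset (hX.isOpen_compl.mem_nhds hpX)
        refine ⟨C, mem_nhdsWithin_of_mem_nhds hC, fun h => ?_⟩
        rw [inter_eq_left.mpr hCX] at h
        have hCc : RelCptIn Xᶜ C :=
          relCptIn_of_closure_subset (hCcl.closure_eq.trans_subset hCX)
        exact (hprop C hCX hCc).1.closure_subset (eApply_subset_of_subset_prod hsub C) h hx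
  refine ⟨_, isClosed_closure.isOpen_compl.mem_nhds key, ?_⟩
  rintro z ⟨y, ⟨hy, -⟩, hyz⟩
  by_contra hz
  exact hy (subset_closure ⟨z, ⟨fun h => hz (hUV h), (hsub hyz).2⟩, hyz⟩)

end CoarseHelpers

/-- For a compactification pack `(X, X̂, X̃)` and `E ⊆ X̂ × X̂`, `E`
belongs to the topological coarse structure iff for every `x ∈ X` and every
neighborhood `V` of `x` there is a neighborhood `W` of `x` with
`(E ∪ E⁻¹)(W ∩ X̂) ⊆ V`. -/
theorem statement3 {T : Type*} [TopologicalSpace T] [CompactSpace T] [T2Space T]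
    (X : Set T) (hXcl : IsClosed X) (hXnd : IsNowhereDense X)
    (E : Set (T × T)) (hE : E ⊆ Xᶜ ×ˢ Xᶜ) :
    MemTopCoarse X E ↔
      ∀ x ∈ X, ∀ V ∈ 𝓝 x, ∃ W ∈ 𝓝 x, eApply (E ∪ invRel E) (W ∩ Xᶜ) ⊆ V := by
  constructor
  · intro h x hx V hV
    obtain ⟨W₁, hW₁, h₁⟩ := h.2.2 x hx V hV
    obtain ⟨W₂, hW₂, h₂⟩ := h.exists_eApply_invRel_subset hXcl hx hV
    refine ⟨W₁ ∩ W₂, Filter.inter_mem hW₁ hW₂, ?_⟩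
    rw [eApply_union_left]
    exact union_subset
      ((eApply_mono (inter_subset_inter_left _ inter_subset_left)).trans h₁)
      ((eApply_mono (inter_subset_inter_left _ inter_subset_right)).trans h₂)
  · intro h
    simp only [eApply_union_left, union_subset_iff] at h
    have hcont : ∀ x ∈ X, ∀ V ∈ 𝓝 x, ∃ W ∈ 𝓝 x, eApply E (W ∩ Xᶜ) ⊆ V :=
      fun x hx V hV => (h x hx V hV).imp fun _ hW => ⟨hW.1, hW.2.1⟩
    have hcont_inv : ∀ x ∈ X, ∀ V ∈ 𝓝 x, ∃ W ∈ 𝓝 x, eApply (invRel E) (W ∩ Xᶜ) ⊆ V :=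
      fun x hx V hV => (h x hx V hV).imp fun _ hW => ⟨hW.1, hW.2.2⟩
    exact ⟨hE, fun K hKX hK => ⟨relCptIn_eApply hE hcont_inv hKX hK,
      relCptIn_eApply (invRel_subset_prod hE) hcont hKX hK⟩, hcont⟩
end

section
/- Let (X, X̂, X̃) be a metrizable compactification pack and let d be a metric on X̃ inducing its topology. Then a set E ⊆ X̂ × X̂ belongs to the topological coarse structure on X̂ attached to the compactification X̃ if and only if E belongs to the C₀ coarse structure ℰ₀ on X̂ attached to d. -/
open Set Metric Topology

/-- `E` belongs to the C₀ coarse structure on `hX` attached to the metric of the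
ambient space. -/
def MemC0 {T : Type*} [MetricSpace T] (hX : Set T) (E : Set (T × T)) : Prop :=
  E ⊆ hX ×ˢ hX ∧
  ∀ ε > 0, ∃ K : Set T, K ⊆ hX ∧ IsCompact K ∧
    ∀ p ∈ E \ K ×ˢ K, dist p.1 p.2 < ε

theorem RelCptIn.of_subset_isCompact {T : Type*} [TopologicalSpace T] [T2Space T]
    {hX A L : Set T} (hL : IsCompact L) (hLX : L ⊆ hX) (hA : A ⊆ L) : RelCptIn hX A := by
  have hcl : closure A ⊆ L := closure_minimal hA hL.isClosed
  rw [RelCptIn, inter_eq_left.2 (hcl.trans hLX)]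
  exact hL.of_isClosed_subset isClosed_closure hcl

theorem MemC0.invRel {T : Type*} [MetricSpace T] {hX : Set T} {E : Set (T × T)}
    (h : MemC0 hX E) : MemC0 hX (invRel E) := by
  refine ⟨fun p hp => (h.1 hp).symm, fun ε hε => ?_⟩
  obtain ⟨K, hKX, hK, hd⟩ := h.2 ε hε
  refine ⟨K, hKX, hK, fun p hp => ?_⟩
  rw [dist_comm]
  exact hd (p.2, p.1) ⟨hp.1, fun hmem => hp.2 hmem.symm⟩

theorem MemC0.relCptIn_eApply {T : Type*} [MetricSpace T] [CompactSpace T] {hX : Set T}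
    (hXo : IsOpen hX) {E : Set (T × T)} (h : MemC0 hX E) {K : Set T} (hK : K ⊆ hX)
    (hKc : RelCptIn hX K) : RelCptIn hX (eApply E K) := by
  obtain ⟨δ, hδ, hδX⟩ := IsCompact.exists_cthickening_subset_open hKc hXo inter_subset_right
  obtain ⟨L, hLX, hL, hd⟩ := h.2 δ hδ
  refine RelCptIn.of_subset_isCompact (hL.union isClosed_cthickening.isCompact)
    (union_subset hLX hδX) ?_
  rintro y ⟨x, hx, hyx⟩
  by_cases hmem : (y, x) ∈ L ×ˢ L
  · exact Or.inl hmem.1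
  · exact Or.inr (mem_cthickening_of_dist_le y x δ _ ⟨subset_closure hx, hK hx⟩
      (hd (y, x) ⟨hyx, hmem⟩).le)

theorem MemC0.memTopCoarse {T : Type*} [MetricSpace T] [CompactSpace T] {X : Set T}
    (hX : IsClosed X) {E : Set (T × T)} (h : MemC0 Xᶜ E) : MemTopCoarse X E := by
  refine ⟨h.1, fun K hK hKc => ⟨h.relCptIn_eApply hX.isOpen_compl hK hKc,
    h.invRel.relCptIn_eApply hX.isOpen_compl hK hKc⟩, fun x hx V hV => ?_⟩
  obtain ⟨ε, hε, hεV⟩ := Metric.mem_nhds_iff.1 hV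
  obtain ⟨K, hKX, hK, hd⟩ := h.2 (ε / 2) (half_pos hε)
  refine ⟨ball x (ε / 2) ∩ Kᶜ, Filter.inter_mem (ball_mem_nhds x (half_pos hε))
    (hK.isClosed.isOpen_compl.mem_nhds fun hxK => hKX hxK hx), ?_⟩
  rintro y ⟨z, ⟨⟨hzx, hzK⟩, -⟩, hyz⟩
  apply hεV
  have hyz_lt := hd (y, z) ⟨hyz, fun hmem => hzK hmem.2⟩
  rw [mem_ball] at hzx ⊢
  linarith [dist_triangle y z x]

theorem MemTopCoarse.memC0 {T : Type*} [MetricSpace T] [CompactSpace T] {X : Set T}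
    {E : Set (T × T)} (h : MemTopCoarse X E) : MemC0 Xᶜ E := by
  refine ⟨h.1, fun ε hε => ?_⟩
  choose! W hW hWE using fun x hx => h.2.2 x hx _ (ball_mem_nhds x (half_pos hε))
  let U := ⋃ x ∈ X, interior (W x) ∩ ball x (ε / 2)
  have hUo : IsOpen U := isOpen_biUnion fun x _ => isOpen_interior.inter isOpen_ball
  have hXU : X ⊆ U := fun x hx => mem_biUnion hx
    ⟨mem_interior_iff_mem_nhds.2 (hW x hx), mem_ball_self (half_pos hε)⟩
  have hUc : IsCompact Uᶜ := hUo.isClosed_compl.isCompact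
  have hUX : Uᶜ ⊆ Xᶜ := compl_subset_compl.2 hXU
  refine ⟨Uᶜ ∪ closure (eApply E Uᶜ) ∩ Xᶜ, union_subset hUX inter_subset_right,
    hUc.union (h.2.1 _ hUX (RelCptIn.of_subset_isCompact hUc hUX Subset.rfl)).1, ?_⟩
  rintro ⟨y, z⟩ ⟨hyz, hmem⟩
  by_cases hz : z ∈ U
  · obtain ⟨x, hx, hzW, hzx⟩ := mem_iUnion₂.1 hz
    have hyx : y ∈ ball x (ε / 2) := hWE x hx ⟨z, ⟨interior_subset hzW, (h.1 hyz).2⟩, hyz⟩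
    rw [mem_ball] at hzx hyx
    linarith [dist_triangle_right y z x]
  · exact absurd ⟨Or.inr ⟨subset_closure ⟨z, hz, hyz⟩, (h.1 hyz).1⟩, Or.inl hz⟩ hmem

/-- For a metrizable compactification pack, the topological coarse
structure attached to the compactification coincides with the C₀ coarse structure
attached to any compatible metric. -/
theorem statement4 {T : Type*} [MetricSpace T] [CompactSpace T]
    (X : Set T) (hXcl : IsClosed X) (hXnd : IsNowhereDense X)
    (E : Set (T × T)) (hE : E ⊆ Xᶜ ×ˢ Xᶜ) :
    MemTopCoarse X E ↔ MemC0 Xᶜ E := ⟨MemTopCoarse.memC0, MemC0.memTopCoarse hXcl⟩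
end

section
/- Let (X̂, d) be a locally compact metric space and let ℰ₀ be the C₀ coarse structure on X̂. A family α of subsets of X̂ satisfies Δ(α) ∈ ℰ₀ if and only if both of the following hold: (i) α(K) is relatively compact in X̂ for every relatively compact K ⊆ X̂; and (ii) for every ε > 0 there is a compact set K ⊆ X̂ such that every U ∈ α with U ∩ K = ∅ has diam U ≤ ε. -/
open Set Metric

/-- `Δ(α) = ⋃_{U ∈ α} U × U`. -/
def deltaFam {Z : Type*} (α : Set (Set Z)) : Set (Z × Z) := ⋃ U ∈ α, U ×ˢ U

/-- `E` belongs to the C₀ coarse structure of the metric space `Z`. -/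
def MemC0All {Z : Type*} [MetricSpace Z] (E : Set (Z × Z)) : Prop :=
  ∀ ε > 0, ∃ K : Set Z, IsCompact K ∧ ∀ p ∈ E \ K ×ˢ K, dist p.1 p.2 < ε

/-- In a locally compact metric space, a family `α` satisfies
`Δ(α) ∈ ℰ₀` iff `α` is proper (images of relatively compact sets are relatively
compact) and, away from some compact set, all its members have diameter at most
`ε`, for every `ε > 0`. -/
theorem statement5 {Z : Type*} [MetricSpace Z] [LocallyCompactSpace Z]
    (α : Set (Set Z)) :
    MemC0All (deltaFam α) ↔
      ((∀ K : Set Z, IsCompact (closure K) → IsCompact (closure (famApply α K))) ∧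
       ∀ ε > 0, ∃ K : Set Z, IsCompact K ∧
         ∀ U ∈ α, U ∩ K = ∅ → EMetric.diam U ≤ ENNReal.ofReal ε) := by
  constructor
  · intro h
    refine ⟨fun K hK => ?_, fun ε hε => ?_⟩
    · obtain ⟨δ, hδ, hKδ⟩ := hK.exists_isCompact_cthickening
      obtain ⟨C, hC, hCδ⟩ := h δ hδ
      refine (hC.union hKδ).closure_of_subset ?_
      rintro y ⟨U, ⟨hU, x, hxU, hxK⟩, hyU⟩
      by_cases hxy : (y, x) ∈ C ×ˢ C
      · exact Or.inl hxy.1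
      · have hd : dist y x < δ := hCδ (y, x) ⟨mem_biUnion hU ⟨hyU, hxU⟩, hxy⟩
        exact Or.inr (mem_cthickening_of_dist_le y x δ _ (subset_closure hxK) hd.le)
    · obtain ⟨K, hK, hKε⟩ := h ε hε
      refine ⟨K, hK, fun U hU hUK => Metric.ediam_le fun x hx y hy => ?_⟩
      rw [edist_dist]
      have hxK : x ∉ K := fun hxK => (hUK.subset ⟨hx, hxK⟩ : x ∈ (∅ : Set Z))
      exact ENNReal.ofReal_le_ofReal
        (hKε (x, y) ⟨mem_biUnion hU ⟨hx, hy⟩, fun hxy => hxK hxy.1⟩).le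
  · rintro ⟨hproper, hsmall⟩ ε hε
    obtain ⟨K, hK, hKε⟩ := hsmall (ε / 2) (half_pos hε)
    refine ⟨closure (famApply α K), hproper K hK.closure, ?_⟩
    rintro ⟨x, y⟩ ⟨hxy, hnot⟩
    obtain ⟨U, hU, hx, hy⟩ := mem_iUnion₂.1 hxy
    rcases (U ∩ K).eq_empty_or_nonempty with hUK | hUK
    · have hd := (Metric.edist_le_ediam_of_mem hx hy).trans (hKε U hU hUK)
      rw [edist_dist, ENNReal.ofReal_le_ofReal_iff (half_pos hε).le] at hd
      exact hd.trans_lt (half_lt_self hε)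
    · exact absurd ⟨subset_closure ⟨U, ⟨hU, hUK⟩, hx⟩, subset_closure ⟨U, ⟨hU, hUK⟩, hy⟩⟩ hnot
end

section
/- Let (X, X̂, X̃) be a metrizable compactification pack, let d be a metric on X̃ inducing its topology, and let ℰ₀ be the C₀ coarse structure on X̂. Let {Wₙ}_{n≥0} be open subsets of X̃ with W₀ = X̃, cl(W_{n+1}) ⊆ Wₙ for every n, and ⋂_{n≥0} Wₙ = X. Let {βₙ}_{n≥0} be families of open subsets of X̃ with β₀ = {X̃}, X ⊆ ⋃_{U ∈ βₙ} U for every n, and lim_{m,n→∞} mesh{U ∩ Wₘ : U ∈ βₙ} = 0. Define α({βₙ},{Wₙ}) = {U ∩ (Wₙ \ cl(W_{n+2})) : U ∈ βₙ, n ≥ 0}. Then: (a) α({βₙ},{Wₙ}) is an open uniform family of subsets of X̂; (b) if each βₙ is finite, then α({βₙ},{Wₙ}) is locally finite; (c) for every uniform family γ of subsets of X̂ there is a strictly increasing sequence {n_k}_{k≥0} with n₀ = 0 such that γ ≺ α({β_k},{W_{n_k}}). -/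
open Set Metric Topology Filter

/-- `β ≺ α`: every member of `β` is contained in some member of `α`. -/
def Refines {Z : Type*} (β α : Set (Set Z)) : Prop := ∀ V ∈ β, ∃ U ∈ α, V ⊆ U

/-- `mult α ≤ m`: every finite subfamily of `α` with nonempty intersection has
cardinality at most `m`. -/
def MultLE {Z : Type*} (α : Set (Set Z)) (m : ℕ) : Prop :=
  ∀ S : Finset (Set Z), ↑S ⊆ α → (⋂₀ (S : Set (Set Z))).Nonempty → S.card ≤ m

/-- A family `α` is locally finite in `hX`:every point of `hX` has a neighborhood meeting
only finitely many members of `α`. -/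
def LocallyFiniteIn {Z : Type*} [TopologicalSpace Z] (hX : Set Z) (α : Set (Set Z)) : Prop :=
  ∀ x ∈ hX, ∃ V : Set Z, IsOpen V ∧ x ∈ V ∧ {U ∈ α | (U ∩ V).Nonempty}.Finite

/-- Covering dimension at most `n` (an integer; the empty space has dimension `-1`);
for `n ≥ 0` this is the usual condition that every finite open cover admits a finite
open refinement, still covering, of multiplicity at most `n + 1`. -/
def DimLE (Y : Type*) [TopologicalSpace Y] (n : ℤ) : Prop :=
  (IsEmpty Y ∧ -1 ≤ n) ∨
  ∃ m : ℕ, (m : ℤ) = n ∧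
    ∀ α : Set (Set Y), α.Finite → (∀ U ∈ α, IsOpen U) → ⋃₀ α = univ →
      ∃ β : Set (Set Y), β.Finite ∧ (∀ V ∈ β, IsOpen V) ∧ ⋃₀ β = univ ∧
        Refines β α ∧ MultLE β (m + 1)

/-- A family of subsets of `hX` is uniform if `Δ(α) ∈ ℰ₀`. -/
def IsUniformFam {T : Type*} [MetricSpace T] (hX : Set T) (α : Set (Set T)) : Prop :=
  MemC0 hX (deltaFam α)

/-- A uniform cover of `hX`. -/
def IsUniformCover {T : Type*} [MetricSpace T] (hX : Set T) (α : Set (Set T)) : Prop :=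
  IsUniformFam hX α ∧ ⋃₀ α = hX

/-- A canonical cover of the compactification pack `(X, Xᶜ, T)`: an open, locally
finite cover `α` of `X̂ = Xᶜ` such that for every `x ∈ X` and every neighborhood `V`
of `x` there is a neighborhood `W` of `x` with `α(W ∩ X̂) ⊆ V`. -/
def IsCanonicalCover {T : Type*} [TopologicalSpace T] (X : Set T) (α : Set (Set T)) : Prop :=
  (∀ U ∈ α, IsOpen U ∧ U ⊆ Xᶜ) ∧ ⋃₀ α = Xᶜ ∧ LocallyFiniteIn Xᶜ α ∧
  ∀ x ∈ X, ∀ V ∈ 𝓝 x, ∃ W ∈ 𝓝 x, famApply α (W ∩ Xᶜ) ⊆ V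

/-- `asdim (hX, ℰ₀) ≤ m`: every uniform cover admits a uniform coarsening of
multiplicity at most `m + 1`. -/
def AsdimLE {T : Type*} [MetricSpace T] (hX : Set T) (m : ℕ) : Prop :=
  ∀ β, IsUniformCover hX β → ∃ α, IsUniformCover hX α ∧ Refines β α ∧ MultLE α (m + 1)

/-- `X` is a cylindrical subset of `T`. -/
def IsCylindrical (T : Type*) [TopologicalSpace T] (X : Set T) : Prop :=
  ∃ j : X × unitInterval → T, Topology.IsEmbedding j ∧ ∀ x : X, j (x, 0) = (x : T)

/-- `X` is a Z-set of the metric space `T`. -/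
def IsZSet {T : Type*} [MetricSpace T] (X : Set T) : Prop :=
  IsClosed X ∧ ∀ ε > 0, ∃ f : T → T, Continuous f ∧ (∀ z, dist (f z) z < ε) ∧
    Set.range f ∩ X = ∅

/-- The cover `α({βₙ},{Wₙ}) = {U ∩ (Wₙ \ cl W_{n+2}) : U ∈ βₙ, n ≥ 0}`. -/
def alphaFam {T : Type*} [TopologicalSpace T] (β : ℕ → Set (Set T)) (W : ℕ → Set T) :
    Set (Set T) :=
  {V | ∃ n : ℕ, ∃ U ∈ β n, V = U ∩ (W n \ closure (W (n + 2)))}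

lemma subset_of_iInter_eq {T : Type*} {X : Set T} {W : ℕ → Set T} (hWint : ⋂ n, W n = X)
    (n : ℕ) : X ⊆ W n :=
  hWint ▸ iInter_subset W n

section NestedNeighborhoods

variable {T : Type*} [MetricSpace T] {X : Set T} {W : ℕ → Set T}

lemma antitone_of_closure_succ_subset (hWnest : ∀ n, closure (W (n + 1)) ⊆ W n) : Antitone W :=
  antitone_nat_of_succ_le fun n => subset_closure.trans (hWnest n)

lemma exists_closure_subset_of_isOpen [CompactSpace T]
    (hWnest : ∀ n, closure (W (n + 1)) ⊆ W n) (hWint : ⋂ n, W n = X)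
    {O : Set T} (hO : IsOpen O) (hXO : X ⊆ O) : ∃ n, closure (W n) ⊆ O := by
  have hanti : Antitone fun n => closure (W n) := fun m n h =>
    closure_mono (antitone_of_closure_succ_subset hWnest h)
  refine exists_subset_nhds_of_compactSpace hanti.directed_ge (fun _ => isClosed_closure)
    fun x hx => hO.mem_nhds (hXO ?_)
  rw [← hWint]
  exact mem_iInter.2 fun n => hWnest n (mem_iInter.1 hx (n + 1))

/-- Members of a uniform family that come close to `X` are small and lie near `X`. -/
lemma IsUniformFam.exists_subset_ball [CompactSpace T]
    (hWnest : ∀ n, closure (W (n + 1)) ⊆ W n) (hWint : ⋂ n, W n = X)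
    {γ : Set (Set T)} (hγ : IsUniformFam Xᶜ γ) {δ : ℝ} (hδ : 0 < δ) :
    ∃ m, ∀ m' ≥ m, ∀ V ∈ γ, (V ∩ closure (W m')).Nonempty → ∃ x ∈ X, V ⊆ ball x δ := by
  obtain ⟨K, hKX, hK, hKδ⟩ := hγ.2 (δ / 2) (half_pos hδ)
  obtain ⟨m, hm⟩ := exists_closure_subset_of_isOpen hWnest hWint
    (isOpen_thickening.inter hK.isClosed.isOpen_compl)
    (subset_inter (self_subset_thickening (half_pos hδ) X) (subset_compl_comm.1 hKX))
  refine ⟨m, fun m' hm' V hV ⟨y, hyV, hy⟩ => ?_⟩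
  obtain ⟨hyX, hyK⟩ := hm (closure_mono (antitone_of_closure_succ_subset hWnest hm') hy)
  obtain ⟨x, hx, hyx⟩ := mem_thickening_iff.1 hyX
  refine ⟨x, hx, fun z hz => ?_⟩
  have hzy : dist z y < δ / 2 :=
    hKδ (z, y) ⟨mem_biUnion hV (mk_mem_prod hz hyV), fun h => hyK h.2⟩
  rw [mem_ball]
  linarith [dist_triangle z y x]

lemma IsUniformFam.exists_subset_and_subset_mem [CompactSpace T] (hXcl : IsClosed X)
    (hWopen : ∀ n, IsOpen (W n))
    (hWnest : ∀ n, closure (W (n + 1)) ⊆ W n) (hWint : ⋂ n, W n = X)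
    {γ : Set (Set T)} (hγ : IsUniformFam Xᶜ γ)
    {b : Set (Set T)} (hb : ∀ U ∈ b, IsOpen U) (hXb : X ⊆ ⋃₀ b) (n : ℕ) :
    ∃ m > n, ∀ V ∈ γ, (V ∩ closure (W m)).Nonempty → V ⊆ W n ∧ ∃ U ∈ b, V ⊆ U := by
  obtain ⟨δ, hδ, hδb⟩ := lebesgue_number_lemma_of_metric_sUnion hXcl.isCompact hb hXb
  obtain ⟨η, hη, hηW⟩ := hXcl.isCompact.exists_thickening_subset_open (hWopen n)
    (subset_of_iInter_eq hWint n)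
  obtain ⟨m, hm⟩ := hγ.exists_subset_ball hWnest hWint (lt_min hδ hη)
  refine ⟨max m (n + 1), by omega, fun V hV hne => ?_⟩
  obtain ⟨x, hx, hVx⟩ := hm _ (le_max_left _ _) V hV hne
  obtain ⟨U, hU, hxU⟩ := hδb x hx
  exact ⟨hVx.trans <| (ball_subset_ball (min_le_right _ _)).trans <|
      (ball_subset_thickening hx η).trans hηW,
    U, hU, hVx.trans <| (ball_subset_ball (min_le_left _ _)).trans hxU⟩

lemma isOpen_of_mem_alphaFam {β : ℕ → Set (Set T)} (hWopen : ∀ n, IsOpen (W n))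
    (hβopen : ∀ n, ∀ U ∈ β n, IsOpen U) {V : Set T} (hV : V ∈ alphaFam β W) : IsOpen V := by
  obtain ⟨n, U, hU, rfl⟩ := hV
  exact (hβopen n U hU).inter ((hWopen n).sdiff isClosed_closure)

lemma subset_compl_of_mem_alphaFam {β : ℕ → Set (Set T)} (hWint : ⋂ n, W n = X)
    {V : Set T} (hV : V ∈ alphaFam β W) : V ⊆ Xᶜ := by
  obtain ⟨n, U, -, rfl⟩ := hV
  exact fun x hx hxX => hx.2.2 (subset_closure (subset_of_iInter_eq hWint _ hxX))

lemma isUniformFam_alphaFam [CompactSpace T] {β : ℕ → Set (Set T)}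
    (hWopen : ∀ n, IsOpen (W n))
    (hWnest : ∀ n, closure (W (n + 1)) ⊆ W n) (hWint : ⋂ n, W n = X)
    (hmesh : ∀ ε > 0, ∃ N : ℕ, ∀ m ≥ N, ∀ n ≥ N, ∀ U ∈ β n,
      Metric.ediam (U ∩ W m) ≤ ENNReal.ofReal ε) :
    IsUniformFam Xᶜ (alphaFam β W) := by
  refine ⟨iUnion₂_subset fun V hV => prod_mono (subset_compl_of_mem_alphaFam hWint hV)
    (subset_compl_of_mem_alphaFam hWint hV), fun ε hε => ?_⟩
  obtain ⟨N, hN⟩ := hmesh (ε / 2) (half_pos hε)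
  refine ⟨(W (N + 2))ᶜ, compl_subset_compl.2 (subset_of_iInter_eq hWint _),
    (hWopen _).isClosed_compl.isCompact, ?_⟩
  rintro ⟨x, y⟩ ⟨hxy, hK⟩
  obtain ⟨V, ⟨n, U, hU, rfl⟩, hx, hy⟩ := mem_iUnion₂.1 hxy
  rcases lt_or_ge n N with h | h
  · have hsub : W (N + 2) ⊆ closure (W (n + 2)) :=
      (antitone_of_closure_succ_subset hWnest (by omega)).trans subset_closure
    exact absurd ⟨fun hx' => hx.2.2 (hsub hx'), fun hy' => hy.2.2 (hsub hy')⟩ hK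
  · have hdist := (edist_le_ofReal (half_pos hε).le).1 <|
      (Metric.edist_le_ediam_of_mem (s := U ∩ W n) ⟨hx.1, hx.2.1⟩ ⟨hy.1, hy.2.1⟩).trans
        (hN n h n h U hU)
    exact hdist.trans_lt (half_lt_self hε)

lemma locallyFiniteIn_alphaFam {β : ℕ → Set (Set T)}
    (hWnest : ∀ n, closure (W (n + 1)) ⊆ W n) (hWint : ⋂ n, W n = X)
    (hfin : ∀ n, (β n).Finite) : LocallyFiniteIn Xᶜ (alphaFam β W) := by
  intro x hx
  rw [← hWint, mem_compl_iff, mem_iInter, not_forall] at hx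
  obtain ⟨m, hm⟩ := hx
  refine ⟨(closure (W (m + 1)))ᶜ, isClosed_closure.isOpen_compl, fun h => hm (hWnest m h), ?_⟩
  refine ((finite_Iio (m + 1)).biUnion fun n _ =>
    (hfin n).image fun U => U ∩ (W n \ closure (W (n + 2)))).subset ?_
  rintro _ ⟨⟨n, U, hU, rfl⟩, y, hyU, hy⟩
  refine mem_biUnion (x := n) ?_ ⟨U, hU, rfl⟩
  by_contra hn
  exact hy (subset_closure (antitone_of_closure_succ_subset hWnest (not_lt.1 hn) hyU.2.1))

lemma IsUniformFam.exists_refines_alphaFam [CompactSpace T] {β : ℕ → Set (Set T)}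
    (hXcl : IsClosed X) (hWopen : ∀ n, IsOpen (W n)) (hW0 : W 0 = univ)
    (hWnest : ∀ n, closure (W (n + 1)) ⊆ W n) (hWint : ⋂ n, W n = X)
    (hβopen : ∀ n, ∀ U ∈ β n, IsOpen U) (hβ0 : β 0 = {univ}) (hβcov : ∀ n, X ⊆ ⋃₀ β n)
    {γ : Set (Set T)} (hγX : ∀ U ∈ γ, U ⊆ Xᶜ) (hγ : IsUniformFam Xᶜ γ) :
    ∃ nk : ℕ → ℕ, nk 0 = 0 ∧ StrictMono nk ∧ Refines γ (alphaFam β (fun k => W (nk k))) := by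
  classical
  choose next hlt hnext using fun k n =>
    hγ.exists_subset_and_subset_mem hXcl hWopen hWnest hWint (hβopen k) (hβcov k) n
  let nk : ℕ → ℕ := fun k => Nat.rec 0 next k
  have hmono : StrictMono nk := strictMono_nat_of_lt_succ fun k => hlt k (nk k)
  have hstep : ∀ k, ∀ V ∈ γ, (V ∩ closure (W (nk (k + 1)))).Nonempty →
      V ⊆ W (nk k) ∧ ∃ U ∈ β k, V ⊆ U := fun k => hnext k (nk k)
  refine ⟨nk, rfl, hmono, fun V hV => ?_⟩
  rcases V.eq_empty_or_nonempty with rfl | ⟨y, hy⟩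
  · exact ⟨_, ⟨0, univ, hβ0 ▸ rfl, rfl⟩, empty_subset _⟩
  have hex : ∃ k, ¬ (V ∩ closure (W (nk (k + 1)))).Nonempty := by
    by_contra! h
    refine hγX V hV hy (hWint ▸ mem_iInter.2 fun k => ?_)
    exact antitone_of_closure_succ_subset hWnest hmono.le_apply ((hstep k V hV (h k)).1 hy)
  rcases hk : Nat.find hex with _ | i
  · have hdisj := hk ▸ Nat.find_spec hex
    refine ⟨_, ⟨0, univ, hβ0 ▸ rfl, rfl⟩, fun z hz => ⟨mem_univ z, ?_, fun hz' => hdisj ⟨z, hz, ?_⟩⟩⟩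
    · exact (eq_univ_iff_forall.1 hW0) z
    · exact closure_mono (antitone_of_closure_succ_subset hWnest
        (hmono.monotone (show 0 + 1 ≤ 0 + 2 by omega))) hz'
  · have hdisj := hk ▸ Nat.find_spec hex
    obtain ⟨hVW, U, hU, hVU⟩ := hstep i V hV (not_not.1 (Nat.find_min hex (m := i) (by omega)))
    exact ⟨_, ⟨i, U, hU, rfl⟩, fun z hz => ⟨hVU hz, hVW hz, fun hz' => hdisj ⟨z, hz, hz'⟩⟩⟩

end NestedNeighborhoods

/-- Properties of the canonical construction `α({βₙ},{Wₙ})`: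
(a) it is an open uniform family of subsets of `X̂`; (b) it is locally finite if each
`βₙ` is finite; (c) every uniform family of subsets of `X̂` refines some
`α({β_k},{W_{n_k}})` for a subsequence `{n_k}` with `n₀ = 0`. -/
theorem statement6 {T : Type*} [MetricSpace T] [CompactSpace T]
    (X : Set T) (hXcl : IsClosed X) (hXnd : IsNowhereDense X)
    (W : ℕ → Set T) (hWopen : ∀ n, IsOpen (W n)) (hW0 : W 0 = univ)
    (hWnest : ∀ n, closure (W (n + 1)) ⊆ W n) (hWint : ⋂ n, W n = X)
    (β : ℕ → Set (Set T)) (hβopen : ∀ n, ∀ U ∈ β n, IsOpen U)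
    (hβ0 : β 0 = {univ}) (hβcov : ∀ n, X ⊆ ⋃₀ β n)
    (hmesh : ∀ ε > 0, ∃ N : ℕ, ∀ m ≥ N, ∀ n ≥ N, ∀ U ∈ β n,
      EMetric.diam (U ∩ W m) ≤ ENNReal.ofReal ε) :
    ((∀ V ∈ alphaFam β W, IsOpen V) ∧ IsUniformFam Xᶜ (alphaFam β W)) ∧
    ((∀ n, (β n).Finite) → LocallyFiniteIn Xᶜ (alphaFam β W)) ∧
    (∀ γ : Set (Set T), (∀ U ∈ γ, U ⊆ Xᶜ) → IsUniformFam Xᶜ γ →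
      ∃ nk : ℕ → ℕ, nk 0 = 0 ∧ StrictMono nk ∧
        Refines γ (alphaFam β (fun k => W (nk k)))) := by
  exact ⟨⟨fun _ => isOpen_of_mem_alphaFam hWopen hβopen,
      isUniformFam_alphaFam hWopen hWnest hWint hmesh⟩,
    locallyFiniteIn_alphaFam hWnest hWint,
    fun _ hγX hγ => hγ.exists_refines_alphaFam hXcl hWopen hW0 hWnest hWint hβopen hβ0 hβcov hγX⟩
end

section
/- Let (X, X̂, X̃) be a metrizable compactification pack, let d be a metric on X̃ inducing its topology, and let ℰ₀ be the C₀ coarse structure on X̂. For every uniform family γ of subsets of X̂ there exists a canonical cover α of (X, X̂, X̃) with γ ≺ α. -/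
open Set Metric Topology Filter

/-- A compact subset of the complement of the nonempty compact set `X` stays at positive
distance from `X`. -/
lemma exists_pos_le_infDist {T : Type*} [MetricSpace T] {X K : Set T} (hX : IsCompact X)
    (hne : X.Nonempty) (hK : IsCompact K) (hKX : K ⊆ Xᶜ) :
    ∃ δ > 0, ∀ k ∈ K, δ ≤ infDist k X := by
  obtain ⟨δ, hδ, h⟩ := hX.exists_thickening_subset_open hK.isClosed.isOpen_compl
    (subset_compl_comm.mp hKX)
  refine ⟨δ, hδ, fun k hk => ?_⟩
  by_contra! hlt
  exact h ((mem_thickening_iff_infDist_lt hne).mpr hlt) hk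

/-- If the relation `R` is controlled near `X`, there is a sequence of positive reals tending to
zero that bounds `R` on the sublevel sets `{infDist · X ≤ a n}`. -/
lemma exists_tendsto_zero_dist_lt {T : Type*} [MetricSpace T] [CompactSpace T] {X : Set T}
    {R : T → T → Prop}
    (hR : ∀ ε > 0, ∃ δ > 0, ∀ x y, infDist y X < δ → R x y → dist x y < ε)
    {a : ℕ → ℝ} (ha : ∀ n, 0 < a n) (ha0 : Tendsto a atTop (𝓝 0)) :
    ∃ s : ℕ → ℝ, (∀ n, 0 < s n) ∧ Tendsto s atTop (𝓝 0) ∧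
      ∀ n x y, infDist y X ≤ a n → R x y → dist x y < s n := by
  set S : ℕ → Set ℝ := fun n => {t | ∃ x y, infDist y X ≤ a n ∧ R x y ∧ dist x y = t}
  have hnonneg : ∀ n, 0 ≤ sSup (S n) := fun n =>
    Real.sSup_nonneg (by rintro _ ⟨x, y, -, -, rfl⟩; exact dist_nonneg)
  have hbdd : ∀ n, BddAbove (S n) := fun n => ⟨diam (univ : Set T), by
    rintro _ ⟨x, y, -, -, rfl⟩
    exact dist_le_diam_of_mem isCompact_univ.isBounded (mem_univ _) (mem_univ _)⟩
  have hS : Tendsto (fun n => sSup (S n)) atTop (𝓝 0) := by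
    rw [Metric.tendsto_atTop]
    intro ε hε
    obtain ⟨δ, hδ, h⟩ := hR (ε / 2) (half_pos hε)
    obtain ⟨N, hN⟩ := eventually_atTop.mp (ha0.eventually_lt_const hδ)
    refine ⟨N, fun n hn => ?_⟩
    have hle : sSup (S n) ≤ ε / 2 := by
      refine Real.sSup_le ?_ (half_pos hε).le
      rintro _ ⟨x, y, hy, hxy, rfl⟩
      exact (h x y (hy.trans_lt (hN n hn)) hxy).le
    rw [Real.dist_0_eq_abs, abs_of_nonneg (hnonneg n)]
    linarith
  refine ⟨fun n => sSup (S n) + a n, fun n => add_pos_of_nonneg_of_pos (hnonneg n) (ha n),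
    by simpa using hS.add ha0, fun n x y hy hxy => ?_⟩
  have := le_csSup (hbdd n) (show dist x y ∈ S n from ⟨x, y, hy, hxy, rfl⟩)
  linarith [ha n]

/-- A symmetric relation which is controlled near `X` moves points at distance at least `a`
from `X` to points at distance bounded below from `X`. -/
lemma exists_pos_lt_infDist_of_rel {T : Type*} [MetricSpace T] {X : Set T} {R : T → T → Prop}
    (hsymm : ∀ x y, R x y → R y x)
    (hR : ∀ ε > 0, ∃ δ > 0, ∀ x y, infDist y X < δ → R x y → dist x y < ε)
    {a : ℝ} (ha : 0 < a) :
    ∃ δ > 0, ∀ x y, a ≤ infDist y X → R x y → δ < infDist x X := by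
  obtain ⟨δ, hδ, h⟩ := hR (a / 2) (half_pos ha)
  refine ⟨min δ (a / 2) / 2, by positivity, fun x y hy hxy => ?_⟩
  by_contra! hlt
  have hm : 0 < min δ (a / 2) := by positivity
  have h1 := min_le_left δ (a / 2)
  have h2 := min_le_right δ (a / 2)
  have h3 := h y x (by linarith) (hsymm _ _ hxy)
  have h4 : infDist y X ≤ infDist x X + dist y x := infDist_le_infDist_add_dist
  linarith

/-- A family of balls cut off away from `X`, finitely many at each stage `n`, whose radii tend
to zero and whose centers approach `X`, is a canonical cover as soon as it covers `Xᶜ`. -/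
lemma isCanonicalCover_iUnion_ball {T : Type*} [MetricSpace T] {X : Set T} (hX : IsClosed X)
    (hne : X.Nonempty) {a r δ : ℕ → ℝ} {t : ℕ → Set T} (ha : Tendsto a atTop (𝓝 0))
    (hr : Tendsto r atTop (𝓝 0)) (hδ : ∀ n, 0 < δ n) (ht : ∀ n, (t n).Finite)
    (hta : ∀ n, ∀ x ∈ t n, infDist x X ≤ a n)
    (hcov : ∀ y ∉ X, ∃ n, ∃ x ∈ t n, y ∈ ball x (r n) ∩ {z | δ n < infDist z X}) :
    IsCanonicalCover X
      (⋃ n, (fun x => ball x (r n) ∩ {z | δ n < infDist z X}) '' t n) := by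
  have hcont : Continuous fun z => infDist z X := continuous_infDist_pt X
  have hsub : ∀ n x, ball x (r n) ∩ {z | δ n < infDist z X} ⊆ Xᶜ := by
    rintro n x z ⟨-, hz⟩ hzX
    rw [mem_ofPred_eq, infDist_zero_of_mem hzX] at hz
    exact (hδ n).not_gt hz
  refine ⟨?_, ?_, ?_, ?_⟩
  · intro U hU
    obtain ⟨n, x, -, rfl⟩ := mem_iUnion.mp hU
    exact ⟨isOpen_ball.inter (isOpen_lt continuous_const hcont), hsub n x⟩
  · refine Subset.antisymm (sUnion_subset fun U hU => ?_) fun y hy => ?_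
    · obtain ⟨n, x, -, rfl⟩ := mem_iUnion.mp hU
      exact hsub n x
    · obtain ⟨n, x, hx, hyx⟩ := hcov y hy
      exact ⟨_, mem_iUnion.mpr ⟨n, x, hx, rfl⟩, hyx⟩
  · intro y hy
    have hpos : 0 < infDist y X := (hX.notMem_iff_infDist_pos hne).mp hy
    have har : Tendsto (fun n => a n + r n) atTop (𝓝 0) := by simpa using ha.add hr
    obtain ⟨N, hN⟩ := eventually_atTop.mp (har.eventually_lt_const (half_pos hpos))
    refine ⟨{z | infDist y X / 2 < infDist z X}, isOpen_lt continuous_const hcont,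
      half_lt_self hpos, ?_⟩
    refine ((finite_Iio N).biUnion fun n _ =>
      (ht n).image fun x => ball x (r n) ∩ {z | δ n < infDist z X}).subset ?_
    rintro U ⟨hU, z, hzU, hz⟩
    obtain ⟨n, x, hx, rfl⟩ := mem_iUnion.mp hU
    refine mem_biUnion (x := n) ?_ ⟨x, hx, rfl⟩
    by_contra hn
    have h1 := hN n (not_lt.mp hn)
    have h2 : infDist z X ≤ infDist x X + dist z x := infDist_le_infDist_add_dist
    have h3 := mem_ball.mp hzU.1
    have h4 := hta n x hx
    rw [mem_ofPred_eq] at hz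
    linarith
  · intro x hx V hV
    obtain ⟨η, hη, hηV⟩ := Metric.mem_nhds_iff.mp hV
    obtain ⟨N, hN⟩ := eventually_atTop.mp (hr.eventually_lt_const (show 0 < η / 4 by linarith))
    refine ⟨ball x (η / 2) ∩ ⋂ n ∈ Finset.range N, {z | infDist z X < δ n}, ?_, ?_⟩
    · refine inter_mem (ball_mem_nhds x (half_pos hη)) ((Finset.iInter_mem_sets _).mpr ?_)
      intro n _
      refine (isOpen_lt hcont continuous_const).mem_nhds ?_
      rw [mem_ofPred_eq, infDist_zero_of_mem hx]
      exact hδ n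
    · rintro z ⟨U, ⟨hU, w, hwU, ⟨hwx, hwI⟩, -⟩, hzU⟩
      obtain ⟨n, c, -, rfl⟩ := mem_iUnion.mp hU
      rcases lt_or_ge n N with hn | hn
      · have h1 : infDist w X < δ n := mem_iInter₂.mp hwI n (Finset.mem_range.mpr hn)
        exact absurd hwU.2 h1.not_gt
      · apply hηV
        have h1 := hN n hn
        have h2 := mem_ball.mp hzU.1
        have h3 := mem_ball'.mp hwU.1
        have h4 := mem_ball.mp hwx
        have h5 := dist_triangle4 z c w x
        rw [mem_ball]
        linarith

/-- If `R` is a reflexive symmetric relation controlled near `X`, then some canonical cover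
has every `R`-neighborhood of a point of `Xᶜ` inside one of its members. -/
lemma exists_isCanonicalCover_of_rel {T : Type*} [MetricSpace T] [CompactSpace T] {X : Set T}
    (hX : IsClosed X) (hne : X.Nonempty) {R : T → T → Prop} (hrefl : ∀ x, R x x)
    (hsymm : ∀ x y, R x y → R y x)
    (hR : ∀ ε > 0, ∃ δ > 0, ∀ x y, infDist y X < δ → R x y → dist x y < ε) :
    ∃ α : Set (Set T), IsCanonicalCover X α ∧ ∀ y ∉ X, ∃ W ∈ α, {x | R x y} ⊆ W := by
  set M : ℝ := diam (univ : Set T) + 1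
  have hM : 0 < M := add_pos_of_nonneg_of_pos diam_nonneg one_pos
  have hfM : ∀ y, infDist y X ≤ M := fun y => by
    obtain ⟨x, hx⟩ := hne
    have h1 := infDist_le_dist_of_mem (x := y) hx
    have h2 := dist_le_diam_of_mem (isCompact_univ (X := T)).isBounded (mem_univ y) (mem_univ x)
    linarith
  set a : ℕ → ℝ := fun n => M * (1 / 2) ^ n
  have hapos : ∀ n, 0 < a n := fun n => by positivity
  have ha0 : Tendsto a atTop (𝓝 0) := by
    simpa [a] using (tendsto_pow_atTop_nhds_zero_of_lt_one (r := (1 / 2 : ℝ))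
      (by norm_num) (by norm_num)).const_mul M
  have hshell : ∀ y ∉ X, ∃ n, a (n + 1) ≤ infDist y X ∧ infDist y X ≤ a n := by
    intro y hy
    have hpos : 0 < infDist y X := (hX.notMem_iff_infDist_pos hne).mp hy
    obtain ⟨n, h1, h2⟩ := exists_nat_pow_near_of_lt_one (div_pos hpos hM)
      ((div_le_one hM).mpr (hfM y)) (show (0 : ℝ) < 1 / 2 by norm_num) (by norm_num)
    rw [lt_div_iff₀' hM] at h1
    rw [div_le_iff₀' hM] at h2
    exact ⟨n, h1.le, h2⟩
  obtain ⟨s, hs, hs0, hsR⟩ := exists_tendsto_zero_dist_lt hR hapos ha0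
  choose δ hδ hδR using fun n => exists_pos_lt_infDist_of_rel hsymm hR (hapos (n + 1))
  have hcpt : ∀ n, IsCompact ((fun z => infDist z X) ⁻¹' Icc (a (n + 1)) (a n)) := fun n =>
    (isClosed_Icc.preimage (continuous_infDist_pt X)).isCompact
  choose t hts htf htc using fun n => (hcpt n).finite_cover_balls (hs n)
  have hcov : ∀ y ∉ X, ∃ n, ∃ x ∈ t n,
      {z | R z y} ⊆ ball x (2 * s n) ∩ {z | δ n < infDist z X} := by
    intro y hy
    obtain ⟨n, hn⟩ := hshell y hy
    obtain ⟨x, hx, hyx⟩ := mem_iUnion₂.mp (htc n hn)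
    refine ⟨n, x, hx, fun z hz => ⟨?_, hδR n z y hn.1 hz⟩⟩
    have h1 := hsR n z y hn.2 hz
    have h2 := mem_ball.mp hyx
    have h3 := dist_triangle z y x
    rw [mem_ball]
    linarith
  refine ⟨_, isCanonicalCover_iUnion_ball hX hne ha0 (by simpa using hs0.const_mul 2) hδ htf
    (fun n x hx => (hts n hx).2) fun y hy => ?_, fun y hy => ?_⟩
  · obtain ⟨n, x, hx, h⟩ := hcov y hy
    exact ⟨n, x, hx, h (hrefl y)⟩
  · obtain ⟨n, x, hx, h⟩ := hcov y hy
    exact ⟨_, mem_iUnion.mpr ⟨n, x, hx, rfl⟩, h⟩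

/-- Adding the empty set to a canonical cover leaves it canonical. -/
lemma IsCanonicalCover.insert_empty {T : Type*} [TopologicalSpace T] {X : Set T}
    {α : Set (Set T)} (h : IsCanonicalCover X α) : IsCanonicalCover X (insert ∅ α) := by
  obtain ⟨h1, h2, h3, h4⟩ := h
  have hsep : ∀ A : Set T,
      {U ∈ insert ∅ α | (U ∩ A).Nonempty} ⊆ {U ∈ α | (U ∩ A).Nonempty} := by
    rintro A U ⟨rfl | hU, hUA⟩
    · simp at hUA
    · exact ⟨hU, hUA⟩
  refine ⟨?_, by simpa using h2, fun x hx => ?_, fun x hx V hV => ?_⟩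
  · rintro U (rfl | hU)
    · exact ⟨isOpen_empty, empty_subset _⟩
    · exact h1 U hU
  · obtain ⟨V, hVo, hxV, hV⟩ := h3 x hx
    exact ⟨V, hVo, hxV, hV.subset (hsep V)⟩
  · obtain ⟨W, hW, hWV⟩ := h4 x hx V hV
    exact ⟨W, hW, (sUnion_subset_sUnion (hsep _)).trans hWV⟩

/-- In a metrizable compactification pack, every uniform family of
subsets of `X̂` refines some canonical cover. -/
theorem statement7 {T : Type*} [MetricSpace T] [CompactSpace T]
    (X : Set T) (hXcl : IsClosed X) (hXnd : IsNowhereDense X)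
    (γ : Set (Set T)) (hγsub : ∀ U ∈ γ, U ⊆ Xᶜ) (hγ : IsUniformFam Xᶜ γ) :
    ∃ α : Set (Set T), IsCanonicalCover X α ∧ Refines γ α := by
  rcases X.eq_empty_or_nonempty with rfl | hne
  · refine ⟨{univ}, ⟨by simp, by simp, fun x _ => ⟨univ, isOpen_univ, mem_univ x, ?_⟩, by simp⟩,
      fun U _ => ⟨univ, rfl, subset_univ U⟩⟩
    exact (finite_singleton univ).subset (sep_subset _ _)
  obtain ⟨α, hα, hαR⟩ := exists_isCanonicalCover_of_rel hXcl hne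
    (R := fun x y => x = y ∨ ∃ U ∈ γ, x ∈ U ∧ y ∈ U) (fun _ => Or.inl rfl)
    (by
      rintro x y (rfl | ⟨U, hU, hx, hy⟩)
      · exact Or.inl rfl
      · exact Or.inr ⟨U, hU, hy, hx⟩)
    (by
      intro ε hε
      obtain ⟨K, hKX, hK, hKε⟩ := hγ.2 ε hε
      obtain ⟨δ, hδ, hδK⟩ := exists_pos_le_infDist hXcl.isCompact hne hK hKX
      refine ⟨δ, hδ, ?_⟩
      rintro x y hy (rfl | ⟨U, hU, hxU, hyU⟩)
      · simpa using hε
      · exact hKε (x, y) ⟨mem_biUnion hU ⟨hxU, hyU⟩, fun h => (hδK y h.2).not_gt hy⟩)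
  refine ⟨insert ∅ α, hα.insert_empty, fun U hU => ?_⟩
  rcases U.eq_empty_or_nonempty with rfl | ⟨y, hy⟩
  · exact ⟨∅, mem_insert _ _, Subset.rfl⟩
  · obtain ⟨W, hW, hRW⟩ := hαR y (hγsub U hU hy)
    exact ⟨W, mem_insert_of_mem _ hW, fun x hx => hRW (Or.inr ⟨U, hU, hx, hy⟩)⟩
end

section
/- Let (X, X̂, X̃) be a metrizable compactification pack, let d be a metric on X̃ inducing its topology, let ℰ₀ be the C₀ coarse structure on X̂, and let n ∈ ℕ. Then asdim(X̂, ℰ₀) ≤ n if and only if for every uniform cover β of X̂ there exists an open, locally finite, uniform cover α of X̂ with β ≺ α and mult α ≤ n + 1. -/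
open Set Metric Topology Filter

/-- A relation is controlled near `X` if its pairs get arbitrarily close together as their first
entry approaches `X`. -/
def ControlledNear {T : Type*} [MetricSpace T] (X : Set T) (E : T → T → Prop) : Prop :=
  ∀ ε : ENNReal, 0 < ε → ∃ δ : ENNReal, 0 < δ ∧
    ∀ x y, E x y → infEDist x X < δ → edist x y < ε

theorem ControlledNear.mono {T : Type*} [MetricSpace T] {X : Set T} {E F : T → T → Prop}
    (hF : ControlledNear X F) (h : ∀ x y, E x y → F x y) : ControlledNear X E := by
  intro ε hε
  obtain ⟨δ, hδ, H⟩ := hF ε hε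
  exact ⟨δ, hδ, fun x y hxy => H x y (h x y hxy)⟩

theorem ControlledNear.comp {T : Type*} [MetricSpace T] {X : Set T} {E F : T → T → Prop}
    (hE : ControlledNear X E) (hF : ControlledNear X F) :
    ControlledNear X (fun x z => ∃ y, E x y ∧ F y z) := by
  intro ε hε
  obtain ⟨δ₂, hδ₂, H₂⟩ := hF (ε / 2) (ENNReal.half_pos hε.ne')
  obtain ⟨δ₁, hδ₁, H₁⟩ := hE (min (ε / 2) (δ₂ / 2))
    (lt_min (ENNReal.half_pos hε.ne') (ENNReal.half_pos hδ₂.ne'))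
  refine ⟨min δ₁ (δ₂ / 2), lt_min hδ₁ (ENNReal.half_pos hδ₂.ne'), ?_⟩
  rintro x z ⟨y, hxy, hyz⟩ hx
  have h1 := lt_min_iff.1 (H₁ x y hxy (hx.trans_le (min_le_left _ _)))
  have hy : infEDist y X < δ₂ := by
    calc infEDist y X ≤ infEDist x X + edist y x := infEDist_le_infEDist_add_edist
      _ < δ₂ / 2 + δ₂ / 2 :=
        ENNReal.add_lt_add (hx.trans_le (min_le_right _ _)) (edist_comm x y ▸ h1.2)
      _ = δ₂ := ENNReal.add_halves δ₂
  calc edist x z ≤ edist x y + edist y z := edist_triangle x y z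
    _ < ε / 2 + ε / 2 := ENNReal.add_lt_add h1.1 (H₂ y z hyz hy)
    _ = ε := ENNReal.add_halves ε

theorem mem_deltaFam {Z : Type*} {α : Set (Set Z)} {x y : Z} :
    (x, y) ∈ deltaFam α ↔ ∃ U ∈ α, x ∈ U ∧ y ∈ U := by
  simp [deltaFam, and_left_comm]

/-- In a compact metric space, a family of subsets of the complement of a closed set `X` is
uniform exactly when its members are controlled near `X`. -/
theorem isUniformFam_compl_iff {T : Type*} [MetricSpace T] [CompactSpace T] {X : Set T}
    (hX : IsClosed X) {α : Set (Set T)} :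
    IsUniformFam Xᶜ α ↔ (∀ U ∈ α, U ⊆ Xᶜ) ∧
      ControlledNear X (fun x y => ∃ U ∈ α, x ∈ U ∧ y ∈ U) := by
  constructor
  · rintro ⟨hsub, h⟩
    refine ⟨fun U hU x hx => (hsub (mem_deltaFam.2 ⟨U, hU, hx, hx⟩)).1, fun ε hε => ?_⟩
    obtain ⟨r, hr, hrε⟩ := ENNReal.lt_iff_exists_nnreal_btwn.1 hε
    have hr' : (0 : ℝ) < r := by exact_mod_cast hr
    obtain ⟨K, hKX, hK, H⟩ := h r hr'
    obtain ⟨δ, hδ, hd⟩ := (disjoint_left.2 hKX : Disjoint K X).exists_thickenings hK hX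
    refine ⟨ENNReal.ofReal δ, ENNReal.ofReal_pos.2 hδ, fun x y hxy hx => ?_⟩
    have hxK : x ∉ K := fun hxK =>
      disjoint_left.1 hd (self_subset_thickening hδ K hxK) hx
    have := H (x, y) ⟨mem_deltaFam.2 hxy, fun hp => hxK hp.1⟩
    have h2 : edist x y < ENNReal.ofReal r := edist_lt_ofReal.2 this
    exact (by simpa using h2 : edist x y < r).trans hrε
  · rintro ⟨hsub, h⟩
    refine ⟨?_, fun ε hε => ?_⟩
    · rintro ⟨x, y⟩ hp
      obtain ⟨U, hU, hx, hy⟩ := mem_deltaFam.1 hp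
      exact ⟨hsub U hU hx, hsub U hU hy⟩
    · obtain ⟨δ, hδ, H⟩ := h (ENNReal.ofReal ε) (ENNReal.ofReal_pos.2 hε)
      refine ⟨{x | δ ≤ infEDist x X}, fun x hx hxX => ?_,
        (isClosed_le continuous_const continuous_infEDist).isCompact, ?_⟩
      · rw [mem_ofPred_eq, infEDist_zero_of_mem hxX] at hx
        exact hδ.not_ge hx
      · rintro ⟨x, y⟩ ⟨hp, hK⟩
        obtain ⟨U, hU, hx, hy⟩ := mem_deltaFam.1 hp
        by_cases hxδ : infEDist x X < δ
        · exact edist_lt_ofReal.1 (H x y ⟨U, hU, hx, hy⟩ hxδ)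
        · have hyδ : infEDist y X < δ := by
            by_contra hyδ
            exact hK ⟨not_lt.1 hxδ, not_lt.1 hyδ⟩
          rw [dist_comm]
          exact edist_lt_ofReal.1 (H y x ⟨U, hU, hy, hx⟩ hyδ)

/-- The complement of a closed set in a compact metric space has an open, locally finite,
uniform cover. -/
theorem exists_open_locallyFinite_uniformCover {T : Type*} [MetricSpace T] [CompactSpace T]
    {X : Set T} (hX : IsClosed X) :
    ∃ γ : Set (Set T), (∀ G ∈ γ, IsOpen G) ∧ LocallyFiniteIn Xᶜ γ ∧ IsUniformCover Xᶜ γ := by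
  have hnhd : ∀ x : ↥Xᶜ, ∃ G : Set T, IsOpen G ∧ (x : T) ∈ G ∧
      ∀ y ∈ G, ∀ z ∈ G, edist y z < infEDist y X := by
    intro x
    have ho : IsOpen {p : T × T | edist p.1 p.2 < infEDist p.1 X} :=
      isOpen_lt (continuous_fst.edist continuous_snd) (continuous_infEDist.comp continuous_fst)
    have hx : ((x : T), (x : T)) ∈ {p : T × T | edist p.1 p.2 < infEDist p.1 X} := by
      simp only [mem_ofPred_eq, edist_self]
      rw [pos_iff_ne_zero, Ne, ← mem_iff_infEDist_zero_of_closed hX]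
      exact x.2
    obtain ⟨u, v, hu, hv, hxu, hxv, huv⟩ := isOpen_prod_iff.1 ho _ _ hx
    exact ⟨u ∩ v, hu.inter hv, ⟨hxu, hxv⟩, fun y hy z hz => huv (mk_mem_prod hy.1 hz.2)⟩
  choose G hGo hxG hG using hnhd
  obtain ⟨v, hvo, hvc, hvf, hvG⟩ := precise_refinement (fun x : ↥Xᶜ => Subtype.val ⁻¹' G x)
    (fun x => (hGo x).preimage continuous_subtype_val)
    (eq_univ_of_forall fun x => mem_iUnion.2 ⟨x, hxG x⟩)
  have hXo : IsOpen Xᶜ := hX.isOpen_compl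
  refine ⟨range fun i => Subtype.val '' v i, ?_, ?_, ?_, ?_⟩
  · rintro _ ⟨i, rfl⟩
    exact hXo.isOpenMap_subtype_val _ (hvo i)
  · intro x hx
    obtain ⟨t, ht, hfin⟩ := hvf ⟨x, hx⟩
    obtain ⟨s, hst, hs, hxs⟩ := _root_.mem_nhds_iff.1 ht
    refine ⟨Subtype.val '' s, hXo.isOpenMap_subtype_val _ hs, ⟨_, hxs, rfl⟩,
      (hfin.image fun i => Subtype.val '' v i).subset ?_⟩
    rintro _ ⟨⟨i, rfl⟩, hne⟩
    rw [← image_inter Subtype.val_injective, image_nonempty] at hne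
    exact ⟨i, hne.mono (inter_subset_inter_right _ hst), rfl⟩
  · refine (isUniformFam_compl_iff hX).2 ⟨?_, fun ε hε => ⟨ε, hε, ?_⟩⟩
    · rintro _ ⟨i, rfl⟩ _ ⟨y, -, rfl⟩
      exact y.2
    · rintro _ _ ⟨_, ⟨i, rfl⟩, ⟨x, hx, rfl⟩, ⟨y, hy, rfl⟩⟩ hε
      exact (hG i x (hvG i hx) y (hvG i hy)).trans hε
  · rw [sUnion_range, ← image_iUnion, hvc, image_univ, Subtype.range_coe]

theorem MultLE.finite_setOf_mem {Z : Type*} {α : Set (Set Z)} {m : ℕ} (h : MultLE α m) (x : Z) :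
    {U ∈ α | x ∈ U}.Finite := by
  by_contra hinf
  obtain ⟨S, hS, hcard⟩ := Set.Infinite.exists_subset_card_eq hinf (m + 1)
  have := h S (fun U hU => (hS hU).1) ⟨x, fun U hU => (hS hU).2⟩
  omega

/-- Shrinking each member of a family does not increase its multiplicity. -/
theorem MultLE.image_of_subset {Z : Type*} {α : Set (Set Z)} {m : ℕ} (h : MultLE α m)
    {f : Set Z → Set Z} (hf : ∀ U ∈ α, f U ⊆ U) : MultLE (f '' α) m := by
  classical
  rintro S hS ⟨x, hx⟩
  obtain ⟨R, hRα, rfl⟩ := Finset.subset_set_image_iff.1 hS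
  refine Finset.card_image_le.trans (h R hRα ⟨x, fun U hU => ?_⟩)
  exact hf U (hRα hU) (hx _ (Finset.mem_coe.2 (Finset.mem_image_of_mem f hU)))

/-- The stars of the members of a uniform cover with respect to another one form a uniform
cover. -/
theorem IsUniformCover.image_famApply {T : Type*} [MetricSpace T] [CompactSpace T] {X : Set T}
    (hX : IsClosed X) {β γ : Set (Set T)} (hβ : IsUniformCover Xᶜ β)
    (hγ : IsUniformCover Xᶜ γ) : IsUniformCover Xᶜ (famApply γ '' β) := by
  have hβ' := (isUniformFam_compl_iff hX).1 hβ.1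
  have hγ' := (isUniformFam_compl_iff hX).1 hγ.1
  have hsub : ∀ U ∈ famApply γ '' β, U ⊆ Xᶜ := by
    rintro _ ⟨V, -, rfl⟩
    exact sUnion_subset fun G hG => hγ'.1 G hG.1
  refine ⟨(isUniformFam_compl_iff hX).2 ⟨hsub, ?_⟩, (sUnion_subset hsub).antisymm ?_⟩
  · refine ((hγ'.2.comp hβ'.2).comp hγ'.2).mono ?_
    rintro x y ⟨_, ⟨V, hV, rfl⟩, ⟨G, ⟨hG, v, hvG, hvV⟩, hx⟩, ⟨G', ⟨hG', w, hwG, hwV⟩, hy⟩⟩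
    exact ⟨w, ⟨v, ⟨G, hG, hx, hvG⟩, V, hV, hvV, hwV⟩, G', hG', hwG, hy⟩
  · intro x hx
    obtain ⟨V, hV, hxV⟩ := hβ.2.symm ▸ hx
    obtain ⟨G, hG, hxG⟩ := hγ.2.symm ▸ hx
    exact ⟨_, ⟨V, hV, rfl⟩, G, ⟨hG, x, hxG, hxV⟩, hxG⟩

/-- If `γ` is locally finite and `α` has finite multiplicity, then the unions of the members of
`γ` inside each member of `α` form a locally finite family. -/
theorem LocallyFiniteIn.image_sUnion_subset {Z : Type*} [TopologicalSpace Z] {Y : Set Z}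
    {α γ : Set (Set Z)} {m : ℕ} (hγ : LocallyFiniteIn Y γ) (hα : MultLE α m) :
    LocallyFiniteIn Y ((fun U => ⋃₀ {G ∈ γ | G ⊆ U}) '' α) := by
  intro x hx
  obtain ⟨W, hWo, hxW, hfin⟩ := hγ x hx
  refine ⟨W, hWo, hxW, ((hfin.biUnion (t := fun G => {U ∈ α | (G ∩ W).Nonempty ∧ G ⊆ U})
    fun G hG => ?_).image fun U => ⋃₀ {G ∈ γ | G ⊆ U}).subset ?_⟩
  · obtain ⟨g, hg, -⟩ := hG.2
    exact (hα.finite_setOf_mem g).subset fun U hU => ⟨hU.1, hU.2.2 hg⟩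
  · rintro _ ⟨⟨U, hU, rfl⟩, y, ⟨G, ⟨hG, hGU⟩, hyG⟩, hyW⟩
    exact ⟨U, mem_biUnion (show G ∈ {G ∈ γ | (G ∩ W).Nonempty} from ⟨hG, y, hyG, hyW⟩)
      ⟨hU, ⟨y, hyG, hyW⟩, hGU⟩, rfl⟩

/-- `asdim (X̂, ℰ₀) ≤ n` iff every uniform cover of `X̂` is refined
in an open, locally finite, uniform cover of multiplicity at most `n + 1`. -/
theorem statement8 {T : Type*} [MetricSpace T] [CompactSpace T]
    (X : Set T) (hXcl : IsClosed X) (hXnd : IsNowhereDense X) (n : ℕ) :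
    AsdimLE Xᶜ n ↔
      ∀ β : Set (Set T), IsUniformCover Xᶜ β →
        ∃ α : Set (Set T), (∀ U ∈ α, IsOpen U) ∧ LocallyFiniteIn Xᶜ α ∧
          IsUniformCover Xᶜ α ∧ Refines β α ∧ MultLE α (n + 1) := by
  constructor
  · intro h β hβ
    obtain ⟨γ, hγo, hγf, hγ⟩ := exists_open_locallyFinite_uniformCover hXcl
    obtain ⟨α, hα, hβα, hm⟩ := h _ (hβ.image_famApply hXcl hγ)
    have hα' := (isUniformFam_compl_iff hXcl).1 hα.1
    have hle : ∀ U, ⋃₀ {G ∈ γ | G ⊆ U} ⊆ U := fun U => sUnion_subset fun G hG => hG.2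
    have href : Refines β ((fun U => ⋃₀ {G ∈ γ | G ⊆ U}) '' α) := by
      intro V hV
      obtain ⟨U, hU, hVU⟩ := hβα _ ⟨V, hV, rfl⟩
      refine ⟨_, ⟨U, hU, rfl⟩, fun x hx => ?_⟩
      have hxX : x ∈ Xᶜ := hβ.2 ▸ mem_sUnion_of_mem hx hV
      obtain ⟨G, hG, hxG⟩ := hγ.2.symm ▸ hxX
      have hGV : G ∈ {G ∈ γ | (G ∩ V).Nonempty} := ⟨hG, x, hxG, hx⟩
      exact ⟨G, ⟨hG, (subset_sUnion_of_mem hGV).trans hVU⟩, hxG⟩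
    have hsub : ∀ U ∈ (fun U => ⋃₀ {G ∈ γ | G ⊆ U}) '' α, U ⊆ Xᶜ := by
      rintro _ ⟨U, hU, rfl⟩
      exact (hle U).trans (hα'.1 U hU)
    refine ⟨(fun U => ⋃₀ {G ∈ γ | G ⊆ U}) '' α, ?_, hγf.image_sUnion_subset hm,
      ⟨(isUniformFam_compl_iff hXcl).2 ⟨hsub, hα'.2.mono ?_⟩,
        (sUnion_subset hsub).antisymm ?_⟩, href, hm.image_of_subset fun U _ => hle U⟩
    · rintro _ ⟨U, -, rfl⟩
      exact isOpen_sUnion fun G hG => hγo G hG.1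
    · rintro x y ⟨_, ⟨U, hU, rfl⟩, hx, hy⟩
      exact ⟨U, hU, hle U hx, hle U hy⟩
    · intro x hx
      obtain ⟨V, hV, hxV⟩ := hβ.2.symm ▸ hx
      obtain ⟨U, hU, hVU⟩ := href V hV
      exact ⟨U, hU, hVU hxV⟩
  · intro h β hβ
    obtain ⟨α, -, -, hα, hβα, hm⟩ := h β hβ
    exact ⟨α, hα, hβα, hm⟩
end

section
/- Every Z-set of the Hilbert cube Q = [0,1]^ℕ is a cylindrical subset of Q. -/
open Set Metric Topology

/-- The point `(1 - s) * a + s * b` of the unit interval. -/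
noncomputable def unitInterval.blend (s a b : unitInterval) : unitInterval :=
  ⟨(1 - s) * a + s * b,
    convex_Icc (0 : ℝ) 1 a.2 b.2 (sub_nonneg.2 s.2.2) s.2.1 (sub_add_cancel _ _)⟩

namespace unitInterval

@[simp] lemma blend_zero (a b : unitInterval) : blend 0 a b = a := by
  ext; simp [blend]

@[simp] lemma blend_one (a b : unitInterval) : blend 1 a b = b := by
  ext; simp [blend]

@[fun_prop]
lemma continuous_blend {Z : Type*} [TopologicalSpace Z] {s a b : Z → unitInterval}
    (hs : Continuous s) (ha : Continuous a) (hb : Continuous b) :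
    Continuous fun z => blend (s z) (a z) (b z) := by
  unfold blend
  fun_prop

lemma dist_blend_le (s a b : unitInterval) : dist a (blend s a b) ≤ dist a b := by
  have h : (a : ℝ) - ((1 - s) * a + s * b) = s * (a - b) := by ring
  rw [Subtype.dist_eq, Subtype.dist_eq, Real.dist_eq, Real.dist_eq]
  change |(a : ℝ) - ((1 - s) * a + s * b)| ≤ _
  rw [h, abs_mul, abs_of_nonneg s.2.1]
  exact mul_le_of_le_one_left (abs_nonneg _) s.2.2

end unitInterval

open unitInterval

namespace HilbertCube

attribute [local instance] PiCountable.metricSpace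

lemma dist_le_dist_of_forall {x y z : ℕ → unitInterval}
    (h : ∀ k, dist (x k) (y k) ≤ dist (x k) (z k)) : dist x y ≤ dist x z := by
  change ∑' _, _ ≤ ∑' _, _
  exact (PiCountable.dist_summable x y).tsum_le_tsum (fun k => min_le_min_left _ (h k))
    (PiCountable.dist_summable x z)

lemma dist_le_of_forall_lt_eq {x y : ℕ → unitInterval} {n : ℕ} (h : ∀ k < n, x k = y k) :
    dist x y ≤ 2 * 2⁻¹ ^ n := by
  rw [← tsum_geometric_inv_two_ge n]
  change ∑' _, _ ≤ _
  refine (PiCountable.dist_summable x y).tsum_le_tsum (fun k => ?_) ?_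
  · split_ifs with hk
    · exact min_le_left _ _
    · rw [h k (not_le.1 hk), dist_self]
      exact min_le_right _ _
  · refine .of_nonneg_of_le (fun k => ?_) (fun k => ?_)
      (summable_geometric_of_lt_one (r := (2⁻¹ : ℝ)) (by norm_num) (by norm_num))
    · split_ifs <;> positivity
    · split_ifs
      · exact le_rfl
      · positivity

/-- A homotopy of the Hilbert cube which starts at the identity and instantly leaves `Y`. -/
lemma exists_instant_homotopy {Y : Set (ℕ → unitInterval)} (hY : IsZSet Y) :
    ∃ h : C((ℕ → unitInterval) × unitInterval, ℕ → unitInterval),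
      (∀ x, h (x, 0) = x) ∧ ∀ x t, 0 < t → h (x, t) ∉ Y := by
  let E : Set C((ℕ → unitInterval) × unitInterval, ℕ → unitInterval) := {h | ∀ x, h (x, 0) = x}
  have hE : IsClosed E := by
    simp only [E, ofPred_forall]
    exact isClosed_iInter fun x => isClosed_eq (by fun_prop) continuous_const
  have : CompleteSpace E := hE.completeSpace_coe
  let K (n : ℕ) : Set ((ℕ → unitInterval) × unitInterval) := {p | (1 : ℝ) ≤ (n + 1) * p.2}
  have hK (n : ℕ) : IsCompact (K n) :=
    (isClosed_le continuous_const (by fun_prop)).isCompact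
  let U (n : ℕ) : Set E := {h | MapsTo h.1 (K n) Yᶜ}
  have hUo (n : ℕ) : IsOpen (U n) :=
    (ContinuousMap.isOpen_setOfPred_mapsTo (hK n) hY.1.isOpen_compl).preimage
      continuous_subtype_val
  have hUd (n : ℕ) : Dense (U n) := by
    refine Metric.dense_iff.2 fun h ε hε => ?_
    obtain ⟨f, hf, hfd, hfY⟩ := hY.2 ε hε
    let s (t : unitInterval) : unitInterval := projIcc 0 1 zero_le_one ((n + 1) * (t : ℝ))
    have hs : Continuous s := continuous_projIcc.comp (by fun_prop)
    let g : C((ℕ → unitInterval) × unitInterval, ℕ → unitInterval) :=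
      ⟨fun p k => blend (s p.2) (h.1 p k) (f (h.1 p) k), by fun_prop⟩
    refine ⟨⟨g, fun x => ?_⟩, ?_, fun p hp => ?_⟩
    · ext1 k
      simp [g, s, h.2 x]
    · rw [mem_ball, Subtype.dist_eq, dist_comm]
      refine ContinuousMap.dist_lt_of_nonempty fun p => ?_
      refine (dist_le_dist_of_forall fun k => dist_blend_le _ _ _).trans_lt ?_
      rw [dist_comm]
      exact hfd _
    · have hs1 : s p.2 = 1 := projIcc_of_right_le _ hp
      have hg : g p = f (h.1 p) := by
        ext1 k
        simp [g, hs1]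
      intro hgY
      exact (hfY ▸ ⟨⟨_, rfl⟩, hg ▸ hgY⟩ : f (h.1 p) ∈ (∅ : Set (ℕ → unitInterval)))
  have : Nonempty E := ⟨⟨⟨Prod.fst, continuous_fst⟩, fun _ => rfl⟩⟩
  obtain ⟨h, hh⟩ := (dense_iInter_of_isOpen_nat hUo hUd).nonempty
  refine ⟨h.1, h.2, fun x t ht => ?_⟩
  have ht' : (0 : ℝ) < t := ht
  obtain ⟨n, hn⟩ := exists_nat_gt (1 / (t : ℝ))
  refine mem_iInter.1 hh n (x := (x, t)) ?_
  change (1 : ℝ) ≤ (n + 1) * t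
  rw [div_lt_iff₀ ht'] at hn
  linarith

/-- A sequence which lists `t` and each coordinate of `x` infinitely often. -/
def repeatCoords (x : ℕ → unitInterval) (t : unitInterval) (k : ℕ) : unitInterval :=
  Nat.casesOn k.unpair.1 t x

lemma continuous_repeatCoords (k : ℕ) :
    Continuous fun p : (ℕ → unitInterval) × unitInterval => repeatCoords p.1 p.2 k := by
  unfold repeatCoords
  cases k.unpair.1 <;> dsimp only <;> fun_prop

lemma eq_of_repeatCoords_eventuallyEq {x y : ℕ → unitInterval} {s t : unitInterval} {n : ℕ}
    (h : ∀ k ≥ n, repeatCoords x s k = repeatCoords y t k) : x = y ∧ s = t := by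
  have key (i : ℕ) := h (Nat.pair i n) (Nat.right_le_pair i n)
  simp only [repeatCoords, Nat.unpair_pair] at key
  exact ⟨funext fun i => key (i + 1), key 0⟩

/-- The weight `2 ^ k * d - 2`, truncated to the unit interval. -/
noncomputable def weight (k : ℕ) (d : ℝ) : unitInterval :=
  projIcc 0 1 zero_le_one (2 ^ k * d - 2)

@[fun_prop]
lemma continuous_weight (k : ℕ) : Continuous (weight k) :=
  continuous_projIcc.comp (by fun_prop)

lemma weight_eq_zero {k : ℕ} {d : ℝ} (h : 2 ^ k * d ≤ 2) : weight k d = 0 :=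
  projIcc_of_le_left _ (by linarith)

lemma exists_forall_weight_eq_one {d : ℝ} (hd : 0 < d) : ∃ n, ∀ k ≥ n, weight k d = 1 := by
  obtain ⟨n, hn⟩ := pow_unbounded_of_one_lt (3 / d) (one_lt_two (α := ℝ))
  refine ⟨n, fun k hk => projIcc_of_right_le _ ?_⟩
  have h2 : (2 : ℝ) ^ n ≤ 2 ^ k := pow_le_pow_right₀ one_le_two hk
  have := (div_lt_iff₀ hd).1 (hn.trans_le h2)
  linarith

lemma dist_blend_weight_lt {d : ℝ} (hd : 0 < d) (x y : ℕ → unitInterval) :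
    dist x (fun k => blend (weight k d) (x k) (y k)) < d := by
  have hex : ∃ n, 2 < 2 ^ n * d := by
    obtain ⟨n, hn⟩ := pow_unbounded_of_one_lt (2 / d) (one_lt_two (α := ℝ))
    exact ⟨n, (div_lt_iff₀ hd).1 hn⟩
  classical
  refine (dist_le_of_forall_lt_eq (n := Nat.find hex) fun k hk => ?_).trans_lt ?_
  · rw [weight_eq_zero (not_lt.1 (Nat.find_min hex hk)), blend_zero]
  · have := Nat.find_spec hex
    rw [inv_pow, ← div_eq_mul_inv, div_lt_iff₀ (by positivity)]
    linarith

/-- Near `Y` the homotopy is unchanged; away from `Y` its tail records the argument. -/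
lemma exists_injOn_homotopy {Y : Set (ℕ → unitInterval)} (hY : IsZSet Y) :
    ∃ J : (ℕ → unitInterval) × unitInterval → ℕ → unitInterval,
      Continuous J ∧ (∀ x ∈ Y, J (x, 0) = x) ∧ InjOn J (Y ×ˢ univ) := by
  obtain ⟨h, h0, hpos⟩ := exists_instant_homotopy hY
  let J (p : (ℕ → unitInterval) × unitInterval) (k : ℕ) : unitInterval :=
    blend (weight k (infDist (h p) Y)) (h p k) (repeatCoords p.1 p.2 k)
  have hJ : Continuous J := by
    refine continuous_pi fun k => continuous_blend ?_ (by fun_prop) (continuous_repeatCoords k)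
    exact (continuous_weight k).comp ((continuous_infDist_pt Y).comp h.continuous)
  have hJ0 : ∀ x ∈ Y, J (x, 0) = x := fun x hx => by
    ext1 k
    simp [J, h0, infDist_zero_of_mem hx, weight_eq_zero]
  have hd {x t} (hx : x ∈ Y) (ht : 0 < t) : 0 < infDist (h (x, t)) Y :=
    (hY.1.notMem_iff_infDist_pos ⟨x, hx⟩).1 (hpos x t ht)
  have hJY {x t} (hx : x ∈ Y) (ht : 0 < t) : J (x, t) ∉ Y := fun hm =>
    ((infDist_le_dist_of_mem hm).trans_lt (dist_blend_weight_lt (hd hx ht) _ _)).false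
  refine ⟨J, hJ, hJ0, ?_⟩
  rintro ⟨x, s⟩ ⟨hx, -⟩ ⟨y, t⟩ ⟨hy, -⟩ heq
  replace hx : x ∈ Y := hx
  replace hy : y ∈ Y := hy
  rcases eq_or_lt_of_le s.2.1 with hs | hs <;> rcases eq_or_lt_of_le t.2.1 with ht | ht
  · obtain rfl : 0 = s := Subtype.ext hs
    obtain rfl : 0 = t := Subtype.ext ht
    rw [hJ0 x hx, hJ0 y hy] at heq
    rw [heq]
  · obtain rfl : 0 = s := Subtype.ext hs
    rw [hJ0 x hx] at heq
    exact (hJY hy ht (heq ▸ hx)).elim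
  · obtain rfl : 0 = t := Subtype.ext ht
    rw [hJ0 y hy] at heq
    exact (hJY hx hs (heq ▸ hy)).elim
  · obtain ⟨m, hm⟩ := exists_forall_weight_eq_one (hd hx hs)
    obtain ⟨n, hn⟩ := exists_forall_weight_eq_one (hd hy ht)
    obtain ⟨rfl, rfl⟩ := eq_of_repeatCoords_eventuallyEq (n := max m n) fun k hk => by
      have := congrFun heq k
      simpa only [J, hm k (le_of_max_le_left hk), hn k (le_of_max_le_right hk), blend_one]
        using this
    rfl

end HilbertCube

/-- Between compact spaces, being a Z-set does not depend on the metric. -/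
lemma IsZSet.image_homeomorph {S T : Type*} [MetricSpace S] [MetricSpace T] [CompactSpace S]
    (e : S ≃ₜ T) {X : Set S} (hX : IsZSet X) : IsZSet (e '' X) := by
  refine ⟨e.isClosedMap X hX.1, fun ε hε => ?_⟩
  obtain ⟨δ, hδ, he⟩ := Metric.uniformContinuous_iff.1
    (CompactSpace.uniformContinuous_of_continuous e.continuous) ε hε
  obtain ⟨f, hf, hfd, hfX⟩ := hX.2 δ hδ
  refine ⟨e ∘ f ∘ e.symm, by fun_prop, fun z => ?_, ?_⟩
  · simpa using he (hfd (e.symm z))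
  · rw [← disjoint_iff_inter_eq_empty, disjoint_left] at hfX ⊢
    rintro _ ⟨z, rfl⟩ ⟨x, hx, hxz⟩
    obtain rfl : x = f (e.symm z) := e.injective hxz
    exact hfX (mem_range_self _) hx

/-- Every Z-set of the Hilbert cube `Q = [0,1]^ℕ` (with any metric
inducing the product topology) is a cylindrical subset of `Q`. -/
theorem statement9 {Q : Type*} [MetricSpace Q] (e : Q ≃ₜ (ℕ → unitInterval))
    (X : Set Q) (hX : IsZSet X) : IsCylindrical Q X := by
  let _ : MetricSpace (ℕ → unitInterval) := PiCountable.metricSpace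
  have : CompactSpace Q := e.symm.compactSpace
  have : CompactSpace X := isCompact_iff_compactSpace.1 hX.1.isCompact
  obtain ⟨J, hJ, hJ0, hinj⟩ := HilbertCube.exists_injOn_homotopy (hX.image_homeomorph e)
  refine ⟨fun p => e.symm (J (e p.1, p.2)), ?_, fun x => ?_⟩
  · refine (Continuous.isClosedEmbedding (by fun_prop) fun p q hpq => ?_).isEmbedding
    have := hinj ⟨mem_image_of_mem e p.1.2, mem_univ _⟩ ⟨mem_image_of_mem e q.1.2, mem_univ _⟩
      (e.symm.injective hpq)
    rw [Prod.mk.injEq] at this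
    exact Prod.ext (Subtype.ext (e.injective this.1)) this.2
  · simp [hJ0 _ (mem_image_of_mem e x.2)]
end

section
/- Let n ∈ ℕ and let d be a metric on [0,1]^n inducing its topology. A closed subset X ⊆ [0,1]^n is a Z-set of [0,1]^n if and only if X ⊆ [0,1]^n \ (0,1)^n, i.e. X is contained in the topological boundary of the cube. -/
open Set Metric Topology

/-- The `m`-th vertex of the monotone lattice path from `x` to `x + (1, …, 1)` that increases the
coordinates one at a time, in the order prescribed by the ranks `ρ`. -/
def kuhnVertex {n : ℕ} (ρ : Equiv.Perm (Fin n)) (x : Fin n → ℕ) (m : ℕ) : Fin n → ℕ :=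
  fun c => x c + if (ρ c : ℕ) < m then 1 else 0

/-- The path of `kuhnVertex` with its first step left out. -/
def kuhnFaceVertex {n : ℕ} (ρ : Equiv.Perm (Fin (n + 1))) (x : Fin (n + 1) → ℕ) (m : ℕ) :
    Fin (n + 1) → ℕ :=
  fun c => x c + if 0 < (ρ c : ℕ) ∧ (ρ c : ℕ) ≤ m then 1 else 0

lemma kuhnFaceVertex_zero {n : ℕ} (ρ : Equiv.Perm (Fin (n + 1))) (x : Fin (n + 1) → ℕ) :
    kuhnFaceVertex ρ x 0 = x := by
  ext c; simp [kuhnFaceVertex]; omega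

lemma kuhnVertex_succ_eq_kuhnFaceVertex {n : ℕ} (ρ : Equiv.Perm (Fin (n + 1)))
    (x : Fin (n + 1) → ℕ) (m : ℕ) :
    kuhnVertex ρ x (m + 1) =
      kuhnFaceVertex ρ (fun c => x c + if ρ c = 0 then 1 else 0) m := by
  ext c
  simp only [kuhnVertex, kuhnFaceVertex, Fin.ext_iff, Fin.val_zero]
  split_ifs <;> omega

lemma kuhnVertex_finRotate_symm {n : ℕ} (ρ : Equiv.Perm (Fin (n + 1)))
    (x : Fin (n + 1) → ℕ) {m : ℕ} (hm : m ≤ n) :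
    kuhnVertex ((finRotate (n + 1)).symm * ρ) x m = kuhnFaceVertex ρ x m := by
  ext c
  simp only [kuhnVertex, kuhnFaceVertex, Equiv.Perm.mul_apply]
  congr 1
  refine if_congr ?_ rfl rfl
  obtain h | ⟨i, h⟩ := Fin.eq_zero_or_eq_succ (ρ c)
  · have : (finRotate (n + 1)).symm 0 = Fin.last n := by
      rw [Equiv.symm_apply_eq, finRotate_last]
    rw [h, this]
    simp [hm]
  · have : (finRotate (n + 1)).symm i.succ = i.castSucc := by
      rw [Equiv.symm_apply_eq, finRotate_apply, Fin.coeSucc_eq_succ]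
    rw [h, this]
    simp

lemma kuhnVertex_swap_mul {n : ℕ} (ρ : Equiv.Perm (Fin (n + 1))) (x : Fin (n + 1) → ℕ)
    (m : Fin n) {l : ℕ} (hl : l ≠ m + 1) :
    kuhnVertex (Equiv.swap m.castSucc m.succ * ρ) x l = kuhnVertex ρ x l := by
  ext c
  simp only [kuhnVertex, Equiv.Perm.mul_apply]
  congr 1
  refine if_congr ?_ rfl rfl
  rw [Equiv.swap_apply_def]
  split_ifs with h1 h2
  · rw [h1]; simp; omega
  · rw [h2]; simp; omega
  · rfl

lemma kuhnFaceVertex_decomposeFin_symm {n : ℕ} (ρ : Equiv.Perm (Fin n)) (a : ℕ)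
    (y : Fin n → ℕ) (m : ℕ) :
    kuhnFaceVertex (Equiv.Perm.decomposeFin.symm (0, ρ)) (Fin.cons a y) m =
      Fin.cons a (kuhnVertex ρ y m) := by
  ext c
  refine Fin.cases ?_ (fun i => ?_) c
  · simp [kuhnFaceVertex]
  · simp [kuhnFaceVertex, kuhnVertex]

/-- The contribution of the path with ranks `ρ` starting at `x` to the discrete degree of `f`. -/
def kuhnTerm {n : ℕ} (f : Fin n → (Fin n → ℕ) → ZMod 2) (ρ : Equiv.Perm (Fin n))
    (x : Fin n → ℕ) : ZMod 2 :=
  ∏ j : Fin n, (f j (kuhnVertex ρ x (j + 1)) - f j (kuhnVertex ρ x j))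

/-- The contribution of a path in a facet. -/
def kuhnFaceTerm {n : ℕ} (f : Fin (n + 1) → (Fin (n + 1) → ℕ) → ZMod 2)
    (ρ : Equiv.Perm (Fin (n + 1))) (x : Fin (n + 1) → ℕ) : ZMod 2 :=
  f 0 x * ∏ j : Fin n, (f j.succ (kuhnFaceVertex ρ x (j + 1)) - f j.succ (kuhnFaceVertex ρ x j))

/-- The edge of a path on which the function with index `j + 1` is differenced, when the
edges are shifted down for indices below `m`. -/
def kuhnShift {n : ℕ} (f : Fin (n + 1) → (Fin (n + 1) → ℕ) → ZMod 2)
    (ρ : Equiv.Perm (Fin (n + 1))) (x : Fin (n + 1) → ℕ) (m : ℕ) (j : Fin n) : ZMod 2 :=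
  if (j : ℕ) < m then f j.succ (kuhnVertex ρ x (j + 1)) - f j.succ (kuhnVertex ρ x j)
  else f j.succ (kuhnVertex ρ x (j + 2)) - f j.succ (kuhnVertex ρ x (j + 1))

lemma sum_prod_kuhnShift_succ {n : ℕ} (f : Fin (n + 1) → (Fin (n + 1) → ℕ) → ZMod 2)
    (x : Fin (n + 1) → ℕ) (m : Fin n) :
    ∑ ρ, ∏ j, kuhnShift f ρ x m j = ∑ ρ, ∏ j, kuhnShift f ρ x (m + 1) j := by
  rw [← sub_eq_zero, CharTwo.sub_eq_add, ← Finset.sum_add_distrib]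
  have key : ∀ ρ, ∏ j, kuhnShift f ρ x m j + ∏ j, kuhnShift f ρ x (m + 1) j =
      (f m.succ (kuhnVertex ρ x (m + 2)) - f m.succ (kuhnVertex ρ x m)) *
        ∏ j ∈ Finset.univ.erase m, kuhnShift f ρ x m j := by
    intro ρ
    have h : ∏ j ∈ Finset.univ.erase m, kuhnShift f ρ x (m + 1) j =
        ∏ j ∈ Finset.univ.erase m, kuhnShift f ρ x m j := by
      refine Finset.prod_congr rfl fun j hj => ?_
      have : (j : ℕ) ≠ m := fun h => Finset.ne_of_mem_erase hj (Fin.ext h)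
      simp only [kuhnShift]
      exact if_congr (by omega) rfl rfl
    rw [← Finset.mul_prod_erase _ _ (Finset.mem_univ m),
      ← Finset.mul_prod_erase _ (kuhnShift f ρ x (m + 1)) (Finset.mem_univ m), h, ← add_mul]
    congr 1
    simp [kuhnShift]
  have inv : ∀ ρ, (f m.succ (kuhnVertex (Equiv.swap m.castSucc m.succ * ρ) x (m + 2)) -
        f m.succ (kuhnVertex (Equiv.swap m.castSucc m.succ * ρ) x m)) *
        ∏ j ∈ Finset.univ.erase m, kuhnShift f (Equiv.swap m.castSucc m.succ * ρ) x m j =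
      (f m.succ (kuhnVertex ρ x (m + 2)) - f m.succ (kuhnVertex ρ x m)) *
        ∏ j ∈ Finset.univ.erase m, kuhnShift f ρ x m j := by
    intro ρ
    rw [kuhnVertex_swap_mul _ _ _ (by omega), kuhnVertex_swap_mul _ _ _ (by omega)]
    congr 1
    refine Finset.prod_congr rfl fun j hj => ?_
    have : (j : ℕ) ≠ m := fun h => Finset.ne_of_mem_erase hj (Fin.ext h)
    simp only [kuhnShift]
    split_ifs with hjm
    · rw [kuhnVertex_swap_mul _ _ _ (by omega), kuhnVertex_swap_mul _ _ _ (by omega)]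
    · rw [kuhnVertex_swap_mul _ _ _ (by omega), kuhnVertex_swap_mul _ _ _ (by omega)]
  simp only [key]
  refine Finset.sum_involution (fun ρ _ => Equiv.swap m.castSucc m.succ * ρ) ?_ ?_ ?_ ?_
  · intro ρ _
    rw [inv, CharTwo.add_self_eq_zero]
  · intro ρ _ _ h
    rw [mul_eq_right, Equiv.swap_eq_one_iff] at h
    exact (Fin.castSucc_lt_succ).ne h
  · simp
  · intro ρ _
    simp [← mul_assoc]

lemma sum_prod_kuhnShift {n : ℕ} (f : Fin (n + 1) → (Fin (n + 1) → ℕ) → ZMod 2)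
    (x : Fin (n + 1) → ℕ) {m : ℕ} (hm : m ≤ n) :
    ∑ ρ, ∏ j, kuhnShift f ρ x 0 j = ∑ ρ, ∏ j, kuhnShift f ρ x m j := by
  induction m with
  | zero => rfl
  | succ m ih => rw [ih (by omega)]; exact sum_prod_kuhnShift_succ f x ⟨m, hm⟩

/-- Summation by parts: the contributions of a cube are those of its facets. -/
lemma sum_kuhnTerm_eq {n : ℕ} (f : Fin (n + 1) → (Fin (n + 1) → ℕ) → ZMod 2)
    (x : Fin (n + 1) → ℕ) :
    ∑ ρ, kuhnTerm f ρ x = ∑ ρ : Equiv.Perm (Fin (n + 1)),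
      (kuhnFaceTerm f ρ (fun c => x c + if ρ c = 0 then 1 else 0) - kuhnFaceTerm f ρ x) := by
  have h1 : ∀ ρ, kuhnTerm f ρ x =
      kuhnFaceTerm f ρ (fun c => x c + if ρ c = 0 then 1 else 0) -
        f 0 x * ∏ j, kuhnShift f ρ x 0 j := by
    intro ρ
    rw [kuhnTerm, Fin.prod_univ_succ, sub_mul]
    congr 1
    simp only [kuhnFaceTerm, Fin.val_zero, Fin.val_succ, kuhnVertex_succ_eq_kuhnFaceVertex,
      kuhnFaceVertex_zero]
  have h2 : ∑ ρ, kuhnFaceTerm f ρ x = ∑ ρ, f 0 x * ∏ j, kuhnShift f ρ x n j := by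
    rw [← Equiv.sum_comp (Equiv.mulLeft (finRotate (n + 1)).symm)
      (fun ρ => f 0 x * ∏ j, kuhnShift f ρ x n j)]
    refine Finset.sum_congr rfl fun ρ _ => ?_
    rw [kuhnFaceTerm]
    congr 1
    refine Finset.prod_congr rfl fun j _ => ?_
    rw [kuhnShift, if_pos j.2, Equiv.coe_mulLeft, kuhnVertex_finRotate_symm _ _ j.2,
      kuhnVertex_finRotate_symm _ _ j.2.le]
  rw [Finset.sum_sub_distrib, h2, ← Finset.mul_sum, ← sum_prod_kuhnShift f x le_rfl,
    Finset.mul_sum, ← Finset.sum_sub_distrib]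
  exact Finset.sum_congr rfl fun ρ _ => h1 ρ

lemma kuhnFaceTerm_eq_zero {n : ℕ} {f : Fin (n + 1) → (Fin (n + 1) → ℕ) → ZMod 2}
    {ρ : Equiv.Perm (Fin (n + 1))} {i : Fin n} (hi : ρ i.succ = 0) {x : Fin (n + 1) → ℕ}
    {b : ZMod 2} (hf : ∀ y : Fin (n + 1) → ℕ, y i.succ = x i.succ → f i.succ y = b) :
    kuhnFaceTerm f ρ x = 0 := by
  rw [kuhnFaceTerm, Finset.prod_eq_zero (Finset.mem_univ i), mul_zero]
  rw [hf _ (by simp [kuhnFaceVertex, hi]), hf _ (by simp [kuhnFaceVertex, hi]), sub_self]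

lemma sum_kuhnFaceTerm_sub {n k : ℕ} (f : Fin (n + 1) → (Fin (n + 1) → ℕ) → ZMod 2)
    (ρ : Equiv.Perm (Fin (n + 1))) {c : Fin (n + 1)} (hc : ρ c = 0) :
    ∑ x : Fin (n + 1) → Fin k,
      (kuhnFaceTerm f ρ (fun i => (x i : ℕ) + if ρ i = 0 then 1 else 0) -
        kuhnFaceTerm f ρ (fun i => (x i : ℕ))) =
    ∑ y : Fin n → Fin k, (kuhnFaceTerm f ρ (c.insertNth k (fun i => (y i : ℕ))) -
        kuhnFaceTerm f ρ (c.insertNth 0 (fun i => (y i : ℕ)))) := by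
  rw [← Equiv.sum_comp (Fin.insertNthEquiv (fun _ => Fin k) c), Fintype.sum_prod_type_right]
  refine Finset.sum_congr rfl fun y _ => ?_
  rw [← Finset.sum_range_sub
    (fun a => kuhnFaceTerm f ρ (c.insertNth a (fun i => (y i : ℕ)))), Finset.sum_range]
  refine Finset.sum_congr rfl fun a _ => ?_
  congr 2 <;> ext i <;> refine Fin.succAboveCases c ?_ (fun i => ?_) i
  · simp [hc]
  · have : ρ (c.succAbove i) ≠ 0 := fun h =>
      Fin.succAbove_ne c i (ρ.injective (h.trans hc.symm))
    simp [this]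
  · simp
  · simp

/-- A parity form of Kuhn's cubical Sperner lemma. -/
theorem sum_kuhnTerm_eq_one {n k : ℕ} (f : Fin n → (Fin n → ℕ) → ZMod 2)
    (h0 : ∀ j x, x j = 0 → f j x = 0) (h1 : ∀ j x, x j = k → f j x = 1) :
    ∑ x : Fin n → Fin k, ∑ ρ, kuhnTerm f ρ (fun i => (x i : ℕ)) = 1 := by
  induction n with
  | zero => simp [kuhnTerm]
  | succ n ih =>
    simp only [sum_kuhnTerm_eq]
    rw [Finset.sum_comm, ← Equiv.sum_comp Equiv.Perm.decomposeFin.symm, Fintype.sum_prod_type,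
      Finset.sum_eq_single_of_mem 0 (Finset.mem_univ _)]
    · rw [← ih (fun j y => f j.succ (Fin.cons k y)) (fun j x hx => h0 _ _ (by simpa using hx))
        (fun j x hx => h1 _ _ (by simpa using hx))]
      conv_rhs => rw [Finset.sum_comm]
      refine Finset.sum_congr rfl fun ρ _ => ?_
      rw [sum_kuhnFaceTerm_sub f _ (c := 0) (by simp)]
      refine Finset.sum_congr rfl fun y _ => ?_
      simp only [Fin.insertNth_zero']
      rw [kuhnFaceTerm, kuhnFaceTerm, h1 0 (Fin.cons k _) (by simp), h0 0 (Fin.cons 0 _) (by simp)]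
      simp [kuhnFaceVertex_decomposeFin_symm, kuhnTerm]
    · intro p _ hp
      refine Finset.sum_eq_zero fun e _ => ?_
      set ρ := Equiv.Perm.decomposeFin.symm (p, e) with hρ
      have hρ0 : ρ 0 ≠ 0 := by simpa [hρ] using hp
      obtain h | ⟨i, h⟩ := Fin.eq_zero_or_eq_succ (ρ.symm 0)
      · exact absurd ((Equiv.symm_apply_eq ρ).1 h).symm hρ0
      · have hi : ρ i.succ = 0 := ((Equiv.symm_apply_eq ρ).1 h).symm
        rw [sum_kuhnFaceTerm_sub f ρ hi]
        refine Finset.sum_eq_zero fun y _ => ?_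
        rw [kuhnFaceTerm_eq_zero hi (b := 1) fun z hz => h1 _ _ (by simpa using hz),
          kuhnFaceTerm_eq_zero hi (b := 0) fun z hz => h0 _ _ (by simpa using hz), sub_self]

/-- The grid point of the cube with coordinates `x i / k`, truncated at `1`. -/
noncomputable def gridPoint {n : ℕ} (k : ℕ) (x : Fin n → ℕ) : Fin n → unitInterval :=
  fun i => projIcc 0 1 zero_le_one ((x i : ℝ) / k)

lemma dist_gridPoint_kuhnVertex_le {n k : ℕ} (ρ : Equiv.Perm (Fin n)) (x : Fin n → ℕ) (m : ℕ) :
    dist (gridPoint k (kuhnVertex ρ x m)) (gridPoint k x) ≤ 1 / k := by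
  refine (dist_pi_le_iff (by positivity)).2 fun i => ?_
  refine (Subtype.dist_eq _ _).trans_le ((abs_projIcc_sub_projIcc zero_le_one).trans ?_)
  rw [← sub_div, abs_div, Nat.abs_cast]
  gcongr
  simp only [kuhnVertex]
  split_ifs <;> simp

/-- A form of the Poincaré–Miranda theorem. -/
theorem mem_range_of_face_conditions {n : ℕ} {g : (Fin n → unitInterval) → Fin n → unitInterval}
    (hg : Continuous g) {p : Fin n → unitInterval} (h0 : ∀ j x, x j = 0 → g x j < p j)
    (h1 : ∀ j x, x j = 1 → p j ≤ g x j) : p ∈ range g := by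
  classical
  rw [← (isCompact_range hg).isClosed.closure_eq, Metric.mem_closure_range_iff]
  intro ε hε
  obtain ⟨δ, hδ, hgδ⟩ := Metric.uniformContinuous_iff.1
    (CompactSpace.uniformContinuous_of_continuous hg) ε hε
  obtain ⟨k, hk⟩ := exists_nat_one_div_lt hδ
  let f : Fin n → (Fin n → ℕ) → ZMod 2 :=
    fun j x => if p j ≤ g (gridPoint (k + 1) x) j then 1 else 0
  have hsum := sum_kuhnTerm_eq_one (k := k + 1) f
    (fun j x hx => if_neg (h0 j _ (by simp [gridPoint, hx])).not_ge)
    (fun j x hx => if_pos (h1 j _ (by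
      simp only [gridPoint, hx]
      rw [div_self (by positivity), projIcc_right]; rfl)))
  obtain ⟨x, -, hx⟩ := Finset.exists_ne_zero_of_sum_ne_zero (hsum.trans_ne one_ne_zero)
  obtain ⟨ρ, -, hρ⟩ := Finset.exists_ne_zero_of_sum_ne_zero hx
  set X : Fin n → ℕ := fun i => (x i : ℕ)
  refine ⟨gridPoint (k + 1) X, ?_⟩
  have hv : ∀ m, dist (g (gridPoint (k + 1) (kuhnVertex ρ X m))) (g (gridPoint (k + 1) X)) < ε :=
    fun m => hgδ ((dist_gridPoint_kuhnVertex_le ρ X m).trans_lt (by exact_mod_cast hk))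
  refine (dist_pi_lt_iff hε).2 fun j => ?_
  have hj := Finset.prod_ne_zero_iff.1 hρ j (Finset.mem_univ j)
  have ha := (dist_pi_lt_iff hε).1 (hv j) j
  have hb := (dist_pi_lt_iff hε).1 (hv (j + 1)) j
  rw [Subtype.dist_eq, Real.dist_eq, abs_lt] at ha hb ⊢
  simp only [f] at hj
  split_ifs at hj with u w w
  · simp at hj
  · rw [not_le] at w
    rw [← Subtype.coe_le_coe] at u
    rw [← Subtype.coe_lt_coe] at w
    constructor <;> linarith
  · rw [not_le] at u
    rw [← Subtype.coe_le_coe] at w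
    rw [← Subtype.coe_lt_coe] at u
    constructor <;> linarith
  · simp at hj

/-- The contraction of the unit interval towards its midpoint by the factor `1 - t`. -/
noncomputable def shrinkInterval (t : unitInterval) (x : unitInterval) : unitInterval :=
  ⟨(1 - t) * x + t / 2, by
    have := t.2.1; have := t.2.2; have := x.2.1; have := x.2.2
    constructor <;> nlinarith⟩

lemma continuous_shrinkInterval (t : unitInterval) : Continuous (shrinkInterval t) := by
  unfold shrinkInterval
  fun_prop

lemma dist_shrinkInterval_le (t x : unitInterval) : dist (shrinkInterval t x) x ≤ t := by
  have := t.2.1; have := t.2.2; have := x.2.1; have := x.2.2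
  rw [Subtype.dist_eq, Real.dist_eq, abs_le]
  simp only [shrinkInterval]
  constructor <;> nlinarith

lemma shrinkInterval_pos {t : unitInterval} (ht : 0 < t) (x : unitInterval) :
    0 < shrinkInterval t x := by
  have h : (0 : ℝ) < t := ht
  have := t.2.2; have := x.2.1
  rw [← Subtype.coe_lt_coe]
  simp only [shrinkInterval, Icc.coe_zero]
  nlinarith

lemma shrinkInterval_lt_one {t : unitInterval} (ht : 0 < t) (x : unitInterval) :
    shrinkInterval t x < 1 := by
  have h : (0 : ℝ) < t := ht
  have := t.2.2; have := x.2.2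
  rw [← Subtype.coe_lt_coe]
  simp only [shrinkInterval, Icc.coe_one]
  nlinarith

/-- A closed subset `X` of the cube `[0,1]^n` (with any metric
inducing its topology) is a Z-set iff it is contained in `[0,1]^n \ (0,1)^n`, the
topological boundary of the cube. -/
theorem statement10 {T : Type*} [MetricSpace T] (n : ℕ)
    (e : T ≃ₜ (Fin n → unitInterval)) (X : Set T) (hXcl : IsClosed X) :
    IsZSet X ↔ X ⊆ {z : T | ∃ i : Fin n, e z i = 0 ∨ e z i = 1} := by
  have : CompactSpace T := e.symm.compactSpace
  constructor
  · rintro ⟨-, hX⟩ z hz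
    by_contra! hzb
    simp only [mem_ofPred_eq, not_exists, not_or] at hzb
    have hδ : ∀ᶠ δ : ℝ in 𝓝[>] 0, ∀ i, δ < e z i ∧ δ < 1 - e z i := by
      refine Filter.eventually_all.2 fun i => ?_
      have h0 : (0 : ℝ) < e z i := unitInterval.pos_iff_ne_zero.2 (hzb i).1
      have h1 : (0 : ℝ) < 1 - e z i := sub_pos.2 (unitInterval.lt_one_iff_ne_one.2 (hzb i).2)
      exact nhdsWithin_le_nhds ((eventually_lt_nhds h0).and (eventually_lt_nhds h1))
    obtain ⟨δ, hδz, hδ⟩ := (hδ.and self_mem_nhdsWithin).exists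
    obtain ⟨ε, hε, heε⟩ := Metric.uniformContinuous_iff.1
      (CompactSpace.uniformContinuous_of_continuous e.continuous) δ hδ
    obtain ⟨f, hf, hfε, hfX⟩ := hX ε hε
    have hclose : ∀ x i, |(e (f (e.symm x)) i : ℝ) - x i| < δ := fun x i => by
      have := (dist_pi_lt_iff hδ).1 (heε (hfε (e.symm x))) i
      rwa [e.apply_symm_apply, Subtype.dist_eq, Real.dist_eq] at this
    obtain ⟨x, hx⟩ : e z ∈ range (fun x => e (f (e.symm x))) := by
      refine mem_range_of_face_conditions (by fun_prop) (fun j x hx => ?_) (fun j x hx => ?_)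
      · have h := (abs_lt.1 (hclose x j)).2
        rw [hx, Icc.coe_zero] at h
        rw [← Subtype.coe_lt_coe]
        linarith [(hδz j).1]
      · have h := (abs_lt.1 (hclose x j)).1
        rw [hx, Icc.coe_one] at h
        rw [← Subtype.coe_le_coe]
        linarith [(hδz j).2]
    have hmem : z ∈ range f ∩ X := ⟨⟨_, e.injective hx⟩, hz⟩
    simp [hfX] at hmem
  · refine fun hX => ⟨hXcl, fun ε hε => ?_⟩
    obtain ⟨δ, hδ, heδ⟩ := Metric.uniformContinuous_iff.1
      (CompactSpace.uniformContinuous_of_continuous e.symm.continuous) ε hε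
    obtain ⟨t, ht0, htδ⟩ : ∃ t : unitInterval, 0 < t ∧ (t : ℝ) < δ :=
      ⟨⟨min 1 (δ / 2), by positivity, min_le_left _ _⟩,
        Subtype.coe_lt_coe.1 (by simp [hδ]), (min_le_right _ _).trans_lt (by linarith)⟩
    refine ⟨fun z => e.symm fun i => shrinkInterval t (e z i), ?_, fun z => ?_, ?_⟩
    · have := continuous_shrinkInterval t
      fun_prop
    · have h := heδ (a := fun i => shrinkInterval t (e z i)) (b := e z)
        ((dist_pi_lt_iff hδ).2 fun i => (dist_shrinkInterval_le t _).trans_lt htδ)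
      rwa [e.symm_apply_apply] at h
    · refine eq_empty_of_forall_notMem ?_
      rintro _ ⟨⟨z, rfl⟩, hz⟩
      obtain ⟨i, hi⟩ := hX hz
      simp only [e.apply_symm_apply] at hi
      exact hi.elim (shrinkInterval_pos ht0 _).ne' (shrinkInterval_lt_one ht0 _).ne
end

section
/- For every n ∈ ℕ, every Z-set of the cube [0,1]^n is a cylindrical subset of [0,1]^n. -/
open Set Metric Topology

section NoRetraction

open MeasureTheory Polynomial Module
open scoped NNReal

/-- A contractive perturbation of the identity is bijective. -/
theorem bijective_add_of_lipschitzWith {E : Type*} [NormedAddCommGroup E]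
    [CompleteSpace E] {u : E → E} {c : ℝ≥0} (hc : c < 1)
    (hu : LipschitzWith c u) : Function.Bijective fun x => x + u x := by
  constructor
  · intro x y hxy
    have h : x - y = u y - u x := by
      rw [sub_eq_sub_iff_add_eq_add, add_comm (u y)]; exact hxy
    have h1 := hu.dist_le_mul y x
    rw [dist_eq_norm, ← h, dist_comm, dist_eq_norm] at h1
    have hc' : (c : ℝ) < 1 := hc
    by_contra hne
    have : 0 < ‖x - y‖ := norm_pos_iff.2 (sub_ne_zero.2 hne)
    nlinarith
  · intro y
    have hcon : ContractingWith c fun x => y - u x :=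
      ⟨hc, LipschitzWith.of_dist_le_mul fun a b => by
        rw [dist_sub_left]; exact hu.dist_le_mul a b⟩
    refine ⟨hcon.fixedPoint, ?_⟩
    have := hcon.fixedPoint_isFixedPt
    rw [Function.IsFixedPt] at this
    exact eq_sub_iff_add_eq.1 this.symm

variable {E : Type*} [NormedAddCommGroup E] [InnerProductSpace ℝ E]

/-- A map vanishing on the unit sphere and Lipschitz on the unit ball stays Lipschitz when
extended by zero. -/
theorem lipschitzWith_indicator_closedBall {v : E → E} {K : ℝ≥0}
    (hv : LipschitzOnWith K v (closedBall 0 1)) (h0 : ∀ x, ‖x‖ = 1 → v x = 0) :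
    LipschitzWith (2 * K) ((closedBall (0 : E) 1).indicator v) := by
  have mixed : ∀ x y : E, ‖x‖ ≤ 1 → 1 < ‖y‖ → ‖v x‖ ≤ 2 * K * ‖x - y‖ := by
    intro x y hx hy
    have hy0 : (0 : ℝ) < ‖y‖ := one_pos.trans hy
    have hz : ‖‖y‖⁻¹ • y‖ = 1 := by
      rw [norm_smul, norm_inv, norm_norm, inv_mul_cancel₀ hy0.ne']
    have h1 := hv.dist_le_mul x (by simpa using hx) (‖y‖⁻¹ • y) (by simpa using hz.le)
    rw [h0 _ hz, dist_zero_right, dist_eq_norm] at h1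
    have h2 : ‖y - ‖y‖⁻¹ • y‖ = ‖y‖ - 1 := by
      have : y - ‖y‖⁻¹ • y = (1 - ‖y‖⁻¹) • y := by rw [sub_smul, one_smul]
      rw [this, norm_smul, Real.norm_of_nonneg (sub_nonneg.2 (inv_le_one_of_one_le₀ hy.le)),
        sub_mul, one_mul, inv_mul_cancel₀ hy0.ne']
    have h3 : ‖y‖ - ‖x‖ ≤ ‖x - y‖ := by rw [norm_sub_rev]; exact norm_sub_norm_le _ _
    have h4 : ‖x - ‖y‖⁻¹ • y‖ ≤ ‖x - y‖ + ‖y - ‖y‖⁻¹ • y‖ := norm_sub_le_norm_sub_add_norm_sub ..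
    calc ‖v x‖ ≤ K * ‖x - ‖y‖⁻¹ • y‖ := h1
      _ ≤ K * (2 * ‖x - y‖) := by gcongr; linarith
      _ = 2 * K * ‖x - y‖ := by ring
  refine LipschitzWith.of_dist_le_mul fun x y => ?_
  rw [dist_eq_norm, dist_eq_norm, NNReal.coe_mul, NNReal.coe_ofNat]
  rcases le_or_gt ‖x‖ 1 with hx | hx <;> rcases le_or_gt ‖y‖ 1 with hy | hy
  · rw [indicator_of_mem (by simpa using hx), indicator_of_mem (by simpa using hy)]
    have := hv.dist_le_mul x (by simpa using hx) y (by simpa using hy)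
    rw [dist_eq_norm, dist_eq_norm] at this
    have h : 0 ≤ K * ‖x - y‖ := by positivity
    linarith
  · rw [indicator_of_mem (by simpa using hx), indicator_of_notMem (by simpa using hy), sub_zero]
    exact mixed x y hx hy
  · rw [indicator_of_notMem (by simpa using hx), indicator_of_mem (by simpa using hy), zero_sub,
      norm_neg, norm_sub_rev]
    exact mixed y x hy hx
  · rw [indicator_of_notMem (by simpa using hx), indicator_of_notMem (by simpa using hy)]
    simp only [sub_self, norm_zero]
    positivity

variable [FiniteDimensional ℝ E]

/-- `det (1 + t A)` is a polynomial in `t` of degree at most the dimension. -/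
theorem exists_polynomial_eval_eq_det (A : E →L[ℝ] E) :
    ∃ p : ℝ[X], p.natDegree ≤ finrank ℝ E ∧
      ∀ t : ℝ, p.eval t = (ContinuousLinearMap.id ℝ E + t • A).det := by
  classical
  let b := Module.finBasis ℝ E
  let M := LinearMap.toMatrix b b (A : E →ₗ[ℝ] E)
  refine ⟨Matrix.det ((X : ℝ[X]) • M.map C + (1 : Matrix _ _ ℝ).map C), ?_, fun t => ?_⟩
  · simpa using natDegree_det_X_add_C_le M 1
  · rw [ContinuousLinearMap.det, ← LinearMap.det_toMatrix b, ← coe_evalRingHom,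
      RingHom.map_det]
    congr 1
    ext i j
    by_cases hij : i = j <;>
      simp [M, LinearMap.toMatrix_apply, hij, add_comm, mul_comm t]

/-- `det (1 + A)` is a fixed affine combination of the `det (1 + t A)`, `t` running through
enough interpolation nodes. -/
theorem det_id_add_eq_sum {s : Finset ℝ} (hs : finrank ℝ E < s.card) (A : E →L[ℝ] E) :
    (ContinuousLinearMap.id ℝ E + A).det =
      ∑ t ∈ s, (Lagrange.basis s id t).eval 1 * (ContinuousLinearMap.id ℝ E + t • A).det := by
  obtain ⟨p, hp, hpe⟩ := exists_polynomial_eval_eq_det A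
  have h := congrArg (eval 1) (Lagrange.eq_interpolate (s := s) (v := id) (f := p)
    Function.injective_id.injOn
    (degree_le_natDegree.trans_lt (by exact_mod_cast hp.trans_lt hs)))
  rw [hpe, one_smul, Lagrange.interpolate_apply, eval_finsetSum] at h
  rw [h]
  exact Finset.sum_congr rfl fun t _ => by simp [hpe, mul_comm]

theorem sum_eval_lagrange_basis {s : Finset ℝ} (hs : s.Nonempty) (x : ℝ) :
    ∑ t ∈ s, (Lagrange.basis s id t).eval x = 1 := by
  rw [← eval_finsetSum, Lagrange.sum_basis Function.injective_id.injOn hs, eval_one]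

/-- There is no smooth map of the unit ball to the unit sphere fixing the sphere pointwise. -/
theorem not_exists_contDiff_retraction {k : E → E} (hk : ContDiff ℝ 1 k)
    (hk1 : ∀ x, ‖k x‖ = 1) (hks : ∀ x, ‖x‖ = 1 → k x = x) : False := by
  borelize E
  let μ : Measure E := (finBasis ℝ E).addHaar
  let B : Set E := closedBall 0 1
  have hB : IsCompact B := isCompact_closedBall _ _
  let v : E → E := fun x => k x - x
  have hv : ContDiff ℝ 1 v := hk.sub contDiff_id
  let D : E → E →L[ℝ] E := fderiv ℝ v
  have hD : Continuous D := hv.continuous_fderiv one_ne_zero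
  have hDv : ∀ x, HasFDerivAt v (D x) x :=
    fun x => (hv.differentiable one_ne_zero x).hasFDerivAt
  obtain ⟨K, hK⟩ := hv.contDiffOn.exists_lipschitzOnWith one_ne_zero
    (convex_closedBall (0 : E) 1) hB
  have hw := lipschitzWith_indicator_closedBall hK fun x hx => by simp [v, hks x hx]
  let J : ℝ → E → ℝ := fun t x => (ContinuousLinearMap.id ℝ E + t • D x).det
  have hJ : Continuous fun z : ℝ × E => J z.1 z.2 :=
    ContinuousLinearMap.continuous_det.comp
      (continuous_const.add (continuous_fst.smul (hD.comp continuous_snd)))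
  have hpos : ∀ᶠ t in 𝓝 (0 : ℝ), ∀ x ∈ B, 0 < J t x := by
    refine hB.eventually_forall_of_forall_eventually fun x _ => ?_
    exact hJ.continuousAt.eventually (lt_mem_nhds (by simp [J, ContinuousLinearMap.det]))
  have hlip : ∀ᶠ t in 𝓝 (0 : ℝ), ‖t‖₊ * (2 * K) < 1 := by
    have : Continuous fun t : ℝ => ‖t‖₊ * (2 * K) := by fun_prop
    exact this.continuousAt.eventually (gt_mem_nhds (by simp))
  have hvol : ∀ t : ℝ, 0 < t → t < 1 → (∀ x ∈ B, 0 < J t x) → ‖t‖₊ * (2 * K) < 1 →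
      ∫ x in B, J t x ∂μ = μ.real B := by
    intro t ht0 ht1 htp htl
    have hbij : Function.Bijective fun x => x + t • B.indicator v x :=
      bijective_add_of_lipschitzWith htl
        (LipschitzWith.of_dist_le_mul fun x y => by
          rw [dist_smul₀, NNReal.coe_mul, mul_assoc]
          exact mul_le_mul_of_nonneg_left (hw.dist_le_mul x y) (norm_nonneg t))
    have heq : EqOn (fun x => x + t • B.indicator v x) (fun x => x + t • v x) B :=
      fun x hx => by simp [indicator_of_mem hx]
    have himg : (fun x => x + t • v x) '' B = B := by
      apply Subset.antisymm
      · rintro _ ⟨x, hx, rfl⟩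
        have hx' : ‖x‖ ≤ 1 := by simpa [B] using hx
        have : x + t • v x = (1 - t) • x + t • k x := by simp only [v]; module
        simp only [B, mem_closedBall, dist_zero_right, this]
        calc ‖(1 - t) • x + t • k x‖ ≤ ‖(1 - t) • x‖ + ‖t • k x‖ := norm_add_le _ _
          _ = (1 - t) * ‖x‖ + t := by
            rw [norm_smul, norm_smul, hk1, Real.norm_of_nonneg ht0.le,
              Real.norm_of_nonneg (by linarith), mul_one]
          _ ≤ 1 := by nlinarith
      · intro y hy
        obtain ⟨x, hx⟩ := hbij.2 y
        by_cases hxB : x ∈ B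
        · exact ⟨x, hxB, by rw [← hx]; exact (heq hxB).symm⟩
        · simp only [indicator_of_notMem hxB, smul_zero, add_zero] at hx
          exact absurd (hx ▸ hy) hxB
    have hinj : InjOn (fun x => x + t • v x) B := (hbij.1.injOn).congr heq
    have hder : ∀ x ∈ B, HasFDerivWithinAt (fun x => x + t • v x)
        (ContinuousLinearMap.id ℝ E + t • D x) B x :=
      fun x _ => ((hasFDerivAt_id x).add ((hDv x).const_smul t)).hasFDerivWithinAt
    have h := integral_image_eq_integral_abs_det_fderiv_smul μ hB.measurableSet hder hinj
      fun _ => (1 : ℝ)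
    rw [himg] at h
    rw [setIntegral_const, smul_eq_mul, mul_one] at h
    rw [h]
    refine setIntegral_congr_fun hB.measurableSet fun x hx => ?_
    simp only [smul_eq_mul, mul_one]
    exact (abs_of_pos (htp x hx)).symm
  obtain ⟨δ, hδ, hball⟩ := Metric.eventually_nhds_iff.1 (hpos.and hlip)
  obtain ⟨s, hsub, hcard⟩ := (Ioo_infinite (lt_min hδ one_pos)).exists_subset_card_eq
    (finrank ℝ E + 1)
  have hs : finrank ℝ E < s.card := by omega
  have hsvol : ∀ t ∈ s, ∫ x in B, J t x ∂μ = μ.real B := by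
    intro t ht
    obtain ⟨h0, h1⟩ := hsub ht
    have hd := hball (y := t) (by
      rw [dist_zero_right, Real.norm_of_nonneg h0.le]; exact h1.trans_le (min_le_left _ _))
    exact hvol t h0 (h1.trans_le (min_le_right _ _)) hd.1 hd.2
  have hJ1 : ∀ x, J 1 x = 0 := by
    intro x
    by_contra hne
    have hkx : HasFDerivAt k (ContinuousLinearMap.id ℝ E + D x) x := by
      have := (hasFDerivAt_id x).add (hDv x)
      refine this.congr_of_eventuallyEq (.of_forall fun y => ?_)
      simp [v]
    have horth : ∀ u, inner ℝ (k x) ((ContinuousLinearMap.id ℝ E + D x) u) = 0 := by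
      intro u
      have h1 := hkx.norm_sq
      have h2 : (fun y => ‖k y‖ ^ 2) = fun _ => (1 : ℝ) := by ext y; simp [hk1]
      rw [h2] at h1
      have h3 := DFunLike.congr_fun (h1.unique (hasFDerivAt_const (1 : ℝ) x)) u
      simp only [smul_apply, ContinuousLinearMap.comp_apply,
        innerSL_apply_apply, zero_apply, nsmul_eq_mul, Nat.cast_ofNat] at h3
      linarith
    have hunit : IsUnit (LinearMap.det
        ((ContinuousLinearMap.id ℝ E + D x : E →L[ℝ] E) : E →ₗ[ℝ] E)) := by
      refine isUnit_iff_ne_zero.2 fun h0 => hne ?_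
      simp only [J, one_smul]
      exact h0
    obtain ⟨u, hu⟩ := (LinearMap.equivOfIsUnitDet hunit).surjective (k x)
    have h := horth u
    rw [LinearMap.equivOfIsUnitDet_apply] at hu
    change (ContinuousLinearMap.id ℝ E + D x) u = k x at hu
    rw [hu, real_inner_self_eq_norm_sq, hk1] at h
    norm_num at h
  have hcombo : ∀ x, J 1 x = ∑ t ∈ s, (Lagrange.basis s id t).eval 1 * J t x := fun x => by
    simp only [J, one_smul]
    exact det_id_add_eq_sum hs (D x)
  have hint : ∀ t, IntegrableOn (J t) B μ := fun t =>
    (hJ.comp (by fun_prop : Continuous fun x : E => (t, x))).continuousOn.integrableOn_compact hB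
  have htotal : ∫ x in B, J 1 x ∂μ = μ.real B := by
    simp only [hcombo]
    rw [integral_finsetSum _ fun t _ => (hint t).const_mul _]
    simp only [integral_const_mul]
    rw [Finset.sum_congr rfl fun t ht => by rw [hsvol t ht], ← Finset.sum_mul,
      sum_eval_lagrange_basis (Finset.card_pos.1 (by omega)), one_mul]
  simp only [hJ1, integral_zero] at htotal
  have : 0 < μ.real B := ENNReal.toReal_pos
    (measure_closedBall_pos μ _ one_pos).ne' hB.measure_lt_top.ne
  exact this.ne htotal

/-- A continuous self-map close to the identity on the unit ball has a zero there. -/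
theorem exists_zero_of_norm_sub_lt {F : E → E} (hF : Continuous F)
    (hclose : ∀ x, ‖x‖ ≤ 1 → ‖F x - x‖ < 1 / 4) : ∃ x, ‖x‖ ≤ 1 ∧ F x = 0 := by
  by_contra! hne
  let φ : E → ℝ := fun x => max 0 (min 1 (2 - 4 * ‖x‖))
  have hφ : Continuous φ := by fun_prop
  let h : E → E := fun x => x + φ x • (F x - x)
  have hh : Continuous h := by fun_prop
  have hout : ∀ x, 1 / 2 ≤ ‖x‖ → h x = x := fun x hx => by
    have : φ x = 0 := max_eq_left ((min_le_right _ _).trans (by linarith))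
    simp [h, this]
  have hh0 : ∀ x, h x ≠ 0 := by
    intro x hx
    rcases le_or_gt (1 / 2) ‖x‖ with hx2 | hx2
    · rw [hout x hx2] at hx
      rw [hx, norm_zero] at hx2
      norm_num at hx2
    · have hφ0 : 0 ≤ φ x := le_max_left _ _
      have hφ1 : φ x ≤ 1 := max_le zero_le_one (min_le_left _ _)
      have hn : ‖x‖ < 1 / 4 := by
        have hxe : x = -(φ x • (F x - x)) := eq_neg_of_add_eq_zero_left hx
        have hc := hclose x (by linarith)
        calc ‖x‖ = φ x * ‖F x - x‖ := by
              conv_lhs => rw [hxe]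
              rw [norm_neg, norm_smul, Real.norm_of_nonneg hφ0]
          _ ≤ 1 * ‖F x - x‖ := by gcongr
          _ < 1 / 4 := by linarith
      have h1 : φ x = 1 := by
        simp only [φ]
        rw [min_eq_left (by linarith), max_eq_right zero_le_one]
      simp only [h, h1, one_smul, add_sub_cancel] at hx
      exact hne x (by linarith) hx
  have hU : {x : E | 1 / 2 < ‖x‖} ∈ 𝓝ˢ {x : E | 1 ≤ ‖x‖} :=
    (isOpen_lt continuous_const continuous_norm).mem_nhdsSet.2 fun x hx =>
      (by norm_num : (1 / 2 : ℝ) < 1).trans_le hx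
  obtain ⟨g, hg, hgh, hgs, -⟩ := hh.exists_contDiff_approx_and_eqOn (1 : ℕ∞) hh.norm
    (fun x => norm_pos_iff.2 (hh0 x)) (isClosed_le continuous_const continuous_norm) hU
    (contDiffOn_id.congr fun x hx => hout x (le_of_lt hx))
  have hg0 : ∀ x, g x ≠ 0 := fun x hx => by simpa [hx] using hgh x
  refine not_exists_contDiff_retraction (k := fun x => ‖g x‖⁻¹ • g x) ?_ (fun x => ?_)
    fun x hx => ?_
  · exact ((hg.norm ℝ hg0).inv fun x => norm_ne_zero_iff.2 (hg0 x)).smul hg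
  · rw [norm_smul, norm_inv, norm_norm, inv_mul_cancel₀ (norm_ne_zero_iff.2 (hg0 x))]
  · have : g x = x := (hgs hx.ge).trans (hout x (by rw [hx]; norm_num))
    rw [this, hx, inv_one, one_smul]

end NoRetraction

/-- Every point of a Z-set of the cube lies on the boundary of the cube. -/
theorem IsZSet.exists_coord_eq {T : Type*} [MetricSpace T] {n : ℕ}
    (e : T ≃ₜ (Fin n → unitInterval)) {X : Set T} (hX : IsZSet X) {p : T} (hp : p ∈ X) :
    ∃ i, (e p i : ℝ) = 0 ∨ (e p i : ℝ) = 1 := by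
  by_contra! hne
  have : CompactSpace T := e.symm.compactSpace
  let c : Fin n → ℝ := fun i => e p i
  obtain ⟨r, hr, hr0⟩ : ∃ r : ℝ, (∀ i, r < c i ∧ r < 1 - c i) ∧ 0 < r := by
    have h : ∀ᶠ r in 𝓝[>] (0 : ℝ), ∀ i, r < c i ∧ r < 1 - c i := by
      refine Filter.eventually_all.2 fun i => ?_
      have h0 : 0 < c i := lt_of_le_of_ne (e p i).2.1 (hne i).1.symm
      have h1 : 0 < 1 - c i := sub_pos.2 (lt_of_le_of_ne (e p i).2.2 (hne i).2)
      exact nhdsWithin_le_nhds ((gt_mem_nhds h0).and (gt_mem_nhds h1))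
    exact (h.and self_mem_nhdsWithin).exists
  obtain ⟨η, hη0, hη⟩ : ∃ η > 0, ∀ y : Fin n → ℝ, (∀ i, |y i| < η) →
      ‖WithLp.toLp 2 y‖ < 1 / 4 := by
    have hcont : Continuous fun y : Fin n → ℝ => ‖WithLp.toLp 2 y‖ :=
      (PiLp.continuous_toLp 2 _).norm
    have hlt : ‖(WithLp.toLp 2 (0 : Fin n → ℝ) : EuclideanSpace ℝ (Fin n))‖ < 1 / 4 := by simp
    obtain ⟨η, hη0, hη⟩ := Metric.eventually_nhds_iff.1
      ((hcont.tendsto 0).eventually (gt_mem_nhds hlt))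
    exact ⟨η, hη0, fun y hy => hη ((dist_pi_lt_iff hη0).2 fun i => by simpa using hy i)⟩
  obtain ⟨ε, hε0, hε⟩ := Metric.uniformContinuous_iff.1
    (CompactSpace.uniformContinuous_of_continuous e.continuous) (r * η) (mul_pos hr0 hη0)
  obtain ⟨f, hf, hfε, hfX⟩ := hX.2 ε hε0
  let z : EuclideanSpace ℝ (Fin n) → T := fun x =>
    e.symm fun i => projIcc 0 1 zero_le_one (c i + r * x i)
  have hz : Continuous z := e.symm.continuous.comp
    (continuous_pi fun i => continuous_projIcc.comp (by fun_prop))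
  let F : EuclideanSpace ℝ (Fin n) → EuclideanSpace ℝ (Fin n) := fun x =>
    WithLp.toLp 2 fun i => r⁻¹ * ((e (f (z x)) i : ℝ) - c i)
  have hF : Continuous F := (PiLp.continuous_toLp 2 _).comp <| continuous_pi fun i =>
    continuous_const.mul ((continuous_subtype_val.comp ((continuous_apply i).comp
      (e.continuous.comp (hf.comp hz)))).sub continuous_const)
  obtain ⟨x, -, hx⟩ := exists_zero_of_norm_sub_lt hF fun x hx => by
    refine hη (fun i => r⁻¹ * ((e (f (z x)) i : ℝ) - c i) - x i) fun i => ?_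
    have hxi : |x i| ≤ 1 := (PiLp.norm_apply_le x i).trans hx
    have hmem : c i + r * x i ∈ Icc (0 : ℝ) 1 := by
      have := abs_le.1 hxi
      constructor <;> nlinarith [hr i]
    have hzi : (e (z x) i : ℝ) = c i + r * x i := by
      simp only [z, e.apply_symm_apply]
      rw [projIcc_of_mem _ hmem]
    have hd : |(e (f (z x)) i : ℝ) - e (z x) i| < r * η :=
      (dist_le_pi_dist (e (f (z x))) (e (z x)) i).trans_lt (hε (hfε (z x)))
    have heq : r⁻¹ * ((e (f (z x)) i : ℝ) - c i) - x i =
        r⁻¹ * ((e (f (z x)) i : ℝ) - e (z x) i) := by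
      rw [hzi]; field_simp; ring
    rw [heq, abs_mul, abs_of_pos (inv_pos.2 hr0)]
    exact (inv_mul_lt_iff₀ hr0).2 hd
  have hfz : f (z x) = p := by
    refine e.injective (funext fun i => Subtype.ext ?_)
    have hi : r⁻¹ * ((e (f (z x)) i : ℝ) - c i) = 0 := congrArg (fun y => y i) hx
    exact sub_eq_zero.1 ((mul_eq_zero.1 hi).resolve_left (inv_ne_zero hr0.ne'))
  exact (eq_empty_iff_forall_notMem.1 hfX) p ⟨⟨z x, hfz⟩, hp⟩

/-- The boundary of the cube is pushed radially towards the centre: a boundary point `a` at time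
`t` is at sup-distance `(1 - t / 2) / 2` from the centre, so both `a` and `t` are determined. -/
theorem radial_push_injective {ι : Type*} {a b : ι → unitInterval} {s t : unitInterval}
    (ha : ∃ i, (a i : ℝ) = 0 ∨ (a i : ℝ) = 1) (hb : ∃ i, (b i : ℝ) = 0 ∨ (b i : ℝ) = 1)
    (h : ∀ i, (1 - (s : ℝ) / 2) * a i + (s : ℝ) / 4 = (1 - (t : ℝ) / 2) * b i + (t : ℝ) / 4) :
    a = b ∧ s = t := by
  have key : ∀ {a b : ι → unitInterval} {s t : unitInterval},
      (∃ i, (a i : ℝ) = 0 ∨ (a i : ℝ) = 1) →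
      (∀ i, (1 - (s : ℝ) / 2) * a i + (s : ℝ) / 4 = (1 - (t : ℝ) / 2) * b i + (t : ℝ) / 4) →
      (t : ℝ) ≤ s := by
    rintro a b s t ⟨i, hi⟩ h
    have hi' := h i
    have ht := t.2.2
    have hb0 := (b i).2.1
    have hb1 := (b i).2.2
    have h0 : 0 ≤ (1 - (t : ℝ) / 2) * b i := mul_nonneg (by linarith) hb0
    have h1 : 0 ≤ (1 - (t : ℝ) / 2) * (1 - b i) := mul_nonneg (by linarith) (by linarith)
    rcases hi with hi | hi <;> rw [hi] at hi' <;> linarith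
  have hst : s = t := Subtype.ext (le_antisymm (key hb fun i => (h i).symm) (key ha h))
  subst hst
  refine ⟨funext fun i => Subtype.ext ?_, rfl⟩
  have hs : (1 - (s : ℝ) / 2) ≠ 0 := by have := s.2.2; linarith
  exact mul_left_cancel₀ hs (add_right_cancel (h i))

/-- For every `n`, every Z-set of the cube `[0,1]^n` (with any
metric inducing its topology) is a cylindrical subset. -/
theorem statement11 {T : Type*} [MetricSpace T] (n : ℕ)
    (e : T ≃ₜ (Fin n → unitInterval)) (X : Set T) (hX : IsZSet X) :
    IsCylindrical T X := by
  have : CompactSpace T := e.symm.compactSpace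
  have : CompactSpace X := isCompact_iff_compactSpace.1 hX.1.isCompact
  have hmem : ∀ (t a : unitInterval), (1 - (t : ℝ) / 2) * a + (t : ℝ) / 4 ∈ unitInterval := by
    intro t a
    obtain ⟨ht0, ht1⟩ := t.2
    obtain ⟨ha0, ha1⟩ := a.2
    have h0 : 0 ≤ (1 - (t : ℝ) / 2) * a := mul_nonneg (by linarith) ha0
    have h1 : 0 ≤ (1 - (t : ℝ) / 2) * (1 - a) := mul_nonneg (by linarith) (by linarith)
    constructor <;> linarith
  let g : X × unitInterval → Fin n → unitInterval := fun y i =>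
    ⟨(1 - (y.2 : ℝ) / 2) * e y.1 i + (y.2 : ℝ) / 4, hmem _ _⟩
  have hg : Continuous g := by
    refine continuous_pi fun i => Continuous.subtype_mk ?_ _
    have hc : Continuous fun y : X × unitInterval => (e y.1 i : ℝ) :=
      continuous_subtype_val.comp ((continuous_apply i).comp
        (e.continuous.comp (continuous_subtype_val.comp continuous_fst)))
    have ht : Continuous fun y : X × unitInterval => (y.2 : ℝ) :=
      continuous_subtype_val.comp continuous_snd
    exact ((continuous_const.sub (ht.div_const 2)).mul hc).add (ht.div_const 4)
  have hinj : Function.Injective g := by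
    rintro ⟨x, s⟩ ⟨y, t⟩ hxy
    obtain ⟨h1, h2⟩ := radial_push_injective (hX.exists_coord_eq e x.2)
      (hX.exists_coord_eq e y.2) fun i => congrArg Subtype.val (congrFun hxy i)
    exact Prod.ext (Subtype.ext (e.injective h1)) h2
  refine ⟨e.symm ∘ g,
    ((e.symm.continuous.comp hg).isClosedEmbedding (e.symm.injective.comp hinj)).isEmbedding,
    fun x => ?_⟩
  rw [Function.comp_apply, Homeomorph.symm_apply_eq]
  ext i
  simp [g]
end

section
/- Let (X, d) be a compact metric space and let n ∈ ℕ be such that dim X ≥ n (i.e. dim X ≤ n − 1 fails). Then there exists ε > 0 such that every finite open cover α of X × [0,1] satisfying (i) diam π₁(U) < ε for every U ∈ α, where π₁ : X × [0,1] → X is the projection, and (ii) no U ∈ α meets both X × {0} and X × {1}, has mult α ≥ n + 2. -/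
open Set Metric Topology

/-- The family `U` admits an open shrinking which still covers and has empty intersection. -/
def HasThinShrinking {X ι : Type*} [TopologicalSpace X] (U : ι → Set X) : Prop :=
  ∃ V : ι → Set X, (∀ i, IsOpen (V i)) ∧ (∀ i, V i ⊆ U i) ∧ ⋃ i, V i = univ ∧ ⋂ i, V i = ∅

theorem multLE_range {Z ι : Type*} {W : ι → Set Z} {m : ℕ}
    (h : ∀ (x : Z) (T : Finset ι), (∀ i ∈ T, x ∈ W i) → T.card ≤ m) : MultLE (range W) m := by
  classical
  rintro S hS ⟨x, hx⟩
  rcases S.eq_empty_or_nonempty with rfl | ⟨s₀, hs₀⟩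
  · simp
  have : Nonempty ι := ⟨(hS hs₀).choose⟩
  choose! g hg using fun s (hs : s ∈ S) => hS hs
  have hinj : Set.InjOn g (S : Set (Set Z)) := fun a ha b hb hab => by
    rw [← hg a ha, ← hg b hb, hab]
  rw [← Finset.card_image_of_injOn hinj]
  refine h x _ fun i hi => ?_
  obtain ⟨s, hs, rfl⟩ := Finset.mem_image.1 hi
  rw [hg s hs]
  exact hx s hs

section Shrinking

variable {X : Type*} [TopologicalSpace X]

theorem exists_shrinking_of_hasThinShrinking {ι : Type*} {m : ℕ}
    (h : ∀ U : Fin (m + 2) → Set X, (∀ i, IsOpen (U i)) → ⋃ i, U i = univ → HasThinShrinking U)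
    (U : ι → Set X) (hU : ∀ i, IsOpen (U i)) (hc : ⋃ i, U i = univ)
    (𝒯 : Finset (Finset ι)) :
    ∃ W : ι → Set X, (∀ i, IsOpen (W i)) ∧ (∀ i, W i ⊆ U i) ∧ ⋃ i, W i = univ ∧
      ∀ S ∈ 𝒯, S.card = m + 2 → ⋂ i ∈ S, W i = ∅ := by
  classical
  induction 𝒯 using Finset.induction_on with
  | empty => exact ⟨U, hU, fun _ => Subset.rfl, hc, by simp⟩
  | insert S 𝒯 _ ih =>
    obtain ⟨W, hWo, hWU, hWc, hW⟩ := ih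
    by_cases hS : S.card = m + 2
    swap
    · refine ⟨W, hWo, hWU, hWc, fun T hT hTc => ?_⟩
      rcases Finset.mem_insert.1 hT with rfl | hT
      · exact absurd hTc hS
      · exact hW T hT hTc
    let e : S ≃ Fin (m + 2) := S.equivFinOfCardEq hS
    obtain ⟨V, hVo, hVU, hVc, hV⟩ := h (fun k => W (e.symm k) ∪ ⋃ i ∈ {i | i ∉ S}, W i)
      (fun k => (hWo _).union (isOpen_biUnion fun i _ => hWo i)) (by
        refine eq_univ_of_forall fun x => ?_
        obtain ⟨i, hi⟩ := mem_iUnion.1 (hWc.symm ▸ mem_univ x : x ∈ ⋃ i, W i)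
        by_cases hiS : i ∈ S
        · exact mem_iUnion.2 ⟨e ⟨i, hiS⟩, Or.inl (by simpa using hi)⟩
        · exact mem_iUnion.2 ⟨0, Or.inr (mem_biUnion hiS hi)⟩)
    let W' : ι → Set X := fun i => if hi : i ∈ S then W i ∩ V (e ⟨i, hi⟩) else W i
    have hW'W : ∀ i, W' i ⊆ W i := fun i => by
      by_cases hi : i ∈ S <;> simp [W', hi]
    refine ⟨W', fun i => ?_, fun i => (hW'W i).trans (hWU i), eq_univ_of_forall fun x => ?_,
      fun T hT hTc => ?_⟩
    · by_cases hi : i ∈ S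
      · simpa [W', hi] using (hWo i).inter (hVo _)
      · simpa [W', hi] using hWo i
    · obtain ⟨k, hk⟩ := mem_iUnion.1 (hVc.symm ▸ mem_univ x : x ∈ ⋃ i, V i)
      rcases hVU k hk with hx | hx
      · refine mem_iUnion.2 ⟨e.symm k, ?_⟩
        simpa [W'] using And.intro hx hk
      · obtain ⟨i, hi, hxi⟩ := mem_iUnion₂.1 hx
        have hi : i ∉ S := hi
        exact mem_iUnion.2 ⟨i, by simpa [W', hi] using hxi⟩
    · rcases Finset.mem_insert.1 hT with rfl | hT
      · refine eq_empty_of_forall_notMem fun x hx => ?_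
        have : x ∈ ⋂ i, V i := mem_iInter.2 fun k => by
          have := mem_iInter₂.1 hx (e.symm k) (e.symm k).2
          simp only [W', Finset.coe_mem, dif_pos, Subtype.coe_eta, Equiv.apply_symm_apply] at this
          exact this.2
        simp [hV] at this
      · refine subset_empty_iff.1 ((iInter₂_mono fun i _ => hW'W i).trans (hW T hT hTc).subset)

theorem dimLE_of_hasThinShrinking {m : ℕ}
    (h : ∀ U : Fin (m + 2) → Set X, (∀ i, IsOpen (U i)) → ⋃ i, U i = univ → HasThinShrinking U) :
    DimLE X m := by
  classical
  refine Or.inr ⟨m, rfl, fun α hα hαo hαc => ?_⟩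
  have := hα.fintype
  obtain ⟨W, hWo, hWU, hWc, hW⟩ := exists_shrinking_of_hasThinShrinking h (fun U : α => (U : Set X))
    (fun U => hαo U U.2) (by rw [← sUnion_eq_iUnion, hαc]) Finset.univ
  refine ⟨range W, finite_range W, by rintro _ ⟨i, rfl⟩; exact hWo i, by rwa [sUnion_range],
    by rintro _ ⟨i, rfl⟩; exact ⟨i, i.2, hWU i⟩, multLE_range fun x T hT => ?_⟩
  by_contra! hcard
  obtain ⟨S, hST, hS⟩ := Finset.exists_subset_card_eq (show m + 2 ≤ T.card by omega)
  have : x ∈ ⋂ i ∈ S, W i := mem_iInter₂.2 fun i hi => hT i (hST hi)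
  simp [hW S (Finset.mem_univ _) hS] at this

theorem exists_cover_not_hasThinShrinking {n : ℕ} (h : ¬ DimLE X ((n : ℤ) - 1)) :
    ∃ U : Fin (n + 1) → Set X, (∀ i, IsOpen (U i)) ∧ ⋃ i, U i = univ ∧ ¬ HasThinShrinking U := by
  cases n with
  | zero =>
    refine ⟨fun _ => univ, fun _ => isOpen_univ, iUnion_const _, ?_⟩
    rintro ⟨V, -, -, hVc, hV⟩
    refine h (Or.inl ⟨⟨fun x => ?_⟩, by simp⟩)
    obtain ⟨i, hi⟩ := mem_iUnion.1 (hVc.symm ▸ mem_univ x : x ∈ ⋃ i, V i)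
    exact (hV ▸ mem_iInter.2 fun j => (Fin.ext (by omega) : i = j) ▸ hi : x ∈ (∅ : Set X))
  | succ m =>
    contrapose! h
    simpa using dimLE_of_hasThinShrinking h

end Shrinking

/-- Combinatorial data modelling a labelled cover of `X × [0, J]`: a partition of unity `κ` on `X`
with index type `V`, and for every vertex `v` and every level `j ≤ J` a member `φ v j` of the cover,
carrying a label `ℓ` subordinate to the family `U`. The predicate `bot` holds for all members on
level `0` and for none on level `J`, and at most `n + 1` members meet at any point. -/
structure IsLabelledPrism {X V A : Type*} [TopologicalSpace X] [Fintype V] {n : ℕ} (J : ℕ)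
    (U : Fin (n + 1) → Set X) (κ : V → X → ℝ) (φ : V → ℕ → A) (ℓ : A → Fin (n + 1))
    (bot : A → Prop) : Prop where
  continuous : ∀ v, Continuous (κ v)
  nonneg : ∀ v x, 0 ≤ κ v x
  sum_eq_one : ∀ x, ∑ v, κ v x = 1
  label_mem : ∀ v x j, j ≤ J → 0 < κ v x → x ∈ U (ℓ (φ v j))
  card_vertices_le : ∀ x (S : Finset V), (∀ v ∈ S, 0 < κ v x) → S.card ≤ n + 1
  card_le : ∀ x, ∀ j < J, ∀ S : Finset A,
    (∀ a ∈ S, ∃ v, 0 < κ v x ∧ (a = φ v j ∨ a = φ v (j + 1))) → S.card ≤ n + 1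
  bot_zero : ∀ v, bot (φ v 0)
  not_bot_top : ∀ v, ¬ bot (φ v J)

namespace IsLabelledPrism

variable {X V A : Type*} [TopologicalSpace X] [Fintype V]

theorem exists_pos {n J : ℕ} {U : Fin (n + 1) → Set X} {κ : V → X → ℝ} {φ : V → ℕ → A}
    {ℓ : A → Fin (n + 1)} {bot : A → Prop} (H : IsLabelledPrism J U κ φ ℓ bot) (x : X) :
    ∃ v, 0 < κ v x := by
  by_contra! h
  have := H.sum_eq_one x
  rw [Finset.sum_eq_zero fun v _ => le_antisymm (h v) (H.nonneg v x)] at this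
  exact zero_ne_one this

theorem isEmpty {J : ℕ} {U : Fin 1 → Set X} {κ : V → X → ℝ} {φ : V → ℕ → A}
    {ℓ : A → Fin 1} {bot : A → Prop} (H : IsLabelledPrism J U κ φ ℓ bot) : IsEmpty X := by
  classical
  refine ⟨fun x => ?_⟩
  obtain ⟨v, hv⟩ := H.exists_pos x
  have key : ∀ j ≤ J, φ v j = φ v 0 := by
    intro j
    induction j with
    | zero => simp
    | succ j ih =>
      intro hj
      rw [← ih (by omega)]
      by_contra hne
      have := H.card_le x j (by omega) {φ v (j + 1), φ v j} (by
        simp only [Finset.mem_insert, Finset.mem_singleton]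
        rintro a (rfl | rfl)
        exacts [⟨v, hv, Or.inr rfl⟩, ⟨v, hv, Or.inl rfl⟩])
      rw [Finset.card_pair hne] at this
      omega
  exact H.not_bot_top v (key J le_rfl ▸ H.bot_zero v)

open Classical in
/-- The coordinate vector of the label of `a`, with the coordinate `0` suppressed unless
`bot a` holds. -/
noncomputable def weight {n : ℕ} (ℓ : A → Fin (n + 1)) (bot : A → Prop) (a : A)
    (i : Fin (n + 1)) : ℤ :=
  if ℓ a = i ∧ (i = 0 → bot a) then 1 else 0

section One

variable {J : ℕ} {U : Fin 2 → Set X} {κ : V → X → ℝ} {φ : V → ℕ → A}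
    {ℓ : A → Fin 2} {bot : A → Prop}

/-- The oriented area of the weights of a pair. -/
noncomputable def det₂ (ℓ : A → Fin 2) (bot : A → Prop) (a b : A) : ℤ :=
  weight ℓ bot a 0 * weight ℓ bot b 1 - weight ℓ bot a 1 * weight ℓ bot b 0

theorem hasThinShrinking_one (H : IsLabelledPrism J U κ φ ℓ bot) : HasThinShrinking U := by
  classical
  let D := det₂ ℓ bot
  have cocycle : ∀ x j, j < J → ∀ a b c : A,
      (∀ d ∈ ({a, b, c} : Finset A), ∃ v, 0 < κ v x ∧ (d = φ v j ∨ d = φ v (j + 1))) →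
      D b c - D a c + D a b = 0 := by
    intro x j hj a b c h
    have hcard := H.card_le x j hj _ h
    have : a = b ∨ a = c ∨ b = c := by
      by_contra! hne
      rw [Finset.card_eq_three.2 ⟨a, b, c, hne.1, hne.2.1, hne.2.2, rfl⟩] at hcard
      omega
    rcases this with rfl | rfl | rfl <;> simp only [D, det₂] <;> ring
  let β : V → ℤ := fun v => ∑ j ∈ Finset.range J, D (φ v j) (φ v (j + 1))
  let m : V → ℤ := fun v => (ℓ (φ v 0) : ℤ) + β v
  have hm : ∀ x v w, 0 < κ v x → 0 < κ w x → m v = m w := by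
    intro x v w hv hw
    have step : ∀ j ∈ Finset.range J, D (φ w j) (φ w (j + 1)) - D (φ v j) (φ v (j + 1)) =
        D (φ v (j + 1)) (φ w (j + 1)) - D (φ v j) (φ w j) := by
      intro j hj
      have hj := Finset.mem_range.1 hj
      have h₁ := cocycle x j hj (φ v j) (φ w j) (φ w (j + 1)) (by
        simp only [Finset.mem_insert, Finset.mem_singleton]
        rintro a (rfl | rfl | rfl)
        exacts [⟨v, hv, Or.inl rfl⟩, ⟨w, hw, Or.inl rfl⟩, ⟨w, hw, Or.inr rfl⟩])
      have h₂ := cocycle x j hj (φ v j) (φ v (j + 1)) (φ w (j + 1)) (by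
        simp only [Finset.mem_insert, Finset.mem_singleton]
        rintro a (rfl | rfl | rfl)
        exacts [⟨v, hv, Or.inl rfl⟩, ⟨v, hv, Or.inr rfl⟩, ⟨w, hw, Or.inr rfl⟩])
      linarith
    have hsum := Finset.sum_congr rfl step
    rw [Finset.sum_sub_distrib, Finset.sum_range_sub (fun j => D (φ v j) (φ w j))] at hsum
    have htop : D (φ v J) (φ w J) = 0 := by
      simp [D, det₂, weight, H.not_bot_top]
    have hbot : D (φ v 0) (φ w 0) = (ℓ (φ w 0) : ℤ) - (ℓ (φ v 0) : ℤ) := by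
      simp only [D, det₂, weight, H.bot_zero, implies_true, and_true]
      generalize ℓ (φ v 0) = p
      generalize ℓ (φ w 0) = q
      revert p q
      decide
    simp only [m, β]
    linarith
  have full : ∀ x v i, 0 < κ v x → β v ≠ 0 → x ∈ U i := by
    intro x v i hv hβ
    obtain ⟨j, hj, hD⟩ := Finset.exists_ne_zero_of_sum_ne_zero hβ
    have hj := Finset.mem_range.1 hj
    have : ∃ k ≤ J, ℓ (φ v k) = i := by
      by_contra! hne
      refine hD ?_
      have h₁ := hne j hj.le
      have h₂ := hne (j + 1) hj
      fin_cases i <;> simp_all [D, det₂, weight]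
    obtain ⟨k, hk, rfl⟩ := this
    exact H.label_mem v x k hk hv
  have hopen : ∀ P : V → Prop, IsOpen {x | ∃ v, 0 < κ v x ∧ P v} := fun P => by
    simp only [ofPred_exists, ofPred_and]
    exact isOpen_iUnion fun v => (isOpen_lt continuous_const (H.continuous v)).inter isOpen_const
  refine ⟨fun i => {x | ∃ v, 0 < κ v x ∧ (i = 0 ↔ m v = 0)}, fun i => hopen _, ?_, ?_, ?_⟩
  · rintro i x ⟨v, hv, hi⟩
    by_cases hβ : β v = 0
    · have : ℓ (φ v 0) = i := by
        simp only [m, hβ, add_zero] at hi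
        revert hi
        generalize ℓ (φ v 0) = p
        revert p i
        decide
      exact this ▸ H.label_mem v x 0 (Nat.zero_le _) hv
    · exact full x v i hv hβ
  · refine eq_univ_of_forall fun x => ?_
    obtain ⟨v, hv⟩ := H.exists_pos x
    by_cases h : m v = 0
    · exact mem_iUnion.2 ⟨0, v, hv, by simp [h]⟩
    · exact mem_iUnion.2 ⟨1, v, hv, by simp [h]⟩
  · refine eq_empty_of_forall_notMem fun x hx => ?_
    obtain ⟨v, hv, h₀⟩ := mem_iInter.1 hx 0
    obtain ⟨w, hw, h₁⟩ := mem_iInter.1 hx 1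
    simp only [true_iff] at h₀
    simp only [one_ne_zero, false_iff] at h₁
    exact h₁ (hm x v w hv hw ▸ h₀)

end One

section Two

variable {J : ℕ} {U : Fin 3 → Set X} {κ : V → X → ℝ} {φ : V → ℕ → A}
    {ℓ : A → Fin 3} {bot : A → Prop}

/-- The oriented volume of the weights of a triple. -/
noncomputable def det₃ (ℓ : A → Fin 3) (bot : A → Prop) (a b c : A) : ℤ :=
  let w := weight ℓ bot
  w a 0 * (w b 1 * w c 2 - w b 2 * w c 1) - w a 1 * (w b 0 * w c 2 - w b 2 * w c 0) +
    w a 2 * (w b 0 * w c 1 - w b 1 * w c 0)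

/-- The representative in `{-1, 0, 1}` of `q - p` modulo `3`. -/
def shortArc (p q : Fin 3) : ℤ :=
  if q = p then 0 else if q = p + 1 then 1 else -1

theorem exists_label_of_det₃_ne_zero {a b c : A} (h : det₃ ℓ bot a b c ≠ 0) (i : Fin 3) :
    ℓ a = i ∨ ℓ b = i ∨ ℓ c = i := by
  classical
  by_contra! hne
  apply h
  fin_cases i <;> simp_all [det₃, weight]

theorem det₃_of_not_bot {a b c : A} (ha : ¬ bot a) (hb : ¬ bot b) (hc : ¬ bot c) :
    det₃ ℓ bot a b c = 0 := by
  simp [det₃, weight, ha, hb, hc]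

theorem three_mul_det₃_of_bot {a b c : A} (ha : bot a) (hb : bot b) (hc : bot c) :
    3 * det₃ ℓ bot a b c =
      shortArc (ℓ a) (ℓ b) + shortArc (ℓ b) (ℓ c) - shortArc (ℓ a) (ℓ c) := by
  classical
  simp only [det₃, weight, ha, hb, hc, implies_true, and_true]
  generalize ℓ a = p
  generalize ℓ b = q
  generalize ℓ c = r
  revert p q r
  decide

/-- The contribution to the bounding cochain of a prism over an edge. -/
noncomputable def prismDet (ℓ : A → Fin 3) (bot : A → Prop) (φ : V → ℕ → A) (v w : V) (j : ℕ) :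
    ℤ :=
  det₃ ℓ bot (φ v j) (φ w j) (φ w (j + 1)) - det₃ ℓ bot (φ v j) (φ v (j + 1)) (φ w (j + 1))

/-- The integral cochain on edges of the nerve whose coboundary counts oriented triangles with
three different labels. -/
noncomputable def boundingCochain (ℓ : A → Fin 3) (bot : A → Prop) (φ : V → ℕ → A) (J : ℕ)
    (v w : V) : ℤ :=
  ∑ j ∈ Finset.range J, prismDet ℓ bot φ v w j

theorem det₃_cocycle (H : IsLabelledPrism J U κ φ ℓ bot) {x : X} {j : ℕ} (hj : j < J) {a b c d : A}
    (h : ∀ e, e = a ∨ e = b ∨ e = c ∨ e = d → ∃ v, 0 < κ v x ∧ (e = φ v j ∨ e = φ v (j + 1))) :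
    det₃ ℓ bot b c d - det₃ ℓ bot a c d + det₃ ℓ bot a b d - det₃ ℓ bot a b c = 0 := by
  classical
  have hcard := H.card_le x j hj {a, b, c, d} (by simpa using h)
  have : a = b ∨ a = c ∨ a = d ∨ b = c ∨ b = d ∨ c = d := by
    by_contra! hne
    obtain ⟨h₁, h₂, h₃, h₄, h₅, h₆⟩ := hne
    rw [Finset.card_insert_of_notMem (by simp [h₁, h₂, h₃]),
      Finset.card_insert_of_notMem (by simp [h₄, h₅]), Finset.card_pair h₆] at hcard
    omega
  rcases this with rfl | rfl | rfl | rfl | rfl | rfl <;> simp only [det₃] <;> ring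

theorem three_mul_boundingCochain (H : IsLabelledPrism J U κ φ ℓ bot) {x : X} {u v w : V}
    (hu : 0 < κ u x) (hv : 0 < κ v x) (hw : 0 < κ w x) :
    3 * (boundingCochain ℓ bot φ J u v + boundingCochain ℓ bot φ J v w -
        boundingCochain ℓ bot φ J u w) =
      shortArc (ℓ (φ u 0)) (ℓ (φ v 0)) + shortArc (ℓ (φ v 0)) (ℓ (φ w 0)) -
        shortArc (ℓ (φ u 0)) (ℓ (φ w 0)) := by
  let D := det₃ ℓ bot
  have step : ∀ j ∈ Finset.range J,
      prismDet ℓ bot φ u v j + prismDet ℓ bot φ v w j - prismDet ℓ bot φ u w j =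
        D (φ u j) (φ v j) (φ w j) - D (φ u (j + 1)) (φ v (j + 1)) (φ w (j + 1)) := by
    intro j hj
    have hj := Finset.mem_range.1 hj
    have h₁ := H.det₃_cocycle (x := x) hj (a := φ u j) (b := φ v j) (c := φ w j) (d := φ w (j + 1))
      (by rintro e (rfl | rfl | rfl | rfl)
          exacts [⟨u, hu, Or.inl rfl⟩, ⟨v, hv, Or.inl rfl⟩, ⟨w, hw, Or.inl rfl⟩,
            ⟨w, hw, Or.inr rfl⟩])
    have h₂ := H.det₃_cocycle (x := x) hj (a := φ u j) (b := φ v j) (c := φ v (j + 1))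
      (d := φ w (j + 1))
      (by rintro e (rfl | rfl | rfl | rfl)
          exacts [⟨u, hu, Or.inl rfl⟩, ⟨v, hv, Or.inl rfl⟩, ⟨v, hv, Or.inr rfl⟩,
            ⟨w, hw, Or.inr rfl⟩])
    have h₃ := H.det₃_cocycle (x := x) hj (a := φ u j) (b := φ u (j + 1)) (c := φ v (j + 1))
      (d := φ w (j + 1))
      (by rintro e (rfl | rfl | rfl | rfl)
          exacts [⟨u, hu, Or.inl rfl⟩, ⟨u, hu, Or.inr rfl⟩, ⟨v, hv, Or.inr rfl⟩,
            ⟨w, hw, Or.inr rfl⟩])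
    simp only [prismDet, D]
    linarith
  have hsum := Finset.sum_congr rfl step
  rw [Finset.sum_sub_distrib, Finset.sum_add_distrib,
    Finset.sum_range_sub' (fun j => D (φ u j) (φ v j) (φ w j)),
    show D (φ u J) (φ v J) (φ w J) = 0 from
      det₃_of_not_bot (H.not_bot_top u) (H.not_bot_top v) (H.not_bot_top w), sub_zero] at hsum
  rw [← three_mul_det₃_of_bot (H.bot_zero u) (H.bot_zero v) (H.bot_zero w)]
  simp only [boundingCochain]
  rw [hsum]

theorem mem_of_boundingCochain_ne_zero (H : IsLabelledPrism J U κ φ ℓ bot) {x : X} {v w : V}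
    (hv : 0 < κ v x) (hw : 0 < κ w x) (h : boundingCochain ℓ bot φ J v w ≠ 0) (i : Fin 3) :
    x ∈ U i := by
  obtain ⟨j, hj, hD⟩ := Finset.exists_ne_zero_of_sum_ne_zero h
  have hj := Finset.mem_range.1 hj
  have : det₃ ℓ bot (φ v j) (φ w j) (φ w (j + 1)) ≠ 0 ∨
      det₃ ℓ bot (φ v j) (φ v (j + 1)) (φ w (j + 1)) ≠ 0 := by
    by_contra! h0
    exact hD (by rw [prismDet, h0.1, h0.2, sub_zero])
  rcases this with h | h <;> rcases exists_label_of_det₃_ne_zero h i with rfl | rfl | rfl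
  exacts [H.label_mem v x j hj.le hv, H.label_mem w x j hj.le hw, H.label_mem w x (j + 1) hj hw,
    H.label_mem v x j hj.le hv, H.label_mem v x (j + 1) hj hv, H.label_mem w x (j + 1) hj hw]

theorem shortArc_modEq (p q : Fin 3) : ∃ k : ℤ, shortArc p q = (q : ℤ) - (p : ℤ) + 3 * k := by
  have : ∀ p q : Fin 3, shortArc p q = (q : ℤ) - (p : ℤ) + 3 * 0 ∨
      shortArc p q = (q : ℤ) - (p : ℤ) + 3 * 1 ∨ shortArc p q = (q : ℤ) - (p : ℤ) + 3 * (-1) := by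
    decide
  rcases this p q with h | h | h
  exacts [⟨_, h⟩, ⟨_, h⟩, ⟨_, h⟩]

/-- If `i` is the label of neither end, then an arc starting at `p` ends, modulo `3`, in the arc
complementary to the open arc of radius `1` about `i`. -/
theorem exists_shift_of_ne {p i : Fin 3} (hp : p ≠ i) :
    ∃ k : ℤ, ∀ q : Fin 3, q ≠ i →
      (i : ℤ) + 1 + 3 * k ≤ p + shortArc p q ∧ (p : ℤ) + shortArc p q ≤ i + 2 + 3 * k := by
  have : ∀ p i : Fin 3, p ≠ i →
      (∀ q : Fin 3, q ≠ i → (i : ℤ) + 1 + 3 * 0 ≤ p + shortArc p q ∧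
        (p : ℤ) + shortArc p q ≤ i + 2 + 3 * 0) ∨
      (∀ q : Fin 3, q ≠ i → (i : ℤ) + 1 + 3 * (-1) ≤ p + shortArc p q ∧
        (p : ℤ) + shortArc p q ≤ i + 2 + 3 * (-1)) := by decide
  rcases this p i hp with h | h
  exacts [⟨_, h⟩, ⟨_, h⟩]

theorem hasThinShrinking_two (H : IsLabelledPrism J U κ φ ℓ bot) : HasThinShrinking U := by
  classical
  let lam : V → Fin 3 := fun v => ℓ (φ v 0)
  let g : V → V → ℤ := fun v w => shortArc (lam v) (lam w) - 3 * boundingCochain ℓ bot φ J v w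
  have hg : ∀ x u v w, 0 < κ u x → 0 < κ v x → 0 < κ w x → g u v + g v w = g u w := by
    intro x u v w hu hv hw
    have := H.three_mul_boundingCochain hu hv hw
    simp only [g, lam]
    linarith
  let f : V → X → ℝ := fun v x => (lam v : ℕ) + ∑ w, κ w x * g v w
  have hfc : ∀ v, Continuous (f v) := fun v =>
    continuous_const.add (continuous_finsetSum _ fun w _ => (H.continuous w).mul continuous_const)
  have hf : ∀ x v w, 0 < κ v x → 0 < κ w x → ∃ k : ℤ, f w x = f v x + 3 * k := by
    intro x v w hv hw
    obtain ⟨k, hk⟩ := shortArc_modEq (lam v) (lam w)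
    have hsum : ∑ u, κ u x * (g w u : ℝ) = ∑ u, κ u x * (g v u : ℝ) - g v w := by
      rw [← one_mul (g v w : ℝ), ← H.sum_eq_one x, Finset.sum_mul, ← Finset.sum_sub_distrib]
      refine Finset.sum_congr rfl fun u _ => ?_
      rcases (H.nonneg u x).eq_or_lt with h0 | hu
      · simp [← h0]
      · rw [← hg x v w u hv hw hu]
        push_cast
        ring
    refine ⟨boundingCochain ℓ bot φ J v w - k, ?_⟩
    have hgk : (g v w : ℝ) = (lam w : ℕ) - (lam v : ℕ) + 3 * k -
        3 * boundingCochain ℓ bot φ J v w := by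
      simp only [g, hk]
      push_cast
      ring
    simp only [f, hsum, hgk]
    push_cast
    ring
  refine ⟨fun i => {x | ∃ v, 0 < κ v x ∧ ∃ k : ℤ, |f v x - (i : ℕ) - 3 * k| < 1}, fun i => ?_,
    ?_, ?_, ?_⟩
  · simp only [ofPred_exists, ofPred_and]
    refine isOpen_iUnion fun v => (isOpen_lt continuous_const (H.continuous v)).inter
      (isOpen_iUnion fun k => isOpen_lt ?_ continuous_const)
    have := hfc v
    fun_prop
  · rintro i x ⟨v, hv, k, hk⟩
    by_cases hb : ∀ w, 0 < κ w x → boundingCochain ℓ bot φ J v w = 0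
    swap
    · push Not at hb
      obtain ⟨w, hw, hb⟩ := hb
      exact H.mem_of_boundingCochain_ne_zero hv hw hb i
    by_cases hl : ∃ w, 0 < κ w x ∧ lam w = i
    · obtain ⟨w, hw, rfl⟩ := hl
      exact H.label_mem w x 0 (Nat.zero_le _) hw
    push Not at hl
    exfalso
    obtain ⟨m, hm⟩ := exists_shift_of_ne (hl v hv)
    have hfx : f v x = ∑ w, κ w x * ((lam v : ℕ) + g v w) := by
      simp only [mul_add, Finset.sum_add_distrib, ← Finset.sum_mul, H.sum_eq_one, one_mul, f]
    have hgw : ∀ w, 0 < κ w x → ((lam v : ℕ) : ℝ) + g v w =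
        ((lam v + shortArc (lam v) (lam w) : ℤ) : ℝ) := by
      intro w hw
      simp only [g, hb w hw]
      push_cast
      ring
    have hlow : (i : ℕ) + 1 + 3 * (m : ℝ) ≤ f v x := by
      rw [hfx, show (i : ℕ) + 1 + 3 * (m : ℝ) = ∑ w, κ w x * ((i : ℕ) + 1 + 3 * (m : ℝ)) by
        rw [← Finset.sum_mul, H.sum_eq_one, one_mul]]
      refine Finset.sum_le_sum fun w _ => ?_
      rcases (H.nonneg w x).eq_or_lt with h0 | hw
      · simp [← h0]
      · refine mul_le_mul_of_nonneg_left ?_ hw.le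
        rw [hgw w hw]
        exact_mod_cast (hm (lam w) (hl w hw)).1
    have hup : f v x ≤ (i : ℕ) + 2 + 3 * (m : ℝ) := by
      rw [hfx, show (i : ℕ) + 2 + 3 * (m : ℝ) = ∑ w, κ w x * ((i : ℕ) + 2 + 3 * (m : ℝ)) by
        rw [← Finset.sum_mul, H.sum_eq_one, one_mul]]
      refine Finset.sum_le_sum fun w _ => ?_
      rcases (H.nonneg w x).eq_or_lt with h0 | hw
      · simp [← h0]
      · refine mul_le_mul_of_nonneg_left ?_ hw.le
        rw [hgw w hw]
        exact_mod_cast (hm (lam w) (hl w hw)).2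
    obtain ⟨h₁, h₂⟩ := abs_lt.1 hk
    rcases le_or_gt k m with hkm | hkm
    · have : (k : ℝ) ≤ m := by exact_mod_cast hkm
      linarith
    · have : (m : ℝ) + 1 ≤ k := by exact_mod_cast hkm
      linarith
  · refine eq_univ_of_forall fun x => ?_
    obtain ⟨v, hv⟩ := H.exists_pos x
    have h₁ := Int.floor_le (f v x)
    have h₂ := Int.lt_floor_add_one (f v x)
    have hi : (⌊f v x⌋ % 3).toNat < 3 := by omega
    refine mem_iUnion.2 ⟨⟨(⌊f v x⌋ % 3).toNat, hi⟩, v, hv, ⌊f v x⌋ / 3, ?_⟩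
    have : (((⌊f v x⌋ % 3).toNat : ℕ) : ℝ) + 3 * ((⌊f v x⌋ / 3 : ℤ) : ℝ) = (⌊f v x⌋ : ℝ) := by
      have : (((⌊f v x⌋ % 3).toNat : ℕ) : ℤ) + 3 * (⌊f v x⌋ / 3) = ⌊f v x⌋ := by omega
      exact_mod_cast this
    rw [sub_sub, this, abs_lt]
    constructor <;> linarith
  · refine eq_empty_of_forall_notMem fun x hx => ?_
    obtain ⟨v, hv, -⟩ := mem_iInter.1 hx 0
    have hx' : ∀ i : Fin 3, ∃ k : ℤ, |f v x - (i : ℕ) - 3 * k| < 1 := by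
      intro i
      obtain ⟨w, hw, k, hk⟩ := mem_iInter.1 hx i
      obtain ⟨m, hm⟩ := hf x v w hv hw
      refine ⟨k - m, ?_⟩
      rw [hm] at hk
      push_cast
      convert hk using 2
      ring
    obtain ⟨a, ha⟩ := hx' 0
    obtain ⟨b, hb⟩ := hx' 1
    obtain ⟨c, hc⟩ := hx' 2
    rw [abs_lt] at ha hb hc
    simp only [Fin.val_zero, Fin.val_one, Fin.val_two, Nat.cast_zero, Nat.cast_one,
      Nat.cast_ofNat] at ha hb hc
    have h₁ : (a : ℝ) < b + 1 := by linarith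
    have h₂ : (b : ℝ) < a + 1 := by linarith
    have h₃ : (b : ℝ) < c + 1 := by linarith
    have h₄ : (c : ℝ) < b + 1 := by linarith
    have h₅ : (a : ℝ) < c + 2 := by linarith
    norm_cast at h₁ h₂ h₃ h₄
    have hab : a = b := by omega
    have hbc : b = c := by omega
    subst hab hbc
    linarith

end Two

section General

variable {n J : ℕ} {U : Fin (n + 1) → Set X} {κ : V → X → ℝ} {φ : V → ℕ → A}
    {ℓ : A → Fin (n + 1)} {bot : A → Prop}

/-- The hat function with peak at `k`. -/
noncomputable def hat (k : ℕ) (t : ℝ) : ℝ := max 0 (1 - |t - k|)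

theorem continuous_hat (k : ℕ) : Continuous (hat k) := by
  unfold hat
  fun_prop

/-- Piecewise linear interpolation: on `[j, j + 1]` the sum of hat functions interpolates
linearly. -/
theorem exists_sum_hat {J : ℕ} (hJ : 0 < J) {t : ℝ} (ht : t ∈ Icc (0 : ℝ) J) :
    ∃ j < J, ∃ r ∈ Icc (0 : ℝ) 1, ∀ a : ℕ → ℝ,
      ∑ k ∈ Finset.range (J + 1), hat k t * a k = (1 - r) * a j + r * a (j + 1) := by
  obtain ⟨j, hj, hjt, htj⟩ : ∃ j < J, (j : ℝ) ≤ t ∧ t ≤ j + 1 := by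
    rcases ht.2.eq_or_lt with rfl | hlt
    · refine ⟨J - 1, by omega, ?_, ?_⟩ <;> rw [Nat.cast_sub (by omega)] <;> simp
    · exact ⟨⌊t⌋₊, (Nat.floor_lt ht.1).2 hlt, Nat.floor_le ht.1, (Nat.lt_floor_add_one t).le⟩
  refine ⟨j, hj, t - j, ⟨by linarith, by linarith⟩, fun a => ?_⟩
  rw [← Finset.sum_subset (s₁ := {j, j + 1})]
  · rw [Finset.sum_pair (by omega)]
    have h₁ : hat j t = 1 - (t - j) := by
      rw [hat, abs_of_nonneg (by linarith), max_eq_right (by linarith)]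
    have h₂ : hat (j + 1) t = t - j := by
      rw [hat, abs_of_nonpos (by push_cast; linarith), max_eq_right (by push_cast; linarith)]
      push_cast
      ring
    rw [h₁, h₂]
  · intro k hk
    simp only [Finset.mem_insert, Finset.mem_singleton, Finset.mem_range] at hk ⊢
    omega
  · intro k _ hk
    simp only [Finset.mem_insert, Finset.mem_singleton, not_or] at hk
    have : hat k t = 0 := by
      refine max_eq_left ?_
      rcases lt_or_gt_of_ne hk.1 with h | h
      · have : (k : ℝ) + 1 ≤ j := by exact_mod_cast h
        linarith [le_abs_self (t - k)]
      · have : (j : ℝ) + 2 ≤ k := by exact_mod_cast (by omega : j + 2 ≤ k)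
        linarith [neg_abs_le (t - k)]
    rw [this, zero_mul]

theorem hat_natCast (k j : ℕ) : hat k (j : ℝ) = if k = j then 1 else 0 := by
  split_ifs with h
  · simp [hat, h]
  · refine max_eq_left ?_
    have : (1 : ℝ) ≤ |((j : ℤ) - (k : ℤ) : ℤ)| := by
      exact_mod_cast Int.one_le_abs (by omega : (j : ℤ) - k ≠ 0)
    push_cast at this
    linarith

open Classical in
/-- The total mass at `(x, t)` of those members of the prism which satisfy `P`. -/
noncomputable def mass (κ : V → X → ℝ) (φ : V → ℕ → A) (J : ℕ) (P : A → Prop) (x : X) (t : ℝ) : ℝ :=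
  ∑ v, κ v x * ∑ k ∈ Finset.range (J + 1), hat k t * (if P (φ v k) then 1 else 0)

theorem continuous_mass (H : IsLabelledPrism J U κ φ ℓ bot) (P : A → Prop) :
    Continuous fun p : X × ℝ => mass κ φ J P p.1 p.2 := by
  unfold mass
  refine continuous_finsetSum _ fun v _ => ((H.continuous v).comp continuous_fst).mul
    (continuous_finsetSum _ fun k _ => ((continuous_hat k).comp continuous_snd).mul
      continuous_const)

theorem mass_nonneg (H : IsLabelledPrism J U κ φ ℓ bot) (P : A → Prop) (x : X) (t : ℝ) :
    0 ≤ mass κ φ J P x t := by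
  refine Finset.sum_nonneg fun v _ => mul_nonneg (H.nonneg v x) (Finset.sum_nonneg fun k _ =>
    mul_nonneg (le_max_left _ _) ?_)
  split_ifs <;> norm_num

theorem mass_mono (H : IsLabelledPrism J U κ φ ℓ bot) {P Q : A → Prop} (hPQ : ∀ a, P a → Q a)
    (x : X) (t : ℝ) : mass κ φ J P x t ≤ mass κ φ J Q x t := by
  refine Finset.sum_le_sum fun v _ => mul_le_mul_of_nonneg_left (Finset.sum_le_sum fun k _ =>
    mul_le_mul_of_nonneg_left ?_ (le_max_left _ _)) (H.nonneg v x)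
  by_cases hP : P (φ v k)
  · simp [hP, hPQ _ hP]
  · simp only [hP, if_false]
    split_ifs <;> norm_num

theorem mass_eq_zero {P : A → Prop} {x : X} {t : ℝ}
    (h : ∀ v k, 0 < κ v x → k ≤ J → 0 < hat k t → ¬ P (φ v k))
    (H : IsLabelledPrism J U κ φ ℓ bot) : mass κ φ J P x t = 0 := by
  refine Finset.sum_eq_zero fun v _ => ?_
  rcases (H.nonneg v x).eq_or_lt with h0 | hv
  · rw [← h0, zero_mul]
  rw [Finset.sum_eq_zero, mul_zero]
  intro k hk
  have hk₀ : 0 ≤ hat k t := le_max_left _ _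
  rcases hk₀.eq_or_lt with h0 | hk0
  · rw [← h0, zero_mul]
  · rw [if_neg (h v k hv (Nat.lt_succ_iff.1 (Finset.mem_range.1 hk)) hk0), mul_zero]

theorem mass_eq_interpolation {X : Type*} {κ : V → X → ℝ} {j : ℕ} {r t : ℝ}
    (h : ∀ a : ℕ → ℝ,
      ∑ k ∈ Finset.range (J + 1), hat k t * a k = (1 - r) * a j + r * a (j + 1))
    (P : A → Prop) [DecidablePred P] (x : X) :
    mass κ φ J P x t = ∑ v, κ v x * ((1 - r) * (if P (φ v j) then 1 else 0) +
      r * (if P (φ v (j + 1)) then 1 else 0)) := by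
  unfold mass
  refine Finset.sum_congr rfl fun v _ => ?_
  rw [← h fun k => if P (φ v k) then 1 else 0]
  congr!

theorem sum_mass (hJ : 0 < J) (H : IsLabelledPrism J U κ φ ℓ bot) (x : X) {t : ℝ}
    (ht : t ∈ Icc (0 : ℝ) J) : ∑ i, mass κ φ J (fun a => ℓ a = i) x t = 1 := by
  obtain ⟨j, -, r, -, h⟩ := exists_sum_hat hJ ht
  simp_rw [mass_eq_interpolation h]
  rw [Finset.sum_comm]
  simp_rw [← Finset.mul_sum, Finset.sum_add_distrib, ← Finset.mul_sum]
  simp [H.sum_eq_one]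

theorem bot_dichotomy (hJ : 0 < J) (H : IsLabelledPrism J U κ φ ℓ bot) {x : X} {t : ℝ}
    (ht : t ∈ Icc (0 : ℝ) J) (hpos : ∀ i, 0 < mass κ φ J (fun a => ℓ a = i) x t) :
    mass κ φ J (fun a => ℓ a = 0 ∧ bot a) x t = mass κ φ J (fun a => ℓ a = 0) x t ∨
      mass κ φ J (fun a => ℓ a = 0 ∧ bot a) x t = 0 := by
  classical
  obtain ⟨j, hj, r, hr, h⟩ := exists_sum_hat hJ ht
  let C : Finset A := (Finset.univ.filter fun v => 0 < κ v x).image (fun v => φ v j) ∪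
    (Finset.univ.filter fun v => 0 < κ v x).image (fun v => φ v (j + 1))
  have hC : ∀ v, 0 < κ v x → φ v j ∈ C ∧ φ v (j + 1) ∈ C := fun v hv =>
    ⟨Finset.mem_union_left _ (Finset.mem_image_of_mem _ (by simp [hv])),
      Finset.mem_union_right _ (Finset.mem_image_of_mem _ (by simp [hv]))⟩
  have hcard : C.card ≤ n + 1 := H.card_le x j hj C fun a ha => by
    simp only [C, Finset.mem_union, Finset.mem_image, Finset.mem_filter, Finset.mem_univ,
      true_and] at ha
    rcases ha with ⟨v, hv, rfl⟩ | ⟨v, hv, rfl⟩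
    exacts [⟨v, hv, Or.inl rfl⟩, ⟨v, hv, Or.inr rfl⟩]
  have hzero : ∀ P : A → Prop, (∀ a ∈ C, ¬ P a) → mass κ φ J P x t = 0 := fun P hP => by
    rw [mass_eq_interpolation h]
    refine Finset.sum_eq_zero fun v _ => ?_
    rcases (H.nonneg v x).eq_or_lt with h0 | hv
    · rw [← h0, zero_mul]
    · simp [hP _ (hC v hv).1, hP _ (hC v hv).2]
  have hsurj : C.image ℓ = Finset.univ := by
    refine Finset.eq_univ_of_forall fun i => ?_
    by_contra hi
    refine (hpos i).ne' (hzero _ fun a ha hai => hi ?_)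
    exact Finset.mem_image.2 ⟨a, ha, hai⟩
  have hinj : Set.InjOn ℓ C := by
    refine Finset.card_image_iff.1 (le_antisymm Finset.card_image_le ?_)
    rw [hsurj]
    simpa using hcard
  obtain ⟨s, hs, hs0⟩ := Finset.mem_image.1 (hsurj ▸ Finset.mem_univ (0 : Fin (n + 1)))
  have huniq : ∀ a ∈ C, ℓ a = 0 → a = s := fun a ha ha0 => hinj ha hs (ha0.trans hs0.symm)
  by_cases hb : bot s
  · left
    rw [mass_eq_interpolation h, mass_eq_interpolation h]
    refine Finset.sum_congr rfl fun v _ => ?_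
    rcases (H.nonneg v x).eq_or_lt with h0 | hv
    · rw [← h0, zero_mul, zero_mul]
    · have : ∀ a ∈ C, (ℓ a = 0 ∧ bot a) = (ℓ a = 0) := fun a ha =>
        propext ⟨And.left, fun h0 => ⟨h0, huniq a ha h0 ▸ hb⟩⟩
      simp only [this _ (hC v hv).1, this _ (hC v hv).2]
  · exact Or.inr (hzero _ fun a ha hab => hb (huniq a ha hab.1 ▸ hab.2))

/-- The map on the parameter space of `Δⁿ × [0, 1]²` which describes two points of a prism on the
same vertical line in terms of label coordinates. -/
noncomputable def pairMap (ℓ : A → Fin (n + 1)) (φ : V → ℕ → A) (s : Fin (n + 1) → V) (j j' : ℕ)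
    (y : (Fin n → ℝ) × ℝ × ℝ) : (Fin n → ℝ) × (Fin n → ℝ) :=
  let c : Fin (n + 1) → ℝ := Fin.cons (1 - ∑ i, y.1 i) y.1
  let e : ℕ → ℝ → Fin n → ℝ := fun k r i => ∑ m, c m *
    ((1 - r) * (if ℓ (φ (s m) k) = i.succ then 1 else 0) +
      r * (if ℓ (φ (s m) (k + 1)) = i.succ then 1 else 0))
  (e j y.2.1, e j' y.2.2)

theorem contDiff_pairMap {V : Type*} {φ : V → ℕ → A} (s : Fin (n + 1) → V) (j j' : ℕ) :
    ContDiff ℝ 1 (pairMap ℓ φ s j j') := by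
  have hc : ∀ m : Fin (n + 1), ContDiff ℝ 1 fun y : (Fin n → ℝ) × ℝ × ℝ =>
      (Fin.cons (1 - ∑ i, y.1 i) y.1 : Fin (n + 1) → ℝ) m := by
    intro m
    refine Fin.cases ?_ (fun i => ?_) m
    · simp only [Fin.cons_zero]
      fun_prop
    · simp only [Fin.cons_succ]
      fun_prop
  unfold pairMap
  refine ContDiff.prodMk (contDiff_pi.2 fun i => ContDiff.sum fun m _ => (hc m).mul ?_)
    (contDiff_pi.2 fun i => ContDiff.sum fun m _ => (hc m).mul ?_) <;> fun_prop

/-- Barycentric coordinates supported on at most `n + 1` vertices come from a parametrised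
`n`-simplex. -/
theorem exists_simplex_parametrisation (H : IsLabelledPrism J U κ φ ℓ bot) (x : X) :
    ∃ (s : Fin (n + 1) → V) (y : Fin n → ℝ), ∀ F : V → ℝ,
      ∑ v, κ v x * F v = ∑ m, (Fin.cons (1 - ∑ i, y i) y : Fin (n + 1) → ℝ) m * F (s m) := by
  classical
  obtain ⟨v₀, hv₀⟩ := H.exists_pos x
  let C := Finset.univ.filter fun v => 0 < κ v x
  have hcard : C.card ≤ n + 1 := H.card_vertices_le x C (by simp [C])
  obtain ⟨g⟩ : Nonempty (C ↪ Fin (n + 1)) := Function.Embedding.nonempty_of_card_le (by simpa)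
  let s : Fin (n + 1) → V := fun m => if h : ∃ v : C, g v = m then h.choose else v₀
  let c : Fin (n + 1) → ℝ := fun m => if ∃ v : C, g v = m then κ (s m) x else 0
  have hs : ∀ v : C, s (g v) = v := fun v => by
    have hex : ∃ w : C, g w = g v := ⟨v, rfl⟩
    simp only [s, dif_pos hex]
    exact congrArg _ (g.injective hex.choose_spec)
  have hsum : ∀ F : V → ℝ, ∑ v, κ v x * F v = ∑ m, c m * F (s m) := by
    intro F
    rw [← Finset.sum_subset (Finset.subset_univ C)]
    · rw [← Finset.sum_coe_sort C, ← Finset.sum_subset (Finset.subset_univ (Finset.univ.map g)),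
        Finset.sum_map]
      · refine Finset.sum_congr rfl fun v _ => ?_
        have hex : ∃ w : C, g w = g v := ⟨v, rfl⟩
        simp only [c, if_pos hex, hs]
      · intro m _ hm
        have : ¬ ∃ v : C, g v = m := fun ⟨v, hv⟩ => hm (by simp [← hv])
        simp only [c, if_neg this, zero_mul]
    · intro v _ hv
      have : κ v x = 0 := le_antisymm (not_lt.1 (by simpa [C] using hv)) (H.nonneg v x)
      rw [this, zero_mul]
  refine ⟨s, fun i => c i.succ, fun F => ?_⟩
  have hc : c 0 = 1 - ∑ i : Fin n, c i.succ := by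
    have := hsum fun _ => 1
    simp only [mul_one, H.sum_eq_one, Fin.sum_univ_succ] at this
    linarith
  rw [hsum, ← hc]
  exact Finset.sum_congr rfl fun m _ => by
    refine Fin.cases ?_ (fun i => ?_) m <;> simp

/-- When `3 ≤ n`, there are two interior points of the `n`-simplex, arbitrarily chosen outside a set
of dimension `n + 2`, which are not attained by the label coordinates on one vertical line. -/
theorem exists_generic_pair (hn : 3 ≤ n) (hJ : 0 < J) (H : IsLabelledPrism J U κ φ ℓ bot) :
    ∃ p q : Fin (n + 1) → ℝ, (∀ i, 0 < p i) ∧ (∀ i, 0 < q i) ∧ ∑ i, p i = 1 ∧ ∑ i, q i = 1 ∧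
      ∀ x, ∀ t ∈ Icc (0 : ℝ) J, ∀ t' ∈ Icc (0 : ℝ) J,
        ¬ ((∀ i, mass κ φ J (fun a => ℓ a = i) x t = p i) ∧
          ∀ i, mass κ φ J (fun a => ℓ a = i) x t' = q i) := by
  let E : Set ((Fin n → ℝ) × (Fin n → ℝ)) :=
    ⋃ z : (Fin (n + 1) → V) × Fin J × Fin J, range (pairMap ℓ φ z.1 z.2.1 z.2.2)
  have hE : Dense Eᶜ := by
    refine dense_compl_of_dimH_lt_finrank (lt_of_le_of_lt (b := ((n + 2 : ℕ) : ENNReal)) ?_ ?_)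
    · rw [dimH_iUnion]
      refine iSup_le fun z => ?_
      refine ((contDiff_pairMap (ℓ := ℓ) (φ := φ) z.1 z.2.1 z.2.2).dimH_range_le).trans ?_
      simp
    · simp only [Module.finrank_prod, Module.finrank_fin_fun]
      exact_mod_cast (by omega : n + 2 < n + n)
  let O : Set (Fin n → ℝ) := {y | (∀ i, 0 < y i) ∧ ∑ i, y i < 1}
  have hO : IsOpen O := by
    refine IsOpen.and ?_ (isOpen_lt (by fun_prop) continuous_const)
    simp only [ofPred_forall]
    exact isOpen_iInter_of_finite fun i => isOpen_lt continuous_const (continuous_apply i)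
  have hOne : O.Nonempty := by
    refine ⟨fun _ => 1 / (n + 1), fun _ => by positivity, ?_⟩
    simp only [Finset.sum_const, Finset.card_univ, Fintype.card_fin, nsmul_eq_mul]
    rw [mul_one_div, div_lt_one (by positivity)]
    linarith
  obtain ⟨⟨p, q⟩, ⟨hp, hq⟩, hpq⟩ := hE.inter_open_nonempty _ (hO.prod hO) (hOne.prod hOne)
  refine ⟨Fin.cons (1 - ∑ i, p i) p, Fin.cons (1 - ∑ i, q i) q, ?_, ?_, ?_, ?_, ?_⟩
  · exact fun i => Fin.cases (by simpa using hp.2) (fun i => by simpa using hp.1 i) i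
  · exact fun i => Fin.cases (by simpa using hq.2) (fun i => by simpa using hq.1 i) i
  · simp [Fin.sum_univ_succ]
  · simp [Fin.sum_univ_succ]
  · rintro x t ht t' ht' ⟨h, h'⟩
    obtain ⟨j, hj, r, -, hr⟩ := exists_sum_hat hJ ht
    obtain ⟨j', hj', r', -, hr'⟩ := exists_sum_hat hJ ht'
    obtain ⟨s, y, hy⟩ := H.exists_simplex_parametrisation x
    refine hpq (mem_iUnion.2 ⟨(s, ⟨j, hj⟩, ⟨j', hj'⟩), (y, r, r'), Prod.ext ?_ ?_⟩)
    · funext i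
      have := h i.succ
      rw [mass_eq_interpolation hr, hy] at this
      simpa [pairMap] using this
    · funext i
      have := h' i.succ
      rw [mass_eq_interpolation hr', hy] at this
      simpa [pairMap] using this

theorem hasThinShrinking_of_three_le [CompactSpace X] [T2Space X] (hn : 3 ≤ n) (hJ : 0 < J)
    (H : IsLabelledPrism J U κ φ ℓ bot) : HasThinShrinking U := by
  let G : Fin (n + 1) → X → ℝ → ℝ := fun i => mass κ φ J fun a => ℓ a = i
  let B : X → ℝ → ℝ := mass κ φ J fun a => ℓ a = 0 ∧ bot a
  obtain ⟨p, q, hp, hq, hp1, hq1, hgen⟩ := H.exists_generic_pair hn hJ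
  have hGc : ∀ i, Continuous fun z : X × ℝ => G i z.1 z.2 := fun i => H.continuous_mass _
  have hclosed : ∀ p : Fin (n + 1) → ℝ,
      IsClosed {x | ∃ t ∈ Icc (0 : ℝ) J, ∀ i, G i x t = p i} := by
    intro p
    have : IsCompact ((univ ×ˢ Icc (0 : ℝ) J) ∩ {z : X × ℝ | ∀ i, G i z.1 z.2 = p i}) := by
      refine (isCompact_univ.prod isCompact_Icc).inter_right ?_
      simp only [ofPred_forall]
      exact isClosed_iInter fun i => isClosed_eq (hGc i) continuous_const
    convert (this.image continuous_fst).isClosed using 1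
    ext x
    simp
  obtain ⟨f, hf0, hf1, hf⟩ := exists_continuous_zero_one_of_isClosed (hclosed q) (hclosed p) (by
    rw [Set.disjoint_left]
    rintro x ⟨t', ht', h'⟩ ⟨t, ht, h⟩
    exact hgen x t ht t' ht' ⟨h, h'⟩)
  let τ : X → ℝ := fun x => J * f x
  have hτc : Continuous τ := by fun_prop
  have hJ0 : (0 : ℝ) ≤ J := Nat.cast_nonneg J
  have hτ : ∀ x, τ x ∈ Icc (0 : ℝ) J := fun x =>
    ⟨mul_nonneg hJ0 (hf x).1, mul_le_of_le_one_right hJ0 (hf x).2⟩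
  let c := min (p 0) (q 0)
  have hc : 0 < c := lt_min (hp 0) (hq 0)
  let θ : X → ℝ := fun x => B x (τ x) / max (G 0 x (τ x)) c
  have hGτ : ∀ i, Continuous fun x => G i x (τ x) := fun i =>
    (hGc i).comp (continuous_id.prodMk hτc)
  have hBτ : Continuous fun x => B x (τ x) :=
    (H.continuous_mass fun a => ℓ a = 0 ∧ bot a).comp (continuous_id.prodMk hτc)
  have hθc : Continuous θ :=
    hBτ.div ((hGτ 0).max continuous_const) fun x => (hc.trans_le (le_max_right _ _)).ne'
  have hθ0 : ∀ x, 0 ≤ θ x := fun x =>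
    div_nonneg (H.mass_nonneg _ _ _) (hc.le.trans (le_max_right _ _))
  have hθ1 : ∀ x, θ x ≤ 1 := fun x =>
    div_le_one_of_le₀ ((H.mass_mono (fun _ => And.left) _ _).trans (le_max_left _ _))
      (hc.le.trans (le_max_right _ _))
  let P : Fin (n + 1) → X → ℝ := fun i x => θ x * p i + (1 - θ x) * q i
  have hPle : ∀ i x, min (p i) (q i) ≤ P i x := fun i x => by
    have h₁ := mul_le_mul_of_nonneg_left (min_le_left (p i) (q i)) (hθ0 x)
    have h₂ := mul_le_mul_of_nonneg_left (min_le_right (p i) (q i)) (sub_nonneg.2 (hθ1 x))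
    simp only [P]
    linarith
  have hPpos : ∀ i x, 0 < P i x := fun i x => (lt_min (hp i) (hq i)).trans_le (hPle i x)
  have hPsum : ∀ x, ∑ i, P i x = 1 := fun x => by
    simp only [P, Finset.sum_add_distrib, ← Finset.mul_sum, hp1, hq1]
    ring
  have hGsum : ∀ x, ∑ i, G i x (τ x) = 1 := fun x => H.sum_mass hJ x (hτ x)
  have hne : ∀ x, ¬ ∀ i, G i x (τ x) = P i x := by
    intro x hx
    have hG0 : 0 < G 0 x (τ x) := hx 0 ▸ hPpos 0 x
    have hmax : max (G 0 x (τ x)) c = G 0 x (τ x) := max_eq_left (hx 0 ▸ hPle 0 x)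
    rcases H.bot_dichotomy hJ (hτ x) (fun i => (hx i).symm ▸ hPpos i x) with hB | hB
    · have hθx : θ x = 1 := by
        simp only [θ, hmax, B, hB]
        exact div_self hG0.ne'
      have hτx : τ x = J := by
        have := hf1 ⟨τ x, hτ x, fun i => by simpa [P, hθx] using hx i⟩
        simp [τ, this]
      refine hG0.ne' (hB.symm.trans (mass_eq_zero (fun v k _ _ hk hb => ?_) H))
      rw [hτx, hat_natCast] at hk
      split_ifs at hk with hkJ
      · exact H.not_bot_top v (hkJ ▸ hb.2)
      · exact hk.false
    · have hθx : θ x = 0 := by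
        simp only [θ, B, hB, zero_div]
      have hτx : τ x = (0 : ℕ) := by
        have := hf0 ⟨τ x, hτ x, fun i => by simpa [P, hθx] using hx i⟩
        simp [τ, this]
      refine hG0.ne' (le_antisymm ?_ hG0.le)
      refine le_of_le_of_eq ?_ hB
      refine Finset.sum_le_sum fun v _ => mul_le_mul_of_nonneg_left
        (Finset.sum_le_sum fun k _ => ?_) (H.nonneg v x)
      rw [hτx, hat_natCast]
      split_ifs with h₀ h₁ h₂ <;> simp_all [H.bot_zero]
  refine ⟨fun i => {x | P i x < G i x (τ x)}, fun i => ?_, fun i x hx => ?_, ?_, ?_⟩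
  · exact isOpen_lt (by fun_prop) (hGτ i)
  · by_contra hxU
    refine ((hPpos i x).trans hx).ne' (mass_eq_zero (fun v k hv hk _ hl => hxU ?_) H)
    exact hl ▸ H.label_mem v x k hk hv
  · refine eq_univ_of_forall fun x => ?_
    by_contra hx
    simp only [mem_iUnion, mem_ofPred_eq, not_exists, not_lt] at hx
    refine hne x fun i => ?_
    exact (Finset.sum_eq_sum_iff_of_le fun i _ => hx i).1 ((hGsum x).trans (hPsum x).symm) i
      (Finset.mem_univ i)
  · refine eq_empty_of_forall_notMem fun x hx => ?_
    have hlt : ∀ i, P i x < G i x (τ x) := fun i => mem_iInter.1 hx i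
    have := Finset.sum_lt_sum_of_nonempty (Finset.univ_nonempty (α := Fin (n + 1)))
      fun i _ => hlt i
    rw [hPsum, hGsum] at this
    exact this.false

end General

end IsLabelledPrism

/-- A labelled prism over a compact Hausdorff space forces a thin shrinking. -/
theorem IsLabelledPrism.hasThinShrinking {X V A : Type*} [TopologicalSpace X] [CompactSpace X]
    [T2Space X] [Fintype V] {J : ℕ} (hJ : 0 < J) :
    ∀ {n : ℕ} {U : Fin (n + 1) → Set X} {κ : V → X → ℝ} {φ : V → ℕ → A} {ℓ : A → Fin (n + 1)}
      {bot : A → Prop}, IsLabelledPrism J U κ φ ℓ bot → HasThinShrinking U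
  | 0, _, _, _, _, _, H => by
    have := H.isEmpty
    exact ⟨fun _ => ∅, fun _ => isOpen_empty, fun _ => empty_subset _, Subsingleton.elim _ _,
      Subsingleton.elim _ _⟩
  | 1, _, _, _, _, _, H => H.hasThinShrinking_one
  | 2, _, _, _, _, _, H => H.hasThinShrinking_two
  | _ + 3, _, _, _, _, _, H => H.hasThinShrinking_of_three_le (by omega) hJ

/-- A version of the Lebesgue number lemma for sets of small diameter. -/
theorem exists_subset_of_ediam_lt {X ι : Type*} [PseudoMetricSpace X] [CompactSpace X] [Nonempty X]
    {U : ι → Set X} (hU : ∀ i, IsOpen (U i)) (hc : ⋃ i, U i = univ) :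
    ∃ ε > 0, ∀ s : Set X, Metric.ediam s < ENNReal.ofReal ε → ∃ i, s ⊆ U i := by
  obtain ⟨ε, hε, h⟩ := lebesgue_number_lemma_of_metric isCompact_univ hU hc.ge
  refine ⟨ε, hε, fun s hs => ?_⟩
  rcases s.eq_empty_or_nonempty with rfl | ⟨x, hx⟩
  · obtain ⟨i, -⟩ := h (Classical.arbitrary X) trivial
    exact ⟨i, empty_subset _⟩
  · obtain ⟨i, hi⟩ := h x trivial
    refine ⟨i, fun y hy => hi ?_⟩
    rw [mem_ball, ← ENNReal.ofReal_lt_ofReal_iff hε, ← edist_dist]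
    exact (Metric.edist_le_ediam_of_mem hy hx).trans_lt hs

/-- If `dim X ≤ m` fails, then all covers of `X × [0, 1]` with small first projections have
multiplicity at least `m + 2`, because their slices over `X × {0}` do. -/
theorem exists_pos_lt_card_of_not_dimLE {X : Type*} [MetricSpace X] [CompactSpace X] {m : ℕ}
    (h : ¬ DimLE X m) :
    ∃ ε > 0, ∀ α : Set (Set (X × unitInterval)),
      α.Finite → (∀ U ∈ α, IsOpen U) → ⋃₀ α = univ →
      (∀ U ∈ α, Metric.ediam (Prod.fst '' U) < ENNReal.ofReal ε) →
      ∃ S : Finset (Set (X × unitInterval)), ↑S ⊆ α ∧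
        (⋂₀ (S : Set (Set (X × unitInterval)))).Nonempty ∧ m + 2 ≤ S.card := by
  have hX : Nonempty X := not_isEmpty_iff.1 fun hX => h (Or.inl ⟨hX, by omega⟩)
  have h' := not_and.1 (not_exists.1 (not_or.1 h).2 m) rfl
  push Not at h'
  obtain ⟨𝒲, -, ho, hc, hW⟩ := h'
  obtain ⟨ε, hε, hsmall⟩ := exists_subset_of_ediam_lt (U := fun w : 𝒲 => (w : Set X))
    (fun w => ho w w.2) (by rwa [← sUnion_eq_iUnion])
  refine ⟨ε, hε, fun α hfin hopen hcov hdiam => ?_⟩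
  by_contra! hmult
  have := hfin.to_subtype
  let slice : α → Set X := fun a => (fun x => (x, (0 : unitInterval))) ⁻¹' (a : Set _)
  refine hW (range slice) (finite_range _) ?_ ?_ ?_ ?_
  · rintro _ ⟨a, rfl⟩
    exact (hopen a a.2).preimage (by fun_prop)
  · refine eq_univ_of_forall fun x => ?_
    obtain ⟨a, ha, hxa⟩ := (hcov.ge trivial : (x, (0 : unitInterval)) ∈ ⋃₀ α)
    exact ⟨_, ⟨⟨a, ha⟩, rfl⟩, hxa⟩
  · rintro _ ⟨a, rfl⟩
    obtain ⟨w, hw⟩ := hsmall _ (hdiam a a.2)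
    exact ⟨w, w.2, fun x hx => hw ⟨_, hx, rfl⟩⟩
  · refine multLE_range fun x T hT => ?_
    have := hmult (T.map (Function.Embedding.subtype _)) (by simp)
      ⟨(x, 0), by
        intro a ha
        obtain ⟨b, hb, rfl⟩ := Finset.mem_map.1 ha
        exact hT b hb⟩
    rw [Finset.card_map] at this
    omega

/-- A cover of `X × [0, 1]` of multiplicity at most `n + 1` separating the two ends, whose members
project into members of `U`, gives rise to a thin shrinking of `U`. -/
theorem hasThinShrinking_of_cover_prod {X : Type*} [MetricSpace X] [CompactSpace X] {n : ℕ}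
    (hdim : DimLE X n) (hX : Nonempty X) {U : Fin (n + 1) → Set X}
    {α : Set (Set (X × unitInterval))} (hopen : ∀ a ∈ α, IsOpen a) (hcov : ⋃₀ α = univ)
    (hsub : ∀ a ∈ α, ∃ i, Prod.fst '' a ⊆ U i)
    (hends : ∀ a ∈ α, ¬ ((a ∩ {p : X × unitInterval | p.2 = 0}).Nonempty ∧
      (a ∩ {p : X × unitInterval | p.2 = 1}).Nonempty))
    (hmult : MultLE α (n + 1)) : HasThinShrinking U := by
  classical
  choose! ℓ hℓ using hsub
  obtain ⟨δ, hδ, hleb⟩ := lebesgue_number_lemma_of_metric_sUnion isCompact_univ hopen hcov.ge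
  obtain ⟨J, hJ⟩ := exists_nat_one_div_lt hδ
  obtain ⟨m, hm, href⟩ := hdim.resolve_left fun h => not_isEmpty_iff.2 hX h.1
  obtain rfl : m = n := by exact_mod_cast hm
  obtain ⟨c, -, hcfin, hc⟩ := (isCompact_univ (X := X)).finite_cover_balls hδ
  obtain ⟨β, hβfin, hβo, hβc, hβr, hβm⟩ := href ((fun x => ball x δ) '' c) (hcfin.image _)
    (by rintro _ ⟨x, -, rfl⟩; exact isOpen_ball) (by rw [sUnion_image]; exact univ_subset_iff.1 hc)
  let V := {v : Set X // v ∈ β ∧ v.Nonempty}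
  have : Finite V := (hβfin.subset fun _ h => h.1 : {v | v ∈ β ∧ v.Nonempty}.Finite).to_subtype
  have : Fintype V := Fintype.ofFinite V
  let t : ℕ → unitInterval := fun j => projIcc 0 1 zero_le_one ((j : ℝ) / (J + 1))
  have ht0 : t 0 = 0 := by simp [t]
  have ht1 : t (J + 1) = 1 := by
    have : ((J + 1 : ℕ) : ℝ) / (J + 1) = 1 := by
      rw [Nat.cast_succ]
      exact div_self (by positivity)
    simp only [t, this]
    exact projIcc_right _
  have htt : ∀ j, dist (t j) (t (j + 1)) < δ := fun j => by
    refine (abs_projIcc_sub_projIcc _).trans_lt (lt_of_eq_of_lt ?_ hJ)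
    rw [Nat.cast_succ, ← sub_div, sub_add_cancel_left, abs_div, abs_neg, abs_one,
      abs_of_pos (by positivity)]
  have hball : ∀ v : V, ∃ x : X, (v : Set X) ⊆ ball x δ := fun v => by
    obtain ⟨_, ⟨x, -, rfl⟩, hx⟩ := hβr v v.2.1
    exact ⟨x, hx⟩
  choose z hz using hball
  choose φ hφα hφ using fun (v : V) (j : ℕ) => hleb (z v, t j) trivial
  have hmem : ∀ (v : V) (j : ℕ), ∀ x ∈ (v : Set X), ∀ s, dist s (t j) < δ → (x, s) ∈ φ v j :=
    fun v j x hx s hs => hφ v j (by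
      rw [mem_ball, Prod.dist_eq]
      exact max_lt (hz v hx) hs)
  have hself : ∀ (v : V) (j : ℕ), ∀ x ∈ (v : Set X), (x, t j) ∈ φ v j :=
    fun v j x hx => hmem v j x hx _ (by rwa [dist_self])
  obtain ⟨f, hf⟩ := PartitionOfUnity.exists_isSubordinate isClosed_univ (fun v : V => (v : Set X))
    (fun v => hβo v v.2.1) (fun x _ => by
      obtain ⟨v, hv, hx⟩ := (hβc.ge trivial : x ∈ ⋃₀ β)
      exact mem_iUnion.2 ⟨⟨v, hv, x, hx⟩, hx⟩)
  have hfv : ∀ v x, 0 < f v x → x ∈ (v : Set X) := fun v x hx =>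
    hf v (subset_closure hx.ne')
  refine IsLabelledPrism.hasThinShrinking (J := J + 1) (κ := fun v => f v) (φ := φ) (ℓ := ℓ)
    (bot := fun a => (a ∩ {p : X × unitInterval | p.2 = 0}).Nonempty) (Nat.succ_pos J)
    ⟨fun v => (f v).continuous, f.nonneg, fun x => ?_, fun v x j _ hx => ?_, fun x S hS => ?_,
      fun x j _ S hS => ?_, fun v => ?_, fun v hv => ?_⟩
  · rw [← finsum_eq_sum_of_fintype]
    exact f.sum_eq_one trivial
  · exact hℓ _ (hφα v j) ⟨_, hself v j x (hfv v x hx), rfl⟩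
  · have := hβm (S.map (Function.Embedding.subtype _)) (by
      intro v hv
      obtain ⟨w, -, rfl⟩ := Finset.mem_map.1 hv
      exact w.2.1) ⟨x, by
      intro v hv
      obtain ⟨w, hw, rfl⟩ := Finset.mem_map.1 hv
      exact hfv w x (hS w hw)⟩
    rwa [Finset.card_map] at this
  · refine hmult S (fun a ha => ?_) ⟨(x, t j), fun a ha => ?_⟩
    · obtain ⟨v, -, rfl | rfl⟩ := hS a ha <;> exact hφα _ _
    · obtain ⟨v, hv, rfl | rfl⟩ := hS a ha
      · exact hself v j x (hfv v x hv)
      · exact hmem v _ x (hfv v x hv) _ (htt j)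
  · obtain ⟨x, hx⟩ := v.2.2
    exact ⟨(x, t 0), hself v 0 x hx, ht0⟩
  · obtain ⟨x, hx⟩ := v.2.2
    exact hends _ (hφα v _) ⟨hv, (x, t (J + 1)), hself v _ x hx, ht1⟩

/-- If `X` is a compact metric space with `dim X ≥ n` (i.e.
`dim X ≤ n − 1` fails), then there is `ε > 0` such that every finite open cover of
`X × [0,1]` whose members have first projections of diameter `< ε` and none of which
meets both `X × {0}` and `X × {1}` has multiplicity at least `n + 2`. -/
theorem statement12 {X : Type*} [MetricSpace X] [CompactSpace X] (n : ℕ)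
    (hdim : ¬ DimLE X ((n : ℤ) - 1)) :
    ∃ ε > 0, ∀ α : Set (Set (X × unitInterval)),
      α.Finite → (∀ U ∈ α, IsOpen U) → ⋃₀ α = univ →
      (∀ U ∈ α, EMetric.diam (Prod.fst '' U) < ENNReal.ofReal ε) →
      (∀ U ∈ α, ¬ ((U ∩ {p : X × unitInterval | p.2 = 0}).Nonempty ∧
                   (U ∩ {p : X × unitInterval | p.2 = 1}).Nonempty)) →
      ∃ S : Finset (Set (X × unitInterval)), ↑S ⊆ α ∧
        (⋂₀ (S : Set (Set (X × unitInterval)))).Nonempty ∧ n + 2 ≤ S.card := by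
  obtain ⟨U, hUo, hUc, hU⟩ := exists_cover_not_hasThinShrinking hdim
  by_cases hn : DimLE X n
  · have hX : Nonempty X := not_isEmpty_iff.1 fun hX => hdim (Or.inl ⟨hX, by omega⟩)
    obtain ⟨ε, hε, hsmall⟩ := exists_subset_of_ediam_lt hUo hUc
    refine ⟨ε, hε, fun α _ hopen hcov hdiam hends => ?_⟩
    by_contra! hmult
    exact hU (hasThinShrinking_of_cover_prod hn hX hopen hcov
      (fun a ha => hsmall _ (hdiam a ha)) hends fun S hS hne => Nat.lt_succ_iff.1 (hmult S hS hne))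
  · obtain ⟨ε, hε, h⟩ := exists_pos_lt_card_of_not_dimLE hn
    exact ⟨ε, hε, fun α hfin hopen hcov hdiam _ => h α hfin hopen hcov hdiam⟩
end
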